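/- There exists an absolute constant ε₁ > 0 with the following property: if (v,p) is a suitable weak solution of the Navier–Stokes equations in Q_T = Ω×(0,T), z₀ ∈ Q_T and r > 0 are such that the closure of Q_{z₀,r} is contained in Q_T, and the weak spatial gradient satisfies ‖∇v‖_{L^{3/2,∞}_{x,t}(Q_{z₀,r})} ≤ ε₁, then z₀ is a regular point of v. -/

import Mathlib

open MeasureTheory Set Filter ENNReal

noncomputable section

/-- Euclidean 3-space. -/
abbrev E3 := EuclideanSpace ℝ (Fin 3)

/-- The parabolic cylinder `Q_{z,r} = B_{x,r} × (t - r², t)`. -/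
def pcyl (z : E3 × ℝ) (r : ℝ) : Set (E3 × ℝ) :=
  (Metric.ball z.1 r) ×ˢ (Ioo (z.2 - r ^ 2) z.2)

/-- The mixed space-time norm `‖f‖_{L^{γ,α}_{x,t}(B × (a,b))}`,
with the essential-supremum modification when an exponent is `∞`. -/
def mixedNorm {F : Type*} [NormedAddCommGroup F]
    (f : E3 × ℝ → F) (B : Set E3) (a b : ℝ) (γ α : ℝ≥0∞) : ℝ≥0∞ :=
  if α = ∞ then
    essSup (fun t => eLpNorm (fun x => f (x, t)) γ (volume.restrict B))
      (volume.restrict (Ioo a b))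
  else
    (∫⁻ t in Ioo a b,
      (eLpNorm (fun x => f (x, t)) γ (volume.restrict B)) ^ α.toReal) ^ (1 / α.toReal)

/-- `f ∈ L^{γ,α}_{x,t}(B × (a,b))`. -/
def MemMixed {F : Type*} [NormedAddCommGroup F]
    (f : E3 × ℝ → F) (B : Set E3) (a b : ℝ) (γ α : ℝ≥0∞) : Prop :=
  mixedNorm f B a b γ α < ∞

/-- Vector in `ℝ³` from coordinates. -/
def vec3 (a b c : ℝ) : E3 := (WithLp.equiv 2 (Fin 3 → ℝ)).symm ![a, b, c]

/-- Cross product in `ℝ³`. -/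
def cross3 (u w : E3) : E3 :=
  vec3 (u 1 * w 2 - u 2 * w 1) (u 2 * w 0 - u 0 * w 2) (u 0 * w 1 - u 1 * w 0)

/-- The unit direction `w/|w|`, interpreted as `0` when `w = 0`. -/
def unitd (w : E3) : E3 := ‖w‖⁻¹ • w

/-- Spatial partial derivative (in direction `i`) of a function on space-time. -/
def sdz {F : Type*} [NormedAddCommGroup F] [NormedSpace ℝ F]
    (φ : E3 × ℝ → F) (i : Fin 3) (z : E3 × ℝ) : F :=
  fderiv ℝ φ z (EuclideanSpace.single i 1, 0)

/-- Time derivative of a function on space-time. -/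
def tdz {F : Type*} [NormedAddCommGroup F] [NormedSpace ℝ F]
    (φ : E3 × ℝ → F) (z : E3 × ℝ) : F :=
  fderiv ℝ φ z (0, 1)

/-- The vorticity `ω = curl v` built from the (weak) velocity gradient
`Dv`, where `Dv z j i` represents `∂_j v_i (z)`. -/
def curlOf (Dv : E3 × ℝ → Fin 3 → Fin 3 → ℝ) (z : E3 × ℝ) : E3 :=
  vec3 (Dv z 1 2 - Dv z 2 1) (Dv z 2 0 - Dv z 0 2) (Dv z 0 1 - Dv z 1 0)

/-- A `3×3` matrix regarded as a Euclidean vector (so that its norm is the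
Frobenius norm). -/
def frob (M : Fin 3 → Fin 3 → ℝ) : EuclideanSpace ℝ (Fin 3 × Fin 3) :=
  (WithLp.equiv 2 (Fin 3 × Fin 3 → ℝ)).symm fun q => M q.1 q.2

/-- `(v, p)` is a suitable weak solution of the Navier–Stokes equations on
`Q_T = Ω × (0,T)`, with weak spatial gradient `Dv` (`Dv z j i = ∂_j v_i (z)`)
and initial data `v₀`. -/
structure IsSuitableWeakSolution (Ω : Set E3) (T : ℝ) (v : E3 × ℝ → E3)
    (Dv : E3 × ℝ → Fin 3 → Fin 3 → ℝ) (p : E3 × ℝ → ℝ) (v₀ : E3 → E3) : Prop where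
  meas_v : Measurable v
  meas_Dv : Measurable Dv
  meas_p : Measurable p
  /-- `Dv` is the weak spatial gradient of `v`. -/
  weak_grad : ∀ ψ : E3 → ℝ, ContDiff ℝ (⊤ : ℕ∞) ψ → HasCompactSupport ψ → tsupport ψ ⊆ Ω →
    ∀ᵐ t ∂(volume.restrict (Ioo 0 T)), ∀ i j : Fin 3,
      ∫ x in Ω, v (x, t) j * fderiv ℝ ψ x (EuclideanSpace.single i 1) =
        - ∫ x in Ω, Dv (x, t) i j * ψ x
  /-- `v ∈ L^∞(0,T;L²(Ω))`. -/
  v_linf_l2 : MemMixed v Ω 0 T 2 ∞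
  /-- `v ∈ L²(0,T;W^{1,2}(Ω))`. -/
  v_l2_w12 : IntegrableOn (fun z => ‖v z‖ ^ 2 + ∑ i, ∑ j, (Dv z i j) ^ 2) (Ω ×ˢ Ioo 0 T)
  /-- `p ∈ L^{3/2}(Q_T)`. -/
  p_l32 : IntegrableOn (fun z => |p z| ^ (3 / 2 : ℝ)) (Ω ×ˢ Ioo 0 T)
  /-- The weak form of the Navier–Stokes equations. -/
  weak_nse : ∀ φ : E3 × ℝ → E3, ContDiff ℝ (⊤ : ℕ∞) φ → HasCompactSupport φ →
    tsupport φ ⊆ Ω ×ˢ Iio T →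
    ∫ z in Ω ×ˢ Ioo 0 T,
        (-(∑ i, v z i * tdz φ z i) + (∑ i, ∑ j, v z j * Dv z j i * φ z i)
          + (∑ i, ∑ j, Dv z j i * sdz φ j z i) - p z * ∑ i, sdz φ i z i)
      = ∫ x in Ω, ∑ i, v₀ x i * φ (x, 0) i
  /-- `div v = 0` weakly. -/
  div_free : ∀ ψ : E3 × ℝ → ℝ, ContDiff ℝ (⊤ : ℕ∞) ψ → HasCompactSupport ψ →
    tsupport ψ ⊆ Ω ×ˢ Ioo 0 T →
    ∫ z in Ω ×ˢ Ioo 0 T, ∑ i, v z i * sdz ψ i z = 0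
  /-- The local energy inequality. -/
  local_energy : ∀ᵐ t ∂(volume.restrict (Ioo 0 T)), ∀ φ : E3 × ℝ → ℝ,
    ContDiff ℝ (⊤ : ℕ∞) φ → HasCompactSupport φ → tsupport φ ⊆ Ω ×ˢ Ioo 0 T → (∀ z, 0 ≤ φ z) →
    (∫ x in Ω, ‖v (x, t)‖ ^ 2 * φ (x, t))
        + 2 * ∫ z in Ω ×ˢ Ioo 0 t, (∑ i, ∑ j, (Dv z i j) ^ 2) * φ z
      ≤ ∫ z in Ω ×ˢ Ioo 0 t,
          (‖v z‖ ^ 2 * (tdz φ z + ∑ i, sdz (fun w => sdz φ i w) i z)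
            + (‖v z‖ ^ 2 + 2 * p z) * ∑ i, v z i * sdz φ i z)

/-- `z` is a regular point of `v`: `v` is essentially bounded on some parabolic
cylinder `Q_{z,r} ⊆ Q_T`. -/
def RegularPoint (Ω : Set E3) (T : ℝ) (v : E3 × ℝ → E3) (z : E3 × ℝ) : Prop :=
  ∃ r > 0, pcyl z r ⊆ Ω ×ˢ Ioo 0 T ∧
    ∃ M : ℝ, ∀ᵐ w ∂(volume.restrict (pcyl z r)), ‖v w‖ ≤ M

/-- `z` is a singular point of `v` in `Q_T`. -/
def SingularPoint (Ω : Set E3) (T : ℝ) (v : E3 × ℝ → E3) (z : E3 × ℝ) : Prop :=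
  z ∈ Ω ×ˢ Ioo 0 T ∧ ¬ RegularPoint Ω T v z


section
def pd (z w : E3 × ℝ) : ℝ := max ‖z.1 - w.1‖ (√|z.2 - w.2|)
def PB (z : E3 × ℝ) (R : ℝ) : Set (E3 × ℝ) := {w | pd z w < R}
def pk (β : ℝ) (z w : E3 × ℝ) : ℝ≥0∞ := (ENNReal.ofReal (pd z w)) ^ (-β)
lemma pd_comm (z w : E3 × ℝ) : pd z w = pd w z := by
  unfold pd; rw [norm_sub_rev, abs_sub_comm]
lemma pk_comm (β : ℝ) (z w : E3 × ℝ) : pk β z w = pk β w z := by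
  unfold pk; rw [pd_comm]
lemma pd_nonneg (z w : E3 × ℝ) : 0 ≤ pd z w := le_max_of_le_left (norm_nonneg _)
lemma pd_tri (z w y : E3 × ℝ) : pd z y ≤ pd z w + pd w y := by
  unfold pd
  apply max_le
  · calc ‖z.1 - y.1‖ = ‖(z.1 - w.1) + (w.1 - y.1)‖ := by congr 1; abel
      _ ≤ _ := norm_add_le _ _
      _ ≤ _ := add_le_add (le_max_left _ _) (le_max_left _ _)
  · calc √|z.2 - y.2| ≤ √(|z.2 - w.2| + |w.2 - y.2|) := by
          apply Real.sqrt_le_sqrt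
          exact abs_sub_le _ _ _
      _ ≤ √|z.2 - w.2| + √|w.2 - y.2| := by
          rw [Real.sqrt_le_iff]; constructor
          · positivity
          · nlinarith [Real.sq_sqrt (abs_nonneg (z.2-w.2)), Real.sq_sqrt (abs_nonneg (w.2-y.2)), Real.sqrt_nonneg |z.2-w.2|, Real.sqrt_nonneg |w.2-y.2|, mul_nonneg (Real.sqrt_nonneg |z.2-w.2|) (Real.sqrt_nonneg |w.2-y.2|)]
      _ ≤ _ := add_le_add (le_max_right _ _) (le_max_right _ _)
lemma pd_continuous : Continuous (fun q : (E3 × ℝ) × (E3 × ℝ) => pd q.1 q.2) := by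
  unfold pd; fun_prop
lemma pd_measurable : Measurable (fun q : (E3 × ℝ) × (E3 × ℝ) => pd q.1 q.2) := by
  unfold pd
  have h1 : Measurable (fun q : (E3 × ℝ) × (E3 × ℝ) => q.1.1 - q.2.1) :=
    (measurable_fst.comp measurable_fst).sub (measurable_fst.comp measurable_snd)
  have h2 : Measurable (fun q : (E3 × ℝ) × (E3 × ℝ) => q.1.2 - q.2.2) :=
    (measurable_snd.comp measurable_fst).sub (measurable_snd.comp measurable_snd)
  exact h1.norm.max (Real.continuous_sqrt.measurable.comp (continuous_abs.measurable.comp h2))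
lemma pd_measurable_right (z : E3 × ℝ) : Measurable (fun w : E3 × ℝ => pd z w) := by
  unfold pd
  have h1 : Measurable (fun q : E3 × ℝ => z.1 - q.1) := measurable_const.sub measurable_fst
  have h2 : Measurable (fun q : E3 × ℝ => z.2 - q.2) := measurable_const.sub measurable_snd
  exact h1.norm.max (Real.continuous_sqrt.measurable.comp (continuous_abs.measurable.comp h2))
lemma pk_measurable (β : ℝ) : Measurable (fun q : (E3 × ℝ) × (E3 × ℝ) => pk β q.1 q.2) :=
  (pd_measurable.ennreal_ofReal).pow_const _
lemma pk_measurable_right (β : ℝ) (z : E3 × ℝ) : Measurable (fun w : E3 × ℝ => pk β z w) :=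
  ((pd_measurable_right z).ennreal_ofReal).pow_const _
lemma measurableSet_PB (z : E3 × ℝ) (R : ℝ) : MeasurableSet (PB z R) :=
  measurableSet_lt (pd_measurable_right z) measurable_const
lemma mem_PB_comm {z w : E3 × ℝ} {R : ℝ} : w ∈ PB z R ↔ z ∈ PB w R := by
  simp only [PB, mem_ofPred_eq, pd_comm]
lemma pd_eq_zero {z w : E3 × ℝ} (h : pd z w = 0) : w = z := by
  have h1 : ‖z.1 - w.1‖ ≤ 0 := h ▸ le_max_left _ _
  have h2 : √|z.2 - w.2| ≤ 0 := h ▸ le_max_right _ _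
  have h3 : z.1 - w.1 = 0 := norm_le_zero_iff.1 h1
  have h4 : |z.2 - w.2| ≤ 0 := Real.sqrt_eq_zero'.1 (le_antisymm h2 (Real.sqrt_nonneg _))
  have h5 : z.2 - w.2 = 0 := abs_nonpos_iff.1 h4
  exact Prod.ext (sub_eq_zero.1 h3).symm (sub_eq_zero.1 h5).symm
lemma PB_eq (z : E3 × ℝ) {R : ℝ} (hR : 0 < R) :
    PB z R = Metric.ball z.1 R ×ˢ Metric.ball z.2 (R ^ 2) := by
  ext w
  simp only [PB, pd, mem_ofPred_eq, mem_prod, Metric.mem_ball, max_lt_iff, dist_eq_norm]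
  rw [norm_sub_rev, Real.sqrt_lt' hR, abs_sub_comm, Real.norm_eq_abs]
def cV : ℝ≥0∞ := 2 * volume (Metric.ball (0 : E3) 1)
lemma cV_ne_top : cV ≠ ∞ := by
  unfold cV
  exact mul_ne_top (by simp) measure_ball_lt_top.ne
lemma vol_PB (z : E3 × ℝ) {R : ℝ} (hR : 0 < R) :
    volume (PB z R) = cV * ENNReal.ofReal R ^ (5 : ℝ) := by
  rw [PB_eq z hR, Measure.volume_eq_prod, Measure.prod_prod, Measure.addHaar_ball _ _ hR.le,
    Real.volume_ball, cV]
  have : Module.finrank ℝ E3 = 3 := by simp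
  rw [this, ofReal_mul (by norm_num), ofReal_pow hR.le, ofReal_pow hR.le,
    show (5 : ℝ) = ((5 : ℕ) : ℝ) by norm_num, rpow_natCast]
  simp only [ofReal_ofNat]
  ring
def geo (x : ℝ) : ℝ≥0∞ := ∑' k : ℕ, ((2 : ℝ≥0∞) ^ (-x)) ^ k
lemma geo_ne_top {x : ℝ} (hx : 0 < x) : geo x ≠ ∞ := by
  unfold geo
  rw [tsum_geometric, Ne, inv_eq_top, tsub_eq_zero_iff_le, not_le]
  exact rpow_lt_one_of_one_lt_of_neg (by norm_num) (by linarith)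
lemma two_pow_real (k : ℕ) : ENNReal.ofReal ((2:ℝ) ^ k) = (2 : ℝ≥0∞) ^ (k : ℝ) := by
  rw [ofReal_pow (by norm_num), rpow_natCast]; simp
lemma near_lemma {β m : ℝ} (hβ : 0 < β) (hm : β < m) (z : E3 × ℝ) (g : E3 × ℝ → ℝ≥0∞)
    {R : ℝ} (hR : 0 < R) (A : ℝ≥0∞)
    (h : ∀ ρ, 0 < ρ → ρ ≤ R → ∫⁻ w in PB z ρ, g w ≤ A * ENNReal.ofReal ρ ^ m) :
    ∫⁻ w in PB z R, pk β z w * g w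
      ≤ (2 ^ β * geo (m - β)) * (A * ENNReal.ofReal R ^ (m - β)) := by
  set ρ : ℕ → ℝ := fun k => R * (1 / 2) ^ k with hρ
  have hρ0 : ∀ k, 0 < ρ k := fun k => by positivity
  have hcov : PB z R ⊆ (⋃ k, (PB z (ρ k) \ PB z (ρ (k+1)))) ∪ {z} := by
    intro w hw
    by_cases hz : pd z w = 0
    · right; exact pd_eq_zero hz
    left
    have hpos : 0 < pd z w := lt_of_le_of_ne (pd_nonneg _ _) (Ne.symm hz)
    have hw' : pd z w < R := hw
    have hex : ∃ k, ρ k ≤ pd z w := by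
      obtain ⟨n, hn⟩ := exists_pow_lt_of_lt_one (div_pos hpos hR) (by norm_num : (1/2 : ℝ) < 1)
      exact ⟨n, by rw [lt_div_iff₀ hR] at hn; simp only [hρ]; linarith⟩
    classical
    have h1 := Nat.find_spec hex
    obtain ⟨k, hk⟩ : ∃ k, Nat.find hex = k + 1 := by
      apply Nat.exists_eq_succ_of_ne_zero
      intro h0
      rw [h0] at h1
      simp [hρ] at h1; linarith
    have h2 := Nat.find_min hex (m := k) (by omega)
    rw [hk] at h1
    refine mem_iUnion.2 ⟨k, ?_, ?_⟩
    · simpa [PB] using h2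
    · simpa [PB] using h1
  have hz0 : volume ({z} : Set (E3 × ℝ)) = 0 := by
    rw [show ({z} : Set (E3 × ℝ)) = {z.1} ×ˢ {z.2} by simp, Measure.volume_eq_prod, Measure.prod_prod]; simp
  have hterm : ∀ k : ℕ, ∫⁻ w in PB z (ρ k) \ PB z (ρ (k+1)), pk β z w * g w
      ≤ 2 ^ β * (A * ENNReal.ofReal R ^ (m - β)) * ((2 : ℝ≥0∞) ^ (-(m - β))) ^ k := by
    intro k
    have hms : MeasurableSet (PB z (ρ k) \ PB z (ρ (k+1))) :=
      (measurableSet_PB _ _).diff (measurableSet_PB _ _)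
    calc ∫⁻ w in PB z (ρ k) \ PB z (ρ (k+1)), pk β z w * g w
        ≤ ∫⁻ w in PB z (ρ k) \ PB z (ρ (k+1)), ENNReal.ofReal (ρ (k+1)) ^ (-β) * g w := by
          refine setLIntegral_mono' hms fun w hw => ?_
          gcongr
          unfold pk
          rw [rpow_neg, rpow_neg, ENNReal.inv_le_inv]
          refine rpow_le_rpow ?_ hβ.le
          apply ofReal_le_ofReal
          have := hw.2
          simpa [PB] using this
      _ = ENNReal.ofReal (ρ (k+1)) ^ (-β) * ∫⁻ w in PB z (ρ k) \ PB z (ρ (k+1)), g w := by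
          rw [lintegral_const_mul']
          apply rpow_ne_top_of_ne_zero
          · simpa using hρ0 (k+1)
          · simp
      _ ≤ ENNReal.ofReal (ρ (k+1)) ^ (-β) * (A * ENNReal.ofReal (ρ k) ^ m) := by
          gcongr
          refine (lintegral_mono_set sdiff_subset).trans (h _ (hρ0 k) ?_)
          simp only [hρ]
          exact mul_le_of_le_one_right hR.le (pow_le_one₀ (by norm_num) (by norm_num))
      _ = _ := by
          have e : ∀ k, ENNReal.ofReal (ρ k) = ENNReal.ofReal R * (2 : ℝ≥0∞) ^ (-(k : ℝ)) := by
            intro k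
            simp only [hρ]
            rw [ofReal_mul hR.le, one_div, inv_pow, ofReal_inv_of_pos (by positivity),
              two_pow_real, rpow_neg]
          have hR0 : ENNReal.ofReal R ≠ 0 := by simpa using hR
          have hRt : ENNReal.ofReal R ≠ ∞ := by simp
          rw [e, e, mul_rpow_of_ne_zero hR0 (by simp), mul_rpow_of_ne_zero hR0 (by simp),
            ← rpow_mul, ← rpow_mul, ← rpow_natCast, ← rpow_mul,
            sub_eq_add_neg m β, rpow_add _ _ hR0 hRt]
          have : (2:ℝ≥0∞) ^ (-((k+1 : ℕ):ℝ) * -β) * 2 ^ (-(k:ℝ) * m)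
              = 2 ^ β * 2 ^ (-(m + -β) * (k:ℝ)) := by
            rw [← rpow_add _ _ (by norm_num) (by norm_num),
              ← rpow_add _ _ (by norm_num) (by norm_num)]
            congr 1; push_cast; ring
          calc _ = ENNReal.ofReal R ^ (-β) * ENNReal.ofReal R ^ m * A *
                ((2:ℝ≥0∞) ^ (-((k+1 : ℕ):ℝ) * -β) * 2 ^ (-(k:ℝ) * m)) := by ring
            _ = _ := by rw [this]; ring
  calc ∫⁻ w in PB z R, pk β z w * g w
      ≤ ∫⁻ w in (⋃ k, (PB z (ρ k) \ PB z (ρ (k+1)))) ∪ {z}, pk β z w * g w :=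
        lintegral_mono_set hcov
    _ ≤ (∫⁻ w in (⋃ k, (PB z (ρ k) \ PB z (ρ (k+1)))), pk β z w * g w)
        + ∫⁻ w in {z}, pk β z w * g w := lintegral_union_le _ _ _
    _ = ∫⁻ w in (⋃ k, (PB z (ρ k) \ PB z (ρ (k+1)))), pk β z w * g w := by
        rw [setLIntegral_measure_zero _ _ hz0, add_zero]
    _ ≤ ∑' k, ∫⁻ w in PB z (ρ k) \ PB z (ρ (k+1)), pk β z w * g w := lintegral_iUnion_le _ _
    _ ≤ ∑' k : ℕ, 2 ^ β * (A * ENNReal.ofReal R ^ (m - β)) * ((2 : ℝ≥0∞) ^ (-(m - β))) ^ k :=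
        ENNReal.tsum_le_tsum hterm
    _ = _ := by rw [ENNReal.tsum_mul_left, geo]; ring
lemma far_lemma {β m : ℝ} (hβ : 0 < β) (hm : m < β) (z : E3 × ℝ) (g : E3 × ℝ → ℝ≥0∞)
    {R : ℝ} (hR : 0 < R) (A : ℝ≥0∞)
    (h : ∀ ρ, R ≤ ρ → ∫⁻ w in PB z ρ, g w ≤ A * ENNReal.ofReal ρ ^ m) :
    ∫⁻ w in (PB z R)ᶜ, pk β z w * g w
      ≤ (2 ^ m * geo (β - m)) * (A * ENNReal.ofReal R ^ (m - β)) := by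
  set ρ : ℕ → ℝ := fun k => R * 2 ^ k with hρ
  have hρ0 : ∀ k, 0 < ρ k := fun k => by positivity
  have hcov : (PB z R)ᶜ ⊆ (⋃ k, (PB z (ρ (k+1)) \ PB z (ρ k))) := by
    intro w hw
    have hw' : R ≤ pd z w := by simpa [PB] using hw
    have hex : ∃ k, pd z w < ρ k := by
      obtain ⟨n, hn⟩ := pow_unbounded_of_one_lt (pd z w / R) (by norm_num : (1 : ℝ) < 2)
      exact ⟨n, by rw [div_lt_iff₀ hR] at hn; simp only [hρ]; linarith⟩
    classical
    have h1 := Nat.find_spec hex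
    obtain ⟨k, hk⟩ : ∃ k, Nat.find hex = k + 1 := by
      apply Nat.exists_eq_succ_of_ne_zero
      intro h0
      rw [h0] at h1
      simp [hρ] at h1; linarith
    have h2 := Nat.find_min hex (m := k) (by omega)
    rw [hk] at h1
    refine mem_iUnion.2 ⟨k, h1, ?_⟩
    simpa [PB] using h2
  have hterm : ∀ k : ℕ, ∫⁻ w in PB z (ρ (k+1)) \ PB z (ρ k), pk β z w * g w
      ≤ 2 ^ m * (A * ENNReal.ofReal R ^ (m - β)) * ((2 : ℝ≥0∞) ^ (-(β - m))) ^ k := by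
    intro k
    have hms : MeasurableSet (PB z (ρ (k+1)) \ PB z (ρ k)) :=
      (measurableSet_PB _ _).diff (measurableSet_PB _ _)
    calc ∫⁻ w in PB z (ρ (k+1)) \ PB z (ρ k), pk β z w * g w
        ≤ ∫⁻ w in PB z (ρ (k+1)) \ PB z (ρ k), ENNReal.ofReal (ρ k) ^ (-β) * g w := by
          refine setLIntegral_mono' hms fun w hw => ?_
          gcongr
          unfold pk
          rw [rpow_neg, rpow_neg, ENNReal.inv_le_inv]
          refine rpow_le_rpow ?_ hβ.le
          apply ofReal_le_ofReal
          have := hw.2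
          simpa [PB] using this
      _ = ENNReal.ofReal (ρ k) ^ (-β) * ∫⁻ w in PB z (ρ (k+1)) \ PB z (ρ k), g w := by
          rw [lintegral_const_mul']
          apply rpow_ne_top_of_ne_zero
          · simpa using hρ0 k
          · simp
      _ ≤ ENNReal.ofReal (ρ k) ^ (-β) * (A * ENNReal.ofReal (ρ (k+1)) ^ m) := by
          gcongr
          refine (lintegral_mono_set sdiff_subset).trans (h _ ?_)
          simp only [hρ]
          exact le_mul_of_one_le_right hR.le (one_le_pow₀ (by norm_num))
      _ = _ := by
          have e : ∀ k, ENNReal.ofReal (ρ k) = ENNReal.ofReal R * (2 : ℝ≥0∞) ^ (k : ℝ) := by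
            intro k
            simp only [hρ]
            rw [ofReal_mul hR.le, two_pow_real]
          have hR0 : ENNReal.ofReal R ≠ 0 := by simpa using hR
          have hRt : ENNReal.ofReal R ≠ ∞ := by simp
          rw [e, e, mul_rpow_of_ne_zero hR0 (by simp), mul_rpow_of_ne_zero hR0 (by simp),
            ← rpow_mul, ← rpow_mul, ← rpow_natCast, ← rpow_mul,
            sub_eq_add_neg m β, rpow_add _ _ hR0 hRt]
          have : (2:ℝ≥0∞) ^ ((k:ℝ) * -β) * 2 ^ (((k+1:ℕ):ℝ) * m)
              = 2 ^ m * 2 ^ (-(β - m) * (k:ℝ)) := by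
            rw [← rpow_add _ _ (by norm_num) (by norm_num),
              ← rpow_add _ _ (by norm_num) (by norm_num)]
            congr 1; push_cast; ring
          calc _ = ENNReal.ofReal R ^ (-β) * ENNReal.ofReal R ^ m * A *
                ((2:ℝ≥0∞) ^ ((k:ℝ) * -β) * 2 ^ (((k+1:ℕ):ℝ) * m)) := by ring
            _ = _ := by rw [this]; ring
  calc ∫⁻ w in (PB z R)ᶜ, pk β z w * g w
      ≤ ∫⁻ w in (⋃ k, (PB z (ρ (k+1)) \ PB z (ρ k))), pk β z w * g w := lintegral_mono_set hcov
    _ ≤ ∑' k, ∫⁻ w in PB z (ρ (k+1)) \ PB z (ρ k), pk β z w * g w := lintegral_iUnion_le _ _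
    _ ≤ ∑' k : ℕ, 2 ^ m * (A * ENNReal.ofReal R ^ (m - β)) * ((2 : ℝ≥0∞) ^ (-(β - m))) ^ k :=
        ENNReal.tsum_le_tsum hterm
    _ = _ := by rw [ENNReal.tsum_mul_left, geo]; ring
end
section
lemma pk_split {b1 b2 p q : ℝ} (h1 : 0 ≤ b1) (h2 : 0 ≤ b2) (hp : 0 ≤ p) (hq : 0 ≤ q) (z w : E3 × ℝ) :
    pk b1 z w ^ p * pk b2 z w ^ q = pk (b1 * p + b2 * q) z w := by
  unfold pk
  rw [rpow_neg, rpow_neg, rpow_neg, ← inv_rpow, ← inv_rpow,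
    ← inv_rpow, ← rpow_mul, ← rpow_mul, rpow_add_of_nonneg]
  · positivity
  · positivity
lemma PB_mono {z : E3 × ℝ} {a b : ℝ} (h : a ≤ b) : PB z a ⊆ PB z b := fun _ hw => lt_of_lt_of_le hw h
lemma PB_sub {z w : E3 × ℝ} {a b : ℝ} (h : w ∈ PB z a) : PB w b ⊆ PB z (a + b) := by
  intro y hy
  exact lt_of_le_of_lt (pd_tri z w y) (add_lt_add h hy)
lemma adams : ∃ C : ℝ≥0∞, C ≠ ∞ ∧ ∀ (g : E3 × ℝ → ℝ≥0∞), Measurable g →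
    ∀ (r : ℝ) (A : ℝ≥0∞), 0 < r →
    (∀ w ρ, 0 < ρ → ρ ≤ r → ∫⁻ y in PB w ρ, g y ≤ A * ENNReal.ofReal ρ ^ (3:ℝ)) →
    (∀ w ρ, r ≤ ρ → ∫⁻ y in PB w ρ, g y
      ≤ (A * ENNReal.ofReal r ^ (-(3/4) : ℝ)) * ENNReal.ofReal ρ ^ (15/4:ℝ)) →
    ∀ z, ∫⁻ w in PB z r, (∫⁻ y, pk 4 w y * g y) ^ (9/5:ℝ)
      ≤ C * A ^ (9/5:ℝ) * ENNReal.ofReal r ^ (16/5 : ℝ) := by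
  set c1 : ℝ≥0∞ := (2 ^ (23/8:ℝ) * geo (3 - 23/8)) with hc1
  set c2 : ℝ≥0∞ := (2 ^ (49/10:ℝ) * geo (5 - 49/10)) * cV with hc2
  set c3 : ℝ≥0∞ := (2 ^ (15/4:ℝ) * geo (4 - 15/4)) with hc3
  have h1t : c1 ≠ ∞ := mul_ne_top (by simp) (geo_ne_top (by norm_num))
  have h2t : c2 ≠ ∞ := mul_ne_top (mul_ne_top (by simp) (geo_ne_top (by norm_num))) cV_ne_top
  have h3t : c3 ≠ ∞ := mul_ne_top (by simp) (geo_ne_top (by norm_num))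
  refine ⟨2 ^ (4/5:ℝ) * (c1 ^ (4/5:ℝ) * c2 * 2 ^ (15/4:ℝ) + c3 ^ (9/5:ℝ) * cV), ?_, ?_⟩
  · have := cV_ne_top
    finiteness
  intro g hg r A hr hn hf z
  set R := ENNReal.ofReal r with hR
  have hR0 : R ≠ 0 := by simpa [hR] using hr
  have hRt : R ≠ ∞ := by simp [hR]
  have near2 : ∀ w, ∫⁻ y in PB w r, pk (23/8) w y * g y ≤ c1 * (A * R ^ (3 - 23/8:ℝ)) := fun w =>
    near_lemma (by norm_num) (by norm_num) w g hr A (hn w)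
  have nearH : ∀ w, (∫⁻ y in PB w r, pk 4 w y * g y) ^ (9/5:ℝ)
      ≤ (c1 * (A * R ^ (3 - 23/8:ℝ))) ^ (4/5:ℝ) * ∫⁻ y in PB w r, pk (49/10) w y * g y := by
    intro w
    have e : ∀ y, pk 4 w y * g y = (pk (49/10) w y * g y) ^ (5/9:ℝ) * (pk (23/8) w y * g y) ^ (4/9:ℝ) := by
      intro y
      rw [mul_rpow_of_nonneg _ _ (by norm_num), mul_rpow_of_nonneg _ _ (by norm_num)]
      have h1 := pk_split (b1 := 49/10) (b2 := 23/8) (p := 5/9) (q := 4/9) (by norm_num) (by norm_num)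
        (by norm_num) (by norm_num) w y
      have h2 : g y ^ (5/9:ℝ) * g y ^ (4/9:ℝ) = g y := by
        rw [← rpow_add_of_nonneg _ _ (by norm_num) (by norm_num)]; norm_num
      rw [mul_mul_mul_comm, h1, h2]; norm_num
    have hH := lintegral_mul_norm_pow_le (μ := volume.restrict (PB w r))
      (f := fun y => pk (49/10) w y * g y) (g := fun y => pk (23/8) w y * g y)
      ((pk_measurable_right _ w).mul hg).aemeasurable ((pk_measurable_right _ w).mul hg).aemeasurable
      (p := 5/9) (q := 4/9) (by norm_num) (by norm_num) (by norm_num)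
    simp_rw [← e] at hH
    calc (∫⁻ y in PB w r, pk 4 w y * g y) ^ (9/5:ℝ)
        ≤ ((∫⁻ y in PB w r, pk (49/10) w y * g y) ^ (5/9:ℝ) *
            (∫⁻ y in PB w r, pk (23/8) w y * g y) ^ (4/9:ℝ)) ^ (9/5:ℝ) := by gcongr
      _ = (∫⁻ y in PB w r, pk (49/10) w y * g y) * (∫⁻ y in PB w r, pk (23/8) w y * g y) ^ (4/5:ℝ) := by
          rw [mul_rpow_of_nonneg _ _ (by norm_num), ← rpow_mul, ← rpow_mul]
          norm_num
      _ ≤ (∫⁻ y in PB w r, pk (49/10) w y * g y) * (c1 * (A * R ^ (3 - 23/8:ℝ))) ^ (4/5:ℝ) := by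
          gcongr; exact near2 w
      _ = _ := mul_comm _ _
  have far : ∀ w, ∫⁻ y in (PB w r)ᶜ, pk 4 w y * g y ≤ c3 * (A * R ^ (-(3/4):ℝ) * R ^ (15/4 - 4:ℝ)) := fun w =>
    far_lemma (by norm_num) (by norm_num) w g hr _ (hf w)
  have ker : ∀ y, ∫⁻ w in PB y r, pk (49/10) y w ≤ c2 * R ^ (1/10:ℝ) := by
    intro y
    have := near_lemma (β := 49/10) (m := 5) (by norm_num) (by norm_num) y (fun _ => 1) hr cV
      (by intro ρ h0 _; simp [vol_PB y h0])
    simp only [mul_one] at this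
    refine this.trans (le_of_eq ?_)
    rw [hc2]; norm_num; ring
  have ton : ∫⁻ w in PB z r, ∫⁻ y in PB w r, pk (49/10) w y * g y
      ≤ c2 * R ^ (1/10:ℝ) * (A * R ^ (-(3/4):ℝ) * ENNReal.ofReal (2*r) ^ (15/4:ℝ)) := by
    have hmeas : Measurable (fun q : (E3 × ℝ) × (E3 × ℝ) =>
        {q : (E3 × ℝ) × (E3 × ℝ) | pd q.1 q.2 < r}.indicator (fun q => pk (49/10) q.1 q.2) q * g q.2) :=
      ((pk_measurable _).indicator (measurableSet_lt pd_measurable measurable_const)).mul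
        (hg.comp measurable_snd)
    calc ∫⁻ w in PB z r, ∫⁻ y in PB w r, pk (49/10) w y * g y
        ≤ ∫⁻ w in PB z r, ∫⁻ y in PB z (2*r),
          {q : (E3 × ℝ) × (E3 × ℝ) | pd q.1 q.2 < r}.indicator (fun q => pk (49/10) q.1 q.2) (w, y) * g y := by
          refine setLIntegral_mono' (measurableSet_PB _ _) fun w hw => ?_
          rw [← lintegral_indicator (measurableSet_PB _ _), ← lintegral_indicator (measurableSet_PB _ _)]
          refine lintegral_mono fun y => ?_
          by_cases hy : y ∈ PB w r
          · have hy2 : y ∈ PB z (2*r) := by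
              have := PB_sub hw hy
              rwa [← two_mul] at this
            have hy3 : (w, y) ∈ {q : (E3 × ℝ) × (E3 × ℝ) | pd q.1 q.2 < r} := hy
            rw [indicator_of_mem hy, indicator_of_mem hy2, indicator_of_mem hy3]
          · simp [hy]
      _ = ∫⁻ y in PB z (2*r), ∫⁻ w in PB z r,
          {q : (E3 × ℝ) × (E3 × ℝ) | pd q.1 q.2 < r}.indicator (fun q => pk (49/10) q.1 q.2) (w, y) * g y :=
          lintegral_lintegral_swap hmeas.aemeasurable
      _ ≤ ∫⁻ y in PB z (2*r), c2 * R ^ (1/10:ℝ) * g y := by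
          refine lintegral_mono fun y => ?_
          have hm : Measurable fun w : E3 × ℝ =>
            {q : (E3 × ℝ) × (E3 × ℝ) | pd q.1 q.2 < r}.indicator (fun q => pk (49/10) q.1 q.2) (w, y) :=
            ((pk_measurable _).indicator (measurableSet_lt pd_measurable measurable_const)).comp
              (measurable_id.prodMk measurable_const)
          rw [lintegral_mul_const _ hm]
          gcongr
          refine (setLIntegral_le_lintegral _ _).trans (le_trans (le_of_eq ?_) (ker y))
          rw [← lintegral_indicator (measurableSet_PB _ _)]
          refine lintegral_congr fun w => ?_
          by_cases hy : w ∈ PB y r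
          · have hy3 : (w, y) ∈ {q : (E3 × ℝ) × (E3 × ℝ) | pd q.1 q.2 < r} := mem_PB_comm.1 hy
            rw [indicator_of_mem hy, indicator_of_mem hy3, pk_comm]
          · have hy3 : (w, y) ∉ {q : (E3 × ℝ) × (E3 × ℝ) | pd q.1 q.2 < r} := fun h => hy (mem_PB_comm.1 h)
            rw [indicator_of_notMem hy, indicator_of_notMem hy3]
      _ = c2 * R ^ (1/10:ℝ) * ∫⁻ y in PB z (2*r), g y := lintegral_const_mul _ hg
      _ ≤ _ := by gcongr; exact hf z (2*r) (by linarith)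
  have e2r : ENNReal.ofReal (2*r) ^ (15/4:ℝ) = 2 ^ (15/4:ℝ) * R ^ (15/4:ℝ) := by
    rw [ofReal_mul (by norm_num), mul_rpow_of_nonneg _ _ (by norm_num)]; simp [hR]
  set F := c3 * (A * R ^ (-(3/4):ℝ) * R ^ (15/4 - 4:ℝ)) with hF
  set N := (c1 * (A * R ^ (3 - 23/8:ℝ))) ^ (4/5:ℝ) with hN
  have pr : ∀ a b : ℝ, R ^ a * R ^ b = R ^ (a + b) := fun a b => (rpow_add a b hR0 hRt).symm
  have prm : ∀ a b : ℝ, (R ^ a) ^ b = R ^ (a * b) := fun a b => (rpow_mul _ a b).symm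
  calc ∫⁻ w in PB z r, (∫⁻ y, pk 4 w y * g y) ^ (9/5:ℝ)
      ≤ ∫⁻ w in PB z r, 2 ^ (4/5:ℝ) * (N * (∫⁻ y in PB w r, pk (49/10) w y * g y) + F ^ (9/5:ℝ)) := by
        refine lintegral_mono fun w => ?_
        rw [← lintegral_add_compl _ (measurableSet_PB w r)]
        refine (rpow_add_le_mul_rpow_add_rpow _ _ (by norm_num)).trans ?_
        norm_num
        gcongr
        · exact nearH w
        · exact far w
    _ = 2 ^ (4/5:ℝ) * (N * (∫⁻ w in PB z r, ∫⁻ y in PB w r, pk (49/10) w y * g y) + F ^ (9/5:ℝ) * volume (PB z r)) := by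
        have hmm : Measurable fun w : E3 × ℝ => ∫⁻ y in PB w r, pk (49/10) w y * g y := by
          have : Measurable (fun q : (E3 × ℝ) × (E3 × ℝ) =>
            {q : (E3 × ℝ) × (E3 × ℝ) | pd q.1 q.2 < r}.indicator (fun q => pk (49/10) q.1 q.2 * g q.2) q) :=
            ((pk_measurable _).mul (hg.comp measurable_snd)).indicator
              (measurableSet_lt pd_measurable measurable_const)
          have h2 := this.lintegral_prod_right' (ν := volume)
          convert h2 using 2 with w
          rw [← lintegral_indicator (measurableSet_PB _ _)]
          rfl
        rw [lintegral_const_mul _ ((hmm.const_mul _).add_const _), lintegral_add_right _ measurable_const,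
          lintegral_const_mul _ hmm]
        simp
    _ ≤ 2 ^ (4/5:ℝ) * (N * (c2 * R ^ (1/10:ℝ) * (A * R ^ (-(3/4):ℝ) * ENNReal.ofReal (2*r) ^ (15/4:ℝ)))
          + F ^ (9/5:ℝ) * (cV * R ^ (5:ℝ))) := by
        rw [vol_PB z hr]
        gcongr
    _ = _ := by
        have hA : A ^ (4/5:ℝ) * A = A ^ (9/5:ℝ) := by
          nth_rewrite 2 [← rpow_one A]
          rw [← rpow_add_of_nonneg _ _ (by norm_num) (by norm_num)]; norm_num
        rw [e2r, hN, hF]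
        simp only [mul_rpow_of_nonneg _ _ (show (0:ℝ) ≤ 4/5 by norm_num),
          mul_rpow_of_nonneg _ _ (show (0:ℝ) ≤ 9/5 by norm_num), prm]
        have q1 : R ^ ((3 - 23/8) * (4/5) : ℝ) * (R ^ (1/10:ℝ) * (R ^ (-(3/4):ℝ) * R ^ (15/4:ℝ))) = R ^ (16/5:ℝ) := by
          rw [pr, pr, pr]; norm_num
        have q2 : R ^ (-(3/4) * (9/5) : ℝ) * (R ^ ((15/4-4)*(9/5):ℝ) * R ^ (5:ℝ)) = R ^ (16/5:ℝ) := by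
          rw [pr, pr]; norm_num
        calc _ = 2 ^ (4/5:ℝ) * (c1 ^ (4/5:ℝ) * c2 * 2 ^ (15/4:ℝ) * (A ^ (4/5:ℝ) * A) *
              (R ^ ((3 - 23/8) * (4/5) : ℝ) * (R ^ (1/10:ℝ) * (R ^ (-(3/4):ℝ) * R ^ (15/4:ℝ))))
              + c3 ^ (9/5:ℝ) * cV * A ^ (9/5:ℝ) *
              (R ^ (-(3/4) * (9/5) : ℝ) * (R ^ ((15/4-4)*(9/5):ℝ) * R ^ (5:ℝ)))) := by ring
          _ = _ := by rw [q1, q2, hA]; ring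
end
section
lemma interp3 {ε : ℝ≥0∞} {f : E3 × ℝ → ℝ≥0∞} (hf : Measurable f)
    (h3 : ∀ z ρ, 0 < ρ → ∫⁻ w in PB z ρ, f w ^ (3:ℝ) ≤ ε ^ (3:ℝ) * ENNReal.ofReal ρ ^ (2:ℝ))
    {a : ℝ} (ha : 0 < a) (ha3 : a < 3) (z : E3 × ℝ) {ρ : ℝ} (hρ : 0 < ρ) :
    ∫⁻ w in PB z ρ, f w ^ a ≤ cV ^ (1 - a/3) * ε ^ a * ENNReal.ofReal ρ ^ (5 - a) := by
  have hH := lintegral_mul_norm_pow_le (μ := volume.restrict (PB z ρ))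
      (f := fun y => f y ^ (3:ℝ)) (g := fun y => 1)
      (hf.pow_const _).aemeasurable aemeasurable_const
      (p := a/3) (q := 1-a/3) (by linarith) (by linarith) (by ring)
  simp only [← rpow_mul, one_rpow, mul_one, lintegral_const, one_mul,
    Measure.restrict_apply_univ, vol_PB z hρ] at hH
  rw [show 3 * (a/3) = a by ring] at hH
  have hR0 : ENNReal.ofReal ρ ≠ 0 := by simpa using hρ
  refine hH.trans ((mul_le_mul_left (rpow_le_rpow (h3 z ρ hρ) (by linarith)) _).trans (le_of_eq ?_))
  rw [mul_rpow_of_nonneg _ _ (by linarith), mul_rpow_of_nonneg _ _ (by linarith),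
    ← rpow_mul, ← rpow_mul, ← rpow_mul,
    show 5 - a = 2 * (a/3) + 5 * (1 - a/3) by ring, rpow_add _ _ hR0 (by simp),
    show 3 * (a/3) = a by ring]
  ring
theorem morrey_iter (C : ℝ≥0∞) (hC : C ≠ ∞) : ∃ ε₀ : ℝ≥0∞, 0 < ε₀ ∧ ∀ ε ≤ ε₀,
    ∀ f : E3 × ℝ → ℝ≥0∞, Measurable f →
    (∀ z ρ, 0 < ρ → ∫⁻ w in PB z ρ, f w ^ (3:ℝ) ≤ ε ^ (3:ℝ) * ENNReal.ofReal ρ ^ (2:ℝ)) →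
    ∀ (z0 : E3 × ℝ) (a : ℝ) (M : ℝ≥0∞), 0 < a → a ≤ 1 → M ≠ ∞ →
    (∀ᵐ z, z ∈ PB z0 a → f z ≤ M + C * ∫⁻ w, pk 4 z w * f w ^ (2:ℝ)) →
    ∃ M' : ℝ≥0∞, M' ≠ ∞ ∧ ∀ᵐ z, z ∈ PB z0 (a/4) → f z ≤ M' := by
  obtain ⟨CA, hCA, adams⟩ := adams
  have hcV := cV_ne_top
  set c4 : ℝ≥0∞ := (cV ^ (1 - (9/4)/3:ℝ)) ^ (4/9:ℝ) with hc4
  have hc4t : c4 ≠ ∞ := by finiteness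
  set D : ℝ≥0∞ := 2 * C * (CA ^ (5/9:ℝ) * c4) with hD
  have hDt : D ≠ ∞ := by finiteness
  refine ⟨min 1 (2 * D + 1)⁻¹, ?_, ?_⟩
  · simp [hDt, mul_ne_top]
  intro ε hε f hf h3 z0 a M ha ha1 hM hrep
  have hεt : ε ≠ ∞ := ((hε.trans (min_le_left _ _)).trans_lt (by simp)).ne
  have hDε : D * ε ≤ 2⁻¹ := by
    calc D * ε ≤ D * (2 * D + 1)⁻¹ := by gcongr; exact hε.trans (min_le_right _ _)
      _ ≤ 2⁻¹ := by
        rw [← div_eq_mul_inv]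
        refine div_le_of_le_mul ?_
        rw [mul_add, ← mul_assoc, ENNReal.inv_mul_cancel (by simp) (by simp), one_mul]
        exact le_self_add
  set η : E3 × ℝ → ℝ≥0∞ := fun z => ENNReal.ofReal (1 - pd z0 z / a) with hη
  have hηm : Measurable η := by
    have := pd_measurable_right z0
    exact (measurable_const.sub (this.div_const a)).ennreal_ofReal
  have hη1 : ∀ z, η z ≤ 1 := fun z => by
    rw [hη, ofReal_le_one]
    have := div_nonneg (pd_nonneg z0 z) ha.le; linarith
  set u : E3 × ℝ → ℝ≥0∞ := fun z => η z * f z with hu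
  have hum : Measurable u := hηm.mul hf
  have huf : ∀ z, u z ≤ f z := fun z => mul_le_of_le_one_left' (hη1 z)
  set c2 : ℝ≥0∞ := cV ^ (1 - 2/3:ℝ) * ε ^ (2:ℝ) with hc2
  have hc2t : c2 ≠ ∞ := by finiteness
  have h2 : ∀ z ρ, 0 < ρ → ∫⁻ w in PB z ρ, f w ^ (2:ℝ) ≤ c2 * ENNReal.ofReal ρ ^ (3:ℝ) := by
    intro z ρ hρ
    have := interp3 hf h3 (a := 2) (by norm_num) (by norm_num) z hρ
    rwa [show (5:ℝ) - 2 = 3 by norm_num] at this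
  set cf : ℝ≥0∞ := 2 ^ (3:ℝ) * geo (4 - 3) * c2 with hcf
  have hcft : cf ≠ ∞ := by
    have := geo_ne_top (x := 4 - 3) (by norm_num)
    finiteness
  have far : ∀ z ρ, 0 < ρ → ∫⁻ w in (PB z ρ)ᶜ, pk 4 z w * f w ^ (2:ℝ) ≤ cf * (ENNReal.ofReal ρ)⁻¹ := by
    intro z ρ hρ
    have := far_lemma (β := 4) (m := 3) (by norm_num) (by norm_num) z (fun w => f w ^ (2:ℝ)) hρ c2
      (fun ρ' h => h2 z ρ' (hρ.trans_le h))
    rw [show (3:ℝ) - 4 = -1 by norm_num, rpow_neg_one] at this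
    rw [hcf]; refine this.trans (le_of_eq (by ring))
  set M1 : ℝ≥0∞ := M + C * (cf * (ENNReal.ofReal (a/2))⁻¹) with hM1
  have ha2 : ENNReal.ofReal (a/2) ≠ 0 := by simp; linarith
  have hM1t : M1 ≠ ∞ := by finiteness
  have hηpos : ∀ z, z ∈ PB z0 a → 0 < 1 - pd z0 z / a := by
    intro z hz
    have : pd z0 z < a := hz
    rw [sub_pos, div_lt_one ha]; exact this
  have hueq : ∀ᵐ z, u z ≤ (PB z0 a).indicator (fun _ => M1) z + 2 * C * ∫⁻ w, pk 4 z w * (u w * f w) := by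
    filter_upwards [hrep] with z hz
    by_cases hza : z ∈ PB z0 a
    swap
    · have : η z = 0 := by
        have h' : a ≤ pd z0 z := by simpa [PB] using hza
        simp only [hη, ofReal_eq_zero]
        have := (one_le_div ha).2 h'; linarith
      simp [hu, this]
    rw [indicator_of_mem hza]
    have hp := hηpos z hza
    set t := 1 - pd z0 z / a with ht
    have hρ : 0 < a/2 * t := by positivity
    have near : η z * ∫⁻ w in PB z (a/2 * t), pk 4 z w * f w ^ (2:ℝ) ≤ 2 * ∫⁻ w, pk 4 z w * (u w * f w) := by
      rw [← lintegral_const_mul' _ _ (by simp [hη]), ← lintegral_const_mul' _ _ (by simp)]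
      refine le_trans (setLIntegral_mono' (measurableSet_PB _ _) fun w hw => ?_) (setLIntegral_le_lintegral _ _)
      have hηw : η z ≤ 2 * η w := by
        have h1 : pd z w < a/2 * t := hw
        have h2 := pd_tri z0 z w
        simp only [hη]
        rw [show (2:ℝ≥0∞) = ENNReal.ofReal 2 by simp, ← ofReal_mul (by norm_num)]
        apply ofReal_le_ofReal
        have h3 : pd z0 w / a ≤ pd z0 z / a + t/2 := by
          rw [div_add' _ _ _ ha.ne', div_le_div_iff_of_pos_right ha]; nlinarith
        linarith
      calc η z * (pk 4 z w * f w ^ (2:ℝ)) ≤ (2 * η w) * (pk 4 z w * f w ^ (2:ℝ)) := by gcongr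
        _ = _ := by simp only [hu, rpow_two]; ring
    have farz : η z * ∫⁻ w in (PB z (a/2 * t))ᶜ, pk 4 z w * f w ^ (2:ℝ) ≤ cf * (ENNReal.ofReal (a/2))⁻¹ := by
      refine (mul_le_mul_right (far z _ hρ) _).trans ?_
      rw [ofReal_mul (by linarith), ENNReal.mul_inv (Or.inl ha2) (Or.inl (by simp))]
      have : η z * (ENNReal.ofReal t)⁻¹ ≤ 1 := ENNReal.mul_inv_le_one _
      calc _ = cf * (ENNReal.ofReal (a/2))⁻¹ * (η z * (ENNReal.ofReal t)⁻¹) := by ring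
        _ ≤ cf * (ENNReal.ofReal (a/2))⁻¹ * 1 := by gcongr
        _ = _ := mul_one _
    calc u z ≤ η z * (M + C * ∫⁻ w, pk 4 z w * f w ^ (2:ℝ)) := by
          simp only [hu]; gcongr; exact hz hza
      _ = η z * M + C * (η z * (∫⁻ w in PB z (a/2 * t), pk 4 z w * f w ^ (2:ℝ))
            + η z * ∫⁻ w in (PB z (a/2 * t))ᶜ, pk 4 z w * f w ^ (2:ℝ)) := by
          rw [← lintegral_add_compl _ (measurableSet_PB z (a/2*t))]; ring
      _ ≤ 1 * M + C * (2 * (∫⁻ w, pk 4 z w * (u w * f w)) + cf * (ENNReal.ofReal (a/2))⁻¹) := by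
          gcongr; exact hη1 z
      _ = _ := by rw [hM1]; ring
  set K : ℝ≥0∞ := M1 * cV ^ (5/9:ℝ) with hK
  have hKt : K ≠ ∞ := by finiteness
  have key : ∀ δ : ℝ, 0 < δ → ∀ z r, 0 < r → (∫⁻ w in PB z r, u w ^ (9/5:ℝ)) ^ (5/9:ℝ)
      ≤ 2 * K * (ENNReal.ofReal r ^ (16/9:ℝ) * ENNReal.ofReal (max r δ) ^ (3/4:ℝ)) := by
    intro δ hδ
    set W : ℝ → ℝ≥0∞ := fun r => ENNReal.ofReal r ^ (16/9:ℝ) * ENNReal.ofReal (max r δ) ^ (3/4:ℝ) with hW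
    have hW0 : ∀ r, 0 < r → W r ≠ 0 := by
      intro r hr
      simp [hW, hr]
    have hWt : ∀ r, W r ≠ ∞ := by
      intro r
      simp only [hW]; finiteness
    set S : ℝ≥0∞ := ⨆ z : E3 × ℝ, ⨆ r : {r : ℝ // 0 < r}, (∫⁻ w in PB z r, u w ^ (9/5:ℝ)) ^ (5/9:ℝ) / W r with hS
    have hSle : ∀ z r, 0 < r → (∫⁻ w in PB z r, u w ^ (9/5:ℝ)) ^ (5/9:ℝ) ≤ S * W r := by
      intro z r hr
      rw [← ENNReal.div_le_iff (hW0 r hr) (hWt r)]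
      exact le_trans (le_iSup (fun r : {r : ℝ // 0 < r} => (∫⁻ w in PB z r, u w ^ (9/5:ℝ)) ^ (5/9:ℝ) / W r) ⟨r, hr⟩)
        (le_iSup (fun z => ⨆ r : {r : ℝ // 0 < r}, (∫⁻ w in PB z r, u w ^ (9/5:ℝ)) ^ (5/9:ℝ) / W r) z)
    have hSge : ∀ B, (∀ z r, 0 < r → (∫⁻ w in PB z r, u w ^ (9/5:ℝ)) ^ (5/9:ℝ) ≤ B * W r) → S ≤ B := by
      intro B hB
      refine iSup_le fun z => iSup_le fun r => ?_
      rw [ENNReal.div_le_iff (hW0 r r.2) (hWt r)]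
      exact hB z r r.2
    have hSt : S ≠ ∞ := by
      have : S ≤ (cV ^ (1 - (9/5)/3:ℝ) * ε ^ (9/5:ℝ)) ^ (5/9:ℝ) * (ENNReal.ofReal δ ^ (3/4:ℝ))⁻¹ := by
        apply hSge
        intro z r hr
        have h1 := interp3 hf h3 (a := 9/5) (by norm_num) (by norm_num) z hr
        have hδ0 : ENNReal.ofReal δ ^ (3/4:ℝ) ≠ 0 := by simp [hδ]
        have hδt : ENNReal.ofReal δ ^ (3/4:ℝ) ≠ ∞ := by finiteness
        calc (∫⁻ w in PB z r, u w ^ (9/5:ℝ)) ^ (5/9:ℝ) ≤ (∫⁻ w in PB z r, f w ^ (9/5:ℝ)) ^ (5/9:ℝ) := by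
              gcongr with w; exact huf w
          _ ≤ (cV ^ (1 - (9/5)/3:ℝ) * ε ^ (9/5:ℝ) * ENNReal.ofReal r ^ (5 - 9/5:ℝ)) ^ (5/9:ℝ) := by gcongr
          _ = (cV ^ (1 - (9/5)/3:ℝ) * ε ^ (9/5:ℝ)) ^ (5/9:ℝ) * ENNReal.ofReal r ^ (16/9:ℝ) := by
              rw [mul_rpow_of_nonneg _ _ (by norm_num), ← rpow_mul (ENNReal.ofReal r)]
              norm_num
          _ = (cV ^ (1 - (9/5)/3:ℝ) * ε ^ (9/5:ℝ)) ^ (5/9:ℝ) * (ENNReal.ofReal δ ^ (3/4:ℝ))⁻¹ *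
                (ENNReal.ofReal r ^ (16/9:ℝ) * ENNReal.ofReal δ ^ (3/4:ℝ)) := by
              rw [mul_assoc, mul_left_comm (ENNReal.ofReal δ ^ (3/4:ℝ))⁻¹, ENNReal.inv_mul_cancel hδ0 hδt, mul_one]
          _ ≤ _ := by
              simp only [hW]; gcongr; exact le_max_right _ _
      refine ne_top_of_le_ne_top ?_ this
      have : ENNReal.ofReal δ ^ (3/4:ℝ) ≠ 0 := by simp [hδ]
      finiteness
    have huf1 : ∀ w ρ, 0 < ρ → ∫⁻ y in PB w ρ, u y * f y
        ≤ S * (c4 * ε) * ENNReal.ofReal (max ρ δ) ^ (3/4:ℝ) * ENNReal.ofReal ρ ^ (3:ℝ) := by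
      intro w ρ hρ
      have hH := lintegral_mul_norm_pow_le (μ := volume.restrict (PB w ρ))
        (f := fun y => u y ^ (9/5:ℝ)) (g := fun y => f y ^ (9/4:ℝ))
        (hum.pow_const _).aemeasurable (hf.pow_const _).aemeasurable
        (p := 5/9) (q := 4/9) (by norm_num) (by norm_num) (by norm_num)
      simp only [← rpow_mul] at hH
      norm_num at hH
      have h1 := interp3 hf h3 (a := 9/4) (by norm_num) (by norm_num) w hρ
      have hR0 : ENNReal.ofReal ρ ≠ 0 := by simpa using hρ
      calc ∫⁻ y in PB w ρ, u y * f y ≤ _ := hH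
        _ ≤ (S * W ρ) * (cV ^ (1 - (9/4)/3:ℝ) * ε ^ (9/4:ℝ) * ENNReal.ofReal ρ ^ (5 - 9/4:ℝ)) ^ (4/9:ℝ) := by
            gcongr; exact hSle w ρ hρ
        _ = _ := by
            rw [mul_rpow_of_nonneg _ _ (by norm_num), mul_rpow_of_nonneg _ _ (by norm_num),
              ← hc4, ← rpow_mul, ← rpow_mul,
              show (3:ℝ) = 16/9 + (5 - 9/4) * (4/9) by norm_num, rpow_add _ _ hR0 (by simp),
              show (9/4 * (4/9) : ℝ) = 1 by norm_num, rpow_one]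
            simp only [hW]; ring
    have hstep : S ≤ K + D * ε * S := by
      apply hSge
      intro z r hr
      set A : ℝ≥0∞ := S * (c4 * ε) * ENNReal.ofReal (max r δ) ^ (3/4:ℝ) with hA
      have hr0 : ENNReal.ofReal r ≠ 0 := by simpa using hr
      have had := adams (fun y => u y * f y) (hum.mul hf) r A hr
        (fun w ρ h0 h1 => (huf1 w ρ h0).trans (by
          rw [hA]; gcongr)) (fun w ρ h1 => (huf1 w ρ (hr.trans_le h1)).trans (by
          have h0 := hr.trans_le h1
          have e1 : max ρ δ ≤ max r δ * (ρ / r) := by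
            rw [← mul_div_assoc, le_div_iff₀ hr]
            have := le_max_left r δ
            have := le_max_right r δ
            rcases max_cases ρ δ with h | h <;> rw [h.1] <;> nlinarith
          have e2 : ENNReal.ofReal (max ρ δ) ^ (3/4:ℝ) ≤ ENNReal.ofReal (max r δ) ^ (3/4:ℝ) *
              (ENNReal.ofReal r ^ (-(3/4):ℝ) * ENNReal.ofReal ρ ^ (3/4:ℝ)) := by
            refine (rpow_le_rpow (ofReal_le_ofReal e1) (by norm_num)).trans (le_of_eq ?_)
            rw [ofReal_mul (by positivity), ofReal_div_of_pos hr, div_eq_mul_inv,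
              mul_rpow_of_nonneg _ _ (by norm_num), mul_rpow_of_nonneg _ _ (by norm_num),
              inv_rpow, rpow_neg]
            ring
          have hρ0 : ENNReal.ofReal ρ ≠ 0 := by simpa using h0
          calc _ ≤ S * (c4 * ε) * (ENNReal.ofReal (max r δ) ^ (3/4:ℝ) *
              (ENNReal.ofReal r ^ (-(3/4):ℝ) * ENNReal.ofReal ρ ^ (3/4:ℝ))) * ENNReal.ofReal ρ ^ (3:ℝ) := by
                gcongr
            _ = _ := by
                rw [hA, show (15/4:ℝ) = 3/4 + 3 by norm_num, rpow_add _ _ hρ0 (by simp)]; ring)) z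
      set I : E3 × ℝ → ℝ≥0∞ := fun z => ∫⁻ w, pk 4 z w * (u w * f w) with hI
      have hIm : Measurable I := by
        exact ((pk_measurable 4).mul ((hum.mul hf).comp measurable_snd)).lintegral_prod_right' (ν := volume)
      have hmink := lintegral_Lp_add_le (μ := volume.restrict (PB z r))
        (f := (PB z0 a).indicator (fun _ => M1)) (g := fun z => 2 * C * I z)
        ((measurable_const.indicator (measurableSet_PB _ _)).aemeasurable) ((hIm.const_mul _).aemeasurable)
        (p := 9/5) (by norm_num)
      rw [show (1 / (9/5) : ℝ) = 5/9 by norm_num] at hmink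
      have t1 : (∫⁻ w in PB z r, (PB z0 a).indicator (fun _ => M1) w ^ (9/5:ℝ)) ^ (5/9:ℝ)
          ≤ K * W r := by
        have : ∀ w, (PB z0 a).indicator (fun _ => M1) w ^ (9/5:ℝ)
            = (PB z0 a).indicator (fun _ => M1 ^ (9/5:ℝ)) w := by
          intro w; by_cases h : w ∈ PB z0 a <;> simp [h]
        simp_rw [this]
        rw [lintegral_indicator_const (measurableSet_PB _ _), Measure.restrict_apply (measurableSet_PB _ _),
          mul_rpow_of_nonneg _ _ (by norm_num), ← rpow_mul]
        norm_num
        rw [hK, mul_assoc]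
        gcongr
        set m := min r a with hm
        have hm0 : 0 < m := lt_min hr ha
        have hmc : ENNReal.ofReal m ≠ 0 := by simpa using hm0
        have v1 : volume (PB z0 a ∩ PB z r) ≤ cV * ENNReal.ofReal m ^ (5:ℝ) := by
          rcases le_total r a with h | h
          · rw [hm, min_eq_left h, ← vol_PB z hr]; exact measure_mono inter_subset_right
          · rw [hm, min_eq_right h, ← vol_PB z0 ha]; exact measure_mono inter_subset_left
        calc volume (PB z0 a ∩ PB z r) ^ (5/9:ℝ) ≤ (cV * ENNReal.ofReal m ^ (5:ℝ)) ^ (5/9:ℝ) := by gcongr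
          _ = cV ^ (5/9:ℝ) * (ENNReal.ofReal m ^ (16/9:ℝ) * ENNReal.ofReal m ^ (3/4:ℝ) * ENNReal.ofReal m ^ (1/4:ℝ)) := by
              rw [mul_rpow_of_nonneg _ _ (by norm_num), ← rpow_mul,
                ← rpow_add _ _ hmc (by simp), ← rpow_add _ _ hmc (by simp)]
              norm_num
          _ ≤ cV ^ (5/9:ℝ) * (ENNReal.ofReal r ^ (16/9:ℝ) * ENNReal.ofReal (max r δ) ^ (3/4:ℝ) * 1) := by
              gcongr
              · exact min_le_left _ _
              · exact (min_le_left _ _).trans (le_max_left _ _)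
              · apply rpow_le_one _ (by norm_num)
                rw [ofReal_le_one]; exact (min_le_right _ _).trans ha1
          _ = _ := by simp only [hW]; ring
      have t2 : (∫⁻ w in PB z r, (2 * C * I w) ^ (9/5:ℝ)) ^ (5/9:ℝ) ≤ D * ε * S * W r := by
        have : ∀ w, (2 * C * I w) ^ (9/5:ℝ) = (2*C)^(9/5:ℝ) * I w ^ (9/5:ℝ) := fun w =>
          mul_rpow_of_nonneg _ _ (by norm_num)
        simp_rw [this]
        rw [lintegral_const_mul _ (hIm.pow_const _)]
        calc ((2*C)^(9/5:ℝ) * ∫⁻ w in PB z r, I w ^ (9/5:ℝ)) ^ (5/9:ℝ)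
            ≤ ((2*C)^(9/5:ℝ) * (CA * A ^ (9/5:ℝ) * ENNReal.ofReal r ^ (16/5:ℝ))) ^ (5/9:ℝ) := by
              gcongr
          _ = _ := by
              simp only [mul_rpow_of_nonneg _ _ (show (0:ℝ) ≤ 5/9 by norm_num), ← rpow_mul]
              norm_num
              simp only [hW, hA, hD]; ring
      calc (∫⁻ w in PB z r, u w ^ (9/5:ℝ)) ^ (5/9:ℝ)
          ≤ (∫⁻ w in PB z r, ((PB z0 a).indicator (fun _ => M1) + fun z => 2 * C * I z) w ^ (9/5:ℝ)) ^ (5/9:ℝ) := by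
            gcongr ?_ ^ (5/9:ℝ)
            refine lintegral_mono_ae ?_
            filter_upwards [ae_restrict_of_ae hueq] with w hw
            gcongr
            exact hw
        _ ≤ _ := hmink
        _ ≤ K * W r + D * ε * S * W r := add_le_add t1 t2
        _ = _ := by ring
    have hS2 : S ≤ 2 * K := by
      have h1 : S ≤ K + 2⁻¹ * S := hstep.trans (by gcongr)
      have h2 : S = 2⁻¹ * S + 2⁻¹ * S := by rw [← add_mul, inv_two_add_inv_two, one_mul]
      have h3 : 2⁻¹ * S ≤ K := by
        have hh : 2⁻¹ * S ≠ ∞ := by finiteness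
        refine (ENNReal.add_le_add_iff_right hh).1 ?_
        rw [← h2]; exact h1
      calc S = 2 * (2⁻¹ * S) := by rw [← mul_assoc, ENNReal.mul_inv_cancel (by simp) (by simp), one_mul]
        _ ≤ _ := by gcongr
    intro z r hr
    exact (hSle z r hr).trans (by gcongr)
  set B : ℝ≥0∞ := (2 * K) ^ (3/2:ℝ) * ε ^ (1/2:ℝ) with hB
  have hBt : B ≠ ∞ := by finiteness
  have hL2 : ∀ z r, 0 < r → ∫⁻ w in PB z r, u w ^ (2:ℝ) ≤ B * ENNReal.ofReal r ^ (33/8:ℝ) := by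
    intro z r hr
    have hr0 : ENNReal.ofReal r ≠ 0 := by simpa using hr
    have hH := lintegral_mul_norm_pow_le (μ := volume.restrict (PB z r))
        (f := fun y => u y ^ (9/5:ℝ)) (g := fun y => u y ^ (3:ℝ))
        (hum.pow_const _).aemeasurable (hum.pow_const _).aemeasurable
        (p := 5/6) (q := 1/6) (by norm_num) (by norm_num) (by norm_num)
    simp only [← rpow_mul] at hH
    have e : ∀ y, u y ^ (9/5*(5/6):ℝ) * u y ^ (3*(1/6):ℝ) = u y ^ (2:ℝ) := by
      intro y
      rw [← rpow_add_of_nonneg _ _ (by norm_num) (by norm_num)]; norm_num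
    simp_rw [e] at hH
    have h1 := key r hr z r hr
    rw [max_self, ← rpow_add _ _ hr0 (by simp)] at h1
    calc _ ≤ _ := hH
      _ = ((∫⁻ w in PB z r, u w ^ (9/5:ℝ)) ^ (5/9:ℝ)) ^ (3/2:ℝ) * (∫⁻ w in PB z r, u w ^ (3:ℝ)) ^ (1/6:ℝ) := by
          rw [← rpow_mul]; norm_num
      _ ≤ (2 * K * ENNReal.ofReal r ^ (16/9+3/4:ℝ)) ^ (3/2:ℝ) * (ε ^ (3:ℝ) * ENNReal.ofReal r ^ (2:ℝ)) ^ (1/6:ℝ) := by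
          gcongr
          refine le_trans ?_ (h3 z r hr)
          gcongr with w; exact huf w
      _ = _ := by
          rw [mul_rpow_of_nonneg _ _ (by norm_num), mul_rpow_of_nonneg (ε ^ (3:ℝ)) _ (by norm_num),
            ← rpow_mul, ← rpow_mul, ← rpow_mul,
            show (33/8:ℝ) = (16/9+3/4)*(3/2) + 2 * (1/6) by norm_num, rpow_add _ _ hr0 (by simp), hB]
          norm_num
          ring
  have ha4 : 0 < a/4 := by linarith
  have ha40 : ENNReal.ofReal (a/4) ≠ 0 := by simpa using ha4
  refine ⟨M + C * (4 * ((2 ^ (4:ℝ) * geo (33/8 - 4)) * (B * ENNReal.ofReal (a/4) ^ (33/8-4:ℝ)))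
      + cf * (ENNReal.ofReal (a/4))⁻¹), ?_, ?_⟩
  · have := geo_ne_top (x := 33/8 - 4) (by norm_num)
    finiteness
  filter_upwards [hrep] with z hz hza
  refine (hz (PB_mono (by linarith) hza)).trans ?_
  gcongr
  rw [← lintegral_add_compl _ (measurableSet_PB z (a/4))]
  gcongr
  · have hn := near_lemma (β := 4) (m := 33/8) (by norm_num) (by norm_num) z (fun w => u w ^ (2:ℝ)) ha4 B
      (fun ρ h _ => hL2 z ρ h)
    refine le_trans ?_ (mul_le_mul_right hn 4)
    rw [← lintegral_const_mul' _ _ (by simp)]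
    refine setLIntegral_mono' (measurableSet_PB _ _) fun w hw => ?_
    have hw2 : pd z0 w < a/2 := by
      have := PB_sub hza hw
      have h' : pd z0 w < a/4 + a/4 := this
      linarith
    have hηw : 1 ≤ 2 * η w := by
      simp only [hη]
      rw [show (2:ℝ≥0∞) = ENNReal.ofReal 2 by simp, ← ofReal_mul (by norm_num)]
      rw [one_le_ofReal]
      have : pd z0 w / a < 1/2 := by rw [div_lt_iff₀ ha]; linarith
      linarith
    calc pk 4 z w * f w ^ (2:ℝ) = pk 4 z w * (1 * f w) ^ (2:ℝ) := by rw [one_mul]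
      _ ≤ pk 4 z w * (2 * η w * f w) ^ (2:ℝ) := by gcongr
      _ = _ := by simp only [hu, rpow_two]; ring
  · exact far z _ ha4
end
section
abbrev ZT := E3 × ℝ
def HD (f : ZT → ℝ) (w z : ZT) (d : ℝ) : Prop := DifferentiableAt ℝ f z ∧ fderiv ℝ f z w = d
lemma HD.add {f g : ZT → ℝ} {w z : ZT} {a b : ℝ} (hf : HD f w z a) (hg : HD g w z b) :
    HD (fun z => f z + g z) w z (a + b) :=
  ⟨hf.1.add hg.1, by rw [fderiv_fun_add hf.1 hg.1]; simp [hf.2, hg.2]⟩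
lemma HD.sub {f g : ZT → ℝ} {w z : ZT} {a b : ℝ} (hf : HD f w z a) (hg : HD g w z b) :
    HD (fun z => f z - g z) w z (a - b) :=
  ⟨hf.1.sub hg.1, by rw [fderiv_fun_sub hf.1 hg.1]; simp [hf.2, hg.2]⟩
lemma HD.mul {f g : ZT → ℝ} {w z : ZT} {a b : ℝ} (hf : HD f w z a) (hg : HD g w z b) :
    HD (fun z => f z * g z) w z (a * g z + f z * b) :=
  ⟨hf.1.mul hg.1, by rw [fderiv_fun_mul hf.1 hg.1]; simp [hf.2, hg.2]; ring⟩
lemma HD.const (c : ℝ) (w z : ZT) : HD (fun _ => c) w z 0 := ⟨by fun_prop, by simp⟩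
lemma HD.cmul {f : ZT → ℝ} {w z : ZT} {a : ℝ} (c : ℝ) (hf : HD f w z a) :
    HD (fun z => c * f z) w z (c * a) := by
  have := (HD.const c w z).mul hf
  simpa using this
lemma HD.congr {f : ZT → ℝ} {w z : ZT} {a b : ℝ} (hf : HD f w z a) (h : a = b) : HD f w z b := h ▸ hf
lemma HD.of_real {f : ZT → ℝ} {g : ℝ → ℝ} {w z : ZT} {a g' : ℝ} (hg : HasDerivAt g g' (f z))
    (hf : HD f w z a) : HD (fun z => g (f z)) w z (g' * a) := by
  refine ⟨hg.differentiableAt.comp z hf.1, ?_⟩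
  have := (hg.hasFDerivAt.comp z hf.1.hasFDerivAt).fderiv
  rw [show (fun z => g (f z)) = g ∘ f from rfl, this]
  simp [hf.2]; ring
def gX (a : E3) (i : Fin 3) (z : ZT) : ℝ := z.1 i - a i
def gc (T : ℝ) (z : ZT) : ℝ := (2 * (T - z.2))⁻¹
def gq (a : E3) (z : ZT) : ℝ := gX a 0 z * gX a 0 z + gX a 1 z * gX a 1 z + gX a 2 z * gX a 2 z
def gG (a : E3) (T : ℝ) (z : ZT) : ℝ := (T - z.2) ^ (-(3/2) : ℝ) * Real.exp (-(1/2) * (gc T z * gq a z))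
def gd (i j : Fin 3) : ℝ := if i = j then 1 else 0
def gD1 (a : E3) (T : ℝ) (i : Fin 3) (z : ZT) : ℝ := (-1) * (gc T z * gX a i z) * gG a T z
def gD2 (a : E3) (T : ℝ) (i j : Fin 3) (z : ZT) : ℝ :=
  (gc T z * gc T z * (gX a i z * gX a j z) - gd i j * gc T z) * gG a T z
def gD3 (a : E3) (T : ℝ) (i j k : Fin 3) (z : ZT) : ℝ :=
  (gc T z * gc T z * (gd i j * gX a k z + gd i k * gX a j z + gd j k * gX a i z)
    - gc T z * gc T z * gc T z * (gX a i z * gX a j z * gX a k z)) * gG a T z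
lemma hd_X (a : E3) (i : Fin 3) (w z : ZT) : HD (gX a i) w z (w.1 i) := by
  unfold gX
  have h : HasFDerivAt (fun z : ZT => z.1 i)
      ((EuclideanSpace.proj i).comp (ContinuousLinearMap.fst ℝ E3 ℝ)) z :=
    ((EuclideanSpace.proj (𝕜 := ℝ) i).comp (ContinuousLinearMap.fst ℝ E3 ℝ)).hasFDerivAt
  exact ⟨h.differentiableAt.sub_const _, by rw [fderiv_sub_const, h.fderiv]; simp⟩
lemma hd_t (T : ℝ) (w z : ZT) : HD (fun z => T - z.2) w z (- w.2) := by
  have h : HasFDerivAt (fun z : ZT => z.2) (ContinuousLinearMap.snd ℝ E3 ℝ) z :=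
    (ContinuousLinearMap.snd ℝ E3 ℝ).hasFDerivAt
  exact ⟨h.differentiableAt.const_sub _, by rw [fderiv_const_sub, h.fderiv]; simp⟩
lemma hd_c {T : ℝ} (w : ZT) {z : ZT} (hz : z.2 < T) : HD (gc T) w z (2 * (gc T z * gc T z) * w.2) := by
  have h := ((hd_t T w z).cmul 2)
  have h0 : 2 * (T - z.2) ≠ 0 := by have := sub_pos.2 hz; positivity
  have := HD.of_real (g := fun y => y⁻¹) (hasDerivAt_inv h0) h
  refine HD.congr this ?_
  unfold gc; field_simp
lemma hd_q (a : E3) (w z : ZT) : HD (gq a) w z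
    (2 * (gX a 0 z * w.1 0 + gX a 1 z * w.1 1 + gX a 2 z * w.1 2)) := by
  have h := fun i => hd_X a i w z
  exact ((((h 0).mul (h 0)).add ((h 1).mul (h 1))).add ((h 2).mul (h 2))).congr (by ring)
lemma hd_G (a : E3) {T : ℝ} (w : ZT) {z : ZT} (hz : z.2 < T) : HD (gG a T) w z
    ((-(gc T z * (gX a 0 z * w.1 0 + gX a 1 z * w.1 1 + gX a 2 z * w.1 2))
      + (3 * gc T z - gc T z * gc T z * gq a z) * w.2) * gG a T z) := by
  have hp := sub_pos.2 hz
  have h1 := HD.of_real (g := fun y => y ^ (-(3/2) : ℝ)) (Real.hasDerivAt_rpow_const (Or.inl hp.ne')) (hd_t T w z)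
  have h2 := HD.of_real (g := Real.exp) (Real.hasDerivAt_exp _) (((hd_c w hz).mul (hd_q a w z)).cmul (-(1/2)))
  refine (h1.mul h2).congr ?_
  have e : (T - z.2) ^ (-(3/2) - 1 : ℝ) = (T - z.2) ^ (-(3/2) : ℝ) * (2 * gc T z) := by
    rw [Real.rpow_sub_one hp.ne']; unfold gc; field_simp
  rw [e]; unfold gG; ring
lemma hd_D1 (a : E3) {T : ℝ} (i j : Fin 3) {z : ZT} (hz : z.2 < T) :
    sdz (gD1 a T i) j z = gD2 a T i j z := by
  refine (((((hd_c _ hz).mul (hd_X a i _ z)).cmul (-1)).mul (hd_G a _ hz)).congr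
    (w := (EuclideanSpace.single j 1, 0)) ?_).2
  unfold gD2
  fin_cases i <;> fin_cases j <;> simp [gd] <;> ring
lemma hd_G1 (a : E3) {T : ℝ} (j : Fin 3) {z : ZT} (hz : z.2 < T) :
    sdz (gG a T) j z = gD1 a T j z := by
  refine ((hd_G a _ hz).congr
    (w := (EuclideanSpace.single j 1, 0)) ?_).2
  unfold gD1
  fin_cases j <;> simp
lemma hd_D2' (a : E3) {T : ℝ} (i j : Fin 3) {z : ZT} (w : ZT) (hz : z.2 < T) :
    HD (gD2 a T i j) w z
     ((2 * (2 * (gc T z * gc T z) * w.2) * gc T z * (gX a i z * gX a j z)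
        + gc T z * gc T z * (w.1 i * gX a j z + gX a i z * w.1 j)
        - gd i j * (2 * (gc T z * gc T z) * w.2)) * gG a T z
      + (gc T z * gc T z * (gX a i z * gX a j z) - gd i j * gc T z) *
      ((-(gc T z * (gX a 0 z * w.1 0 + gX a 1 z * w.1 1 + gX a 2 z * w.1 2))
      + (3 * gc T z - gc T z * gc T z * gq a z) * w.2) * gG a T z)) := by
  have hc := hd_c w hz
  have hX := fun i => hd_X a i w z
  exact ((((hc.mul hc).mul ((hX i).mul (hX j))).sub (hc.cmul (gd i j))).mul (hd_G a w hz)).congr (by ring)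
lemma hd_D2 (a : E3) {T : ℝ} (i j k : Fin 3) {z : ZT} (hz : z.2 < T) :
    sdz (gD2 a T i j) k z = gD3 a T i j k z := by
  refine ((hd_D2' a i j (EuclideanSpace.single k 1, 0) hz).congr ?_).2
  unfold gD3
  fin_cases i <;> fin_cases j <;> fin_cases k <;> simp [gd] <;> ring
lemma hd_D3 (a : E3) {T : ℝ} (i j : Fin 3) {z : ZT} (hz : z.2 < T) :
    tdz (gD2 a T i j) z + ∑ k, sdz (gD3 a T i j k) k z = 0 := by
  have h1 := (hd_D2' a i j (0, 1) hz).2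
  have h2 : ∀ k, HD (gD3 a T i j k) (EuclideanSpace.single k 1, 0) z _ := fun k => by
    have hc := hd_c (EuclideanSpace.single k 1, 0) hz
    have hX := fun i => hd_X a i (EuclideanSpace.single k 1, 0) z
    exact (((hc.mul hc).mul ((((hX k).cmul (gd i j)).add ((hX j).cmul (gd i k))).add ((hX i).cmul (gd j k)))).sub
      (((hc.mul hc).mul hc).mul (((hX i).mul (hX j)).mul (hX k)))).mul (hd_G a _ hz)
  unfold tdz sdz
  rw [h1, Fin.sum_univ_three, (h2 0).2, (h2 1).2, (h2 2).2]
  unfold gq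
  fin_cases i <;> fin_cases j <;> simp [gd] <;> ring
lemma gG_contDiffAt (a : E3) {T : ℝ} {z : ZT} (hz : z.2 < T) : ContDiffAt ℝ (⊤ : ℕ∞) (gG a T) z := by
  have hp := sub_pos.2 hz
  have hX : ∀ i, ContDiffAt ℝ (⊤ : ℕ∞) (gX a i) z := fun i => by
    unfold gX
    exact (((EuclideanSpace.proj (𝕜 := ℝ) i).comp (ContinuousLinearMap.fst ℝ E3 ℝ)).contDiff.contDiffAt).sub
      contDiffAt_const
  have ht : ContDiffAt ℝ (⊤ : ℕ∞) (fun z : ZT => T - z.2) z := contDiffAt_const.sub contDiffAt_snd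
  have hc : ContDiffAt ℝ (⊤ : ℕ∞) (gc T) z := (contDiffAt_const.mul ht).inv (by positivity)
  have hq : ContDiffAt ℝ (⊤ : ℕ∞) (gq a) z :=
    (((hX 0).mul (hX 0)).add ((hX 1).mul (hX 1))).add ((hX 2).mul (hX 2))
  exact (ht.rpow_const_of_ne hp.ne').mul (Real.contDiff_exp.contDiffAt.comp z (contDiffAt_const.mul (hc.mul hq)))
lemma gX_contDiff (a : E3) (i : Fin 3) : ContDiff ℝ (⊤ : ℕ∞) (gX a i) := by
  unfold gX
  exact (((EuclideanSpace.proj (𝕜 := ℝ) i).comp (ContinuousLinearMap.fst ℝ E3 ℝ)).contDiff).sub contDiff_const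
lemma gc_contDiffAt {T : ℝ} {z : ZT} (hz : z.2 < T) : ContDiffAt ℝ (⊤ : ℕ∞) (gc T) z := by
  have hp := sub_pos.2 hz
  exact (contDiffAt_const.mul (contDiffAt_const.sub contDiffAt_snd)).inv (by positivity)
lemma gD1_contDiffAt (a : E3) {T : ℝ} (i : Fin 3) {z : ZT} (hz : z.2 < T) :
    ContDiffAt ℝ (⊤ : ℕ∞) (gD1 a T i) z :=
  (contDiffAt_const.mul ((gc_contDiffAt hz).mul (gX_contDiff a i).contDiffAt)).mul (gG_contDiffAt a hz)
lemma gD2_contDiffAt (a : E3) {T : ℝ} (i j : Fin 3) {z : ZT} (hz : z.2 < T) :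
    ContDiffAt ℝ (⊤ : ℕ∞) (gD2 a T i j) z :=
  (((((gc_contDiffAt hz).mul (gc_contDiffAt hz)).mul ((gX_contDiff a i).contDiffAt.mul
    (gX_contDiff a j).contDiffAt))).sub (contDiffAt_const.mul (gc_contDiffAt hz))).mul (gG_contDiffAt a hz)
end
section
def gR (a : E3) (T : ℝ) (z : ZT) : ℝ := √(‖z.1 - a‖ ^ 2 + (T - z.2))
lemma gq_eq (a : E3) (z : ZT) : gq a z = ‖z.1 - a‖ ^ 2 := by
  rw [EuclideanSpace.norm_sq_eq, Fin.sum_univ_three]; simp [gq, gX]; ring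
lemma abs_gd_le (i j : Fin 3) : |gd i j| ≤ 1 := by unfold gd; split_ifs <;> simp
lemma exp_aux {y : ℝ} (hy : 0 ≤ y) : (1 + y) ^ 5 ≤ 368640 * Real.exp (y / 4) := by
  have h := Real.pow_div_factorial_le_exp ((1 + y)/4) (by positivity) 5
  have h2 : Real.exp ((1+y)/4) ≤ 3 * Real.exp (y/4) := by
    rw [show (1+y)/4 = 1/4 + y/4 by ring, Real.exp_add]
    gcongr
    calc Real.exp (1/4) ≤ Real.exp 1 := Real.exp_le_exp.2 (by norm_num)
      _ ≤ 3 := by have := Real.exp_one_lt_d9; linarith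
  have e : ((1+y)/4)^5 / (Nat.factorial 5 : ℝ) = (1+y)^5 / 122880 := by
    rw [div_pow, show (Nat.factorial 5 : ℝ) = 120 by norm_num [Nat.factorial]]; ring
  rw [e] at h
  linarith [h.trans h2]
lemma gauss_bounds : ∃ K : ℝ, 0 < K ∧ ∀ (a : E3) (T : ℝ) (z : ZT), z.2 < T →
    |gG a T z| ≤ K / gR a T z ^ 3 ∧ (∀ i, |gD1 a T i z| ≤ K / gR a T z ^ 4) ∧
    (∀ i j, |gD2 a T i j z| ≤ K / gR a T z ^ 5) ∧ (∀ i j k, |gD3 a T i j k z| ≤ K / gR a T z ^ 6) := by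
  refine ⟨368640, by norm_num, fun a T z hz => ?_⟩
  set K : ℝ := 368640 with hK
  have hσ := sub_pos.2 hz
  set σ := T - z.2 with hσd
  set ρ := ‖z.1 - a‖ ^ 2 + σ with hρ
  have hρ0 : 0 < ρ := by positivity
  have hR : gR a T z = √ρ := rfl
  set R := gR a T z with hRd
  have hR0 : 0 < R := by rw [hR]; positivity
  have hR2 : R ^ 2 = ρ := by rw [hR, Real.sq_sqrt hρ0.le]
  set ω := √σ with hω
  have hω0 : 0 < ω := by positivity
  have hω2 : ω ^ 2 = σ := Real.sq_sqrt hσ.le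
  set u := ω / R with hu
  have hu0 : 0 < u := by positivity
  have hu1 : u ≤ 1 := by
    rw [hu, div_le_one hR0, hR]; exact Real.sqrt_le_sqrt (by rw [hρ]; nlinarith [norm_nonneg (z.1 - a)])
  have hωu : ω = u * R := by rw [hu]; field_simp
  have hX : ∀ i, |gX a i z| ≤ R := by
    intro i
    have h1 : |gX a i z| ≤ ‖z.1 - a‖ := by
      have := EuclideanSpace.norm_sq_eq (z.1 - a)
      have h2 : (gX a i z) ^ 2 ≤ ‖z.1 - a‖ ^ 2 := by
        rw [this]
        have := Finset.single_le_sum (f := fun i => ‖(z.1 - a) i‖ ^ 2) (fun _ _ => by positivity) (Finset.mem_univ i)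
        simpa [gX] using this
      exact abs_le_of_sq_le_sq h2 (norm_nonneg _)
    refine h1.trans ?_
    rw [hR]; exact Real.le_sqrt_of_sq_le (by rw [hρ]; linarith)
  have hG0 : 0 ≤ gG a T z := by unfold gG; positivity
  have hG : gG a T z ≤ K * u ^ 7 / R ^ 3 := by
    have e1 : σ ^ (-(3/2) : ℝ) = (ω ^ 3)⁻¹ := by
      rw [← hω2, ← Real.rpow_natCast, ← Real.rpow_mul hω0.le, ← Real.rpow_natCast, ← Real.rpow_neg hω0.le]
      norm_num
    have e2 : -(1/2) * (gc T z * gq a z) = -((‖z.1 - a‖^2 / σ) / 4) := by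
      rw [gq_eq]; unfold gc; rw [← hσd]; field_simp; ring
    have h1 := exp_aux (y := ‖z.1 - a‖^2 / σ) (by positivity)
    have e3 : 1 + ‖z.1 - a‖^2 / σ = (u ^ 2)⁻¹ := by
      rw [hu, div_pow, hω2, hR2, hρ]; field_simp; ring
    rw [e3] at h1
    have h2 : Real.exp (-((‖z.1 - a‖^2 / σ) / 4)) ≤ K * u ^ 10 := by
      rw [Real.exp_neg]
      have hp := Real.exp_pos (‖z.1 - a‖^2 / σ / 4)
      rw [inv_le_iff_one_le_mul₀ hp]
      have h3 : (u^2)⁻¹ ^ 5 * u ^ 10 = 1 := by field_simp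
      nlinarith [mul_le_mul_of_nonneg_right h1 (by positivity : 0 ≤ u ^ 10)]
    unfold gG
    rw [← hσd, e1, e2]
    calc (ω^3)⁻¹ * Real.exp (-((‖z.1 - a‖^2 / σ) / 4)) ≤ (ω^3)⁻¹ * (K * u ^ 10) := by gcongr
      _ = K * u ^ 7 / R ^ 3 := by rw [hωu]; field_simp
  have hc : gc T z = (2 * u ^ 2 * R ^ 2)⁻¹ := by
    unfold gc; rw [← hσd, ← hω2, hωu]; ring
  have hc0 : 0 ≤ gc T z := by rw [hc]; positivity
  set c := gc T z with hcd
  set g := gG a T z with hg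
  have hcu : c * u ^ 2 * R ^ 2 = 1/2 := by rw [hc]; field_simp
  have hcK : ∀ n : ℕ, n ≤ 3 → c ^ n * g ≤ K / R ^ (3 + 2 * n) := by
    intro n hn
    calc c ^ n * g ≤ c ^ n * (K * u ^ 7 / R ^ 3) := by gcongr
      _ = K * (1/2) ^ n * u ^ (7 - 2 * n) / R ^ (3 + 2 * n) := by
          rw [hc]; interval_cases n <;> field_simp <;> norm_num <;> try ring
      _ ≤ K * 1 * 1 / R ^ (3 + 2 * n) := by
          gcongr
          · exact pow_le_one₀ (by norm_num) (by norm_num)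
          · exact pow_le_one₀ hu0.le hu1
      _ = _ := by ring
  have hcK' : ∀ n : ℕ, n ≤ 3 → c ^ n * g ≤ K * (1/2)^n / R ^ (3 + 2 * n) := by
    intro n hn
    calc c ^ n * g ≤ c ^ n * (K * u ^ 7 / R ^ 3) := by gcongr
      _ = K * (1/2) ^ n * u ^ (7 - 2 * n) / R ^ (3 + 2 * n) := by
          rw [hc]; interval_cases n <;> field_simp <;> norm_num <;> try ring
      _ ≤ K * (1/2) ^ n * 1 / R ^ (3 + 2 * n) := by
          gcongr
          exact pow_le_one₀ hu0.le hu1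
      _ = _ := by ring
  refine ⟨?_, fun i => ?_, fun i j => ?_, fun i j k => ?_⟩
  · rw [abs_of_nonneg hG0]; simpa using hcK 0 (by norm_num)
  · calc |gD1 a T i z| = (c ^ 1 * g) * |gX a i z| := by
          unfold gD1; rw [abs_mul, abs_mul, abs_mul, abs_of_nonneg hG0, abs_of_nonneg hc0]; simp; ring
      _ ≤ (K / R ^ (3 + 2*1)) * R := by gcongr; exact hcK 1 (by norm_num); exact hX i
      _ = _ := by field_simp
  · calc |gD2 a T i j z| = |(c^2*g) * (gX a i z * gX a j z) - (c^1*g) * gd i j| := by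
          unfold gD2; congr 1; ring
      _ ≤ |(c^2*g) * (gX a i z * gX a j z)| + |(c^1*g) * gd i j| := abs_sub _ _
      _ = (c^2*g) * (|gX a i z| * |gX a j z|) + (c^1*g) * |gd i j| := by
          rw [abs_mul (c^2*g), abs_mul (gX a i z), abs_mul (c^1*g), abs_of_nonneg (by positivity : 0 ≤ c^2*g), abs_of_nonneg (by positivity : 0 ≤ c^1*g)]
      _ ≤ (K * (1/2)^2 / R ^ (3 + 2*2)) * (R * R) + (K * (1/2)^1 / R ^ (3+2*1)) * 1 := by
          gcongr
          · exact hcK' 2 (by norm_num)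
          · exact hX i
          · exact hX j
          · exact hcK' 1 (by norm_num)
          · exact abs_gd_le i j
      _ = (3/4) * (K / R ^ 5) := by field_simp; ring
      _ ≤ _ := by have : 0 < K / R ^ 5 := by positivity
                  linarith
  · calc |gD3 a T i j k z| = |(c^2*g) * (gd i j * gX a k z + gd i k * gX a j z + gd j k * gX a i z)
            - (c^3*g) * (gX a i z * gX a j z * gX a k z)| := by
          unfold gD3; congr 1; ring
      _ ≤ |(c^2*g) * (gd i j * gX a k z + gd i k * gX a j z + gd j k * gX a i z)|
            + |(c^3*g) * (gX a i z * gX a j z * gX a k z)| := abs_sub _ _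
      _ = (c^2*g) * |gd i j * gX a k z + gd i k * gX a j z + gd j k * gX a i z|
            + (c^3*g) * (|gX a i z| * |gX a j z| * |gX a k z|) := by
          rw [abs_mul (c^2*g), abs_mul (c^3*g), abs_mul (gX a i z * gX a j z), abs_mul (gX a i z), abs_of_nonneg (by positivity : 0 ≤ c^2*g),
            abs_of_nonneg (by positivity : 0 ≤ c^3*g)]
      _ ≤ (K * (1/2)^2 / R ^ (3 + 2*2)) * (1 * R + 1 * R + 1 * R) + (K * (1/2)^3 / R ^ (3+2*3)) * (R * R * R) := by
          have h3 : |gd i j * gX a k z + gd i k * gX a j z + gd j k * gX a i z| ≤ 1 * R + 1 * R + 1 * R := by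
            refine (abs_add_three _ _ _).trans ?_
            rw [abs_mul, abs_mul, abs_mul]
            gcongr
            all_goals first | exact abs_gd_le _ _ | exact hX _
          gcongr
          · exact hcK' 2 (by norm_num)
          · exact hcK' 3 (by norm_num)
          · exact hX i
          · exact hX j
          · exact hX k
      _ = (7/8) * (K / R ^ 6) := by field_simp; ring
      _ ≤ _ := by have : 0 < K / R ^ 6 := by positivity
                  linarith
end
section
lemma gD3_contDiffAt (a : E3) {T : ℝ} (i j k : Fin 3) {z : ZT} (hz : z.2 < T) :
    ContDiffAt ℝ (⊤ : ℕ∞) (gD3 a T i j k) z := by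
  have hX := fun i => (gX_contDiff a i).contDiffAt (x := z)
  have hc := gc_contDiffAt hz
  unfold gD3
  exact (((hc.mul hc).mul (((contDiffAt_const.mul (hX k)).add (contDiffAt_const.mul (hX j))).add
    (contDiffAt_const.mul (hX i)))).sub (((hc.mul hc).mul hc).mul (((hX i).mul (hX j)).mul (hX k)))).mul
    (gG_contDiffAt a hz)
lemma ev_zero {A : ZT → ℝ} {t₁ : ℝ} (hA : ∀ z, t₁ ≤ z.2 → A z = 0) {z : ZT} (hz : t₁ < z.2) :
    A =ᶠ[nhds z] fun _ => 0 := by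
  have : {w : ZT | t₁ < w.2} ∈ nhds z := (isOpen_lt continuous_const continuous_snd).mem_nhds hz
  filter_upwards [this] with w hw using hA w (le_of_lt hw)
lemma cut_contDiff {A Θ : ZT → ℝ} {t₁ T : ℝ} (hA : ContDiff ℝ (⊤ : ℕ∞) A)
    (hA0 : ∀ z, t₁ ≤ z.2 → A z = 0) (hT : t₁ < T)
    (hΘ : ∀ z : ZT, z.2 < T → ContDiffAt ℝ (⊤ : ℕ∞) Θ z) :
    ContDiff ℝ (⊤ : ℕ∞) (fun z => A z * Θ z) := by
  rw [contDiff_iff_contDiffAt]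
  intro z
  by_cases hz : z.2 < T
  · exact hA.contDiffAt.mul (hΘ z hz)
  · have h1 := ev_zero hA0 (z := z) (by linarith)
    refine (contDiffAt_const (c := (0:ℝ))).congr_of_eventuallyEq ?_
    filter_upwards [h1] with w hw
    simp [hw]
lemma cut_fderiv {A Θ : ZT → ℝ} {t₁ T : ℝ} (hA : ContDiff ℝ (⊤ : ℕ∞) A)
    (hA0 : ∀ z, t₁ ≤ z.2 → A z = 0) (hT : t₁ < T)
    (hΘ : ∀ z : ZT, z.2 < T → DifferentiableAt ℝ Θ z) (z w : ZT) :
    fderiv ℝ (fun z => A z * Θ z) z w = fderiv ℝ A z w * Θ z + A z * fderiv ℝ Θ z w := by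
  by_cases hz : z.2 < T
  · have hAd : DifferentiableAt ℝ A z := hA.contDiffAt.differentiableAt (by simp)
    rw [fderiv_fun_mul hAd (hΘ z hz)]; simp; ring
  · have h1 := ev_zero hA0 (z := z) (by linarith)
    have h2 : (fun z => A z * Θ z) =ᶠ[nhds z] fun _ => 0 := by
      filter_upwards [h1] with w hw
      simp [hw]
    rw [h2.fderiv_eq, h1.fderiv_eq, h1.eq_of_nhds]; simp
lemma sdz_contDiff {A : ZT → ℝ} (hA : ContDiff ℝ (⊤ : ℕ∞) A) (j : Fin 3) :
    ContDiff ℝ (⊤ : ℕ∞) (sdz A j) := by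
  unfold sdz
  exact (hA.fderiv_right (m := (⊤ : ℕ∞)) (by simp)).clm_apply contDiff_const
lemma sdz_zero {A : ZT → ℝ} {t₁ : ℝ} (hA : ContDiff ℝ (⊤ : ℕ∞) A) (hA0 : ∀ z, t₁ ≤ z.2 → A z = 0)
    (j : Fin 3) : ∀ z, t₁ ≤ z.2 → sdz A j z = 0 := by
  have h1 : ∀ z : ZT, t₁ < z.2 → sdz A j z = 0 := fun z hz => by
    unfold sdz; rw [(ev_zero hA0 hz).fderiv_eq]; simp
  intro z hz
  have hc : Continuous (fun s : ℝ => sdz A j (z.1, z.2 + s)) :=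
    (sdz_contDiff hA j).continuous.comp (by fun_prop)
  have h2 : Tendsto (fun s : ℝ => sdz A j (z.1, z.2 + s)) (nhdsWithin 0 (Ioi 0)) (nhds (sdz A j z)) := by
    have := hc.tendsto 0
    simp only [add_zero] at this
    exact this.mono_left nhdsWithin_le_nhds
  refine tendsto_nhds_unique h2 (tendsto_const_nhds.congr' ?_)
  filter_upwards [self_mem_nhdsWithin] with s hs
  have : (0:ℝ) < s := hs
  exact (h1 _ (by simp; linarith)).symm
lemma cut_sdz {A Θ : ZT → ℝ} {t₁ T : ℝ} (hA : ContDiff ℝ (⊤ : ℕ∞) A)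
    (hA0 : ∀ z, t₁ ≤ z.2 → A z = 0) (hT : t₁ < T)
    (hΘ : ∀ z : ZT, z.2 < T → ContDiffAt ℝ (⊤ : ℕ∞) Θ z) (j : Fin 3) (z : ZT) :
    sdz (fun z => A z * Θ z) j z = sdz A j z * Θ z + A z * sdz Θ j z :=
  cut_fderiv hA hA0 hT (fun z hz => (hΘ z hz).differentiableAt (by simp)) z _
lemma cut_sdz2 {A Θ D : ZT → ℝ} {t₁ T : ℝ} (hA : ContDiff ℝ (⊤ : ℕ∞) A)
    (hA0 : ∀ z, t₁ ≤ z.2 → A z = 0) (hT : t₁ < T)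
    (hΘ : ∀ z : ZT, z.2 < T → ContDiffAt ℝ (⊤ : ℕ∞) Θ z) (j : Fin 3)
    (hD : ∀ z : ZT, z.2 < T → ContDiffAt ℝ (⊤ : ℕ∞) D z)
    (hD' : ∀ z : ZT, z.2 < T → sdz Θ j z = D z) (z : ZT) :
    sdz (fun w => sdz (fun z => A z * Θ z) j w) j z =
      sdz (sdz A j) j z * Θ z + 2 * (sdz A j z * D z) + A z * sdz D j z := by
  have hz0 := sdz_zero hA hA0 j
  have hAj := sdz_contDiff hA j
  have e : (fun w => sdz (fun z => A z * Θ z) j w) = fun w => sdz A j w * Θ w + A w * D w := by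
    funext w
    rw [cut_sdz hA hA0 hT hΘ]
    by_cases hw : w.2 < T
    · rw [hD' w hw]
    · rw [hA0 w (by linarith)]; simp
  rw [e]
  have c1 := cut_contDiff hAj hz0 hT hΘ
  have c2 := cut_contDiff hA hA0 hT hD
  have : sdz (fun w => sdz A j w * Θ w + A w * D w) j z
    = sdz (fun w => sdz A j w * Θ w) j z + sdz (fun w => A w * D w) j z := by
    unfold sdz at *
    rw [fderiv_fun_add (c1.contDiffAt.differentiableAt (by simp)) (c2.contDiffAt.differentiableAt (by simp))]
    simp
  rw [this, cut_sdz hAj hz0 hT hΘ, cut_sdz hA hA0 hT hD]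
  by_cases hw : z.2 < T
  · rw [hD' z hw]; ring
  · rw [hz0 z (by linarith)]; simp;
end
section
def CB (v : ZT → E3) (p : ZT → ℝ) (Q : Set ZT) : Prop :=
  ∀ φ : Fin 3 → ZT → ℝ, (∀ i, ContDiff ℝ (⊤ : ℕ∞) (φ i)) → (∀ i, HasCompactSupport (φ i)) →
    (∀ i, tsupport (φ i) ⊆ Q) →
    ∫ z in Q, ((∑ i, v z i * (tdz (φ i) z + ∑ j, sdz (fun w => sdz (φ i) j w) j z))
      + (∑ i, ∑ j, v z i * v z j * sdz (φ i) j z) + p z * ∑ i, sdz (φ i) i z) = 0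
def CD (v : ZT → E3) (Q : Set ZT) : Prop :=
  ∀ ψ : ZT → ℝ, ContDiff ℝ (⊤ : ℕ∞) ψ → HasCompactSupport ψ → tsupport ψ ⊆ Q →
    ∫ z in Q, ∑ i, v z i * sdz ψ i z = 0
def gL (a : E3) (T : ℝ) (z : ZT) : ℝ := ∑ k, gD2 a T k k z
def gTh (a : E3) (T : ℝ) (e i : Fin 3) (z : ZT) : ℝ := gD2 a T i e z - gd i e * gL a T z
def gTh1 (a : E3) (T : ℝ) (e i j : Fin 3) (z : ZT) : ℝ :=
  gD3 a T i e j z - gd i e * ∑ k, gD3 a T k k j z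
lemma gL_contDiffAt (a : E3) {T : ℝ} {z : ZT} (hz : z.2 < T) : ContDiffAt ℝ (⊤ : ℕ∞) (gL a T) z := by
  unfold gL; exact ContDiffAt.sum fun k _ => gD2_contDiffAt a k k hz
lemma gTh_contDiffAt (a : E3) {T : ℝ} (e i : Fin 3) {z : ZT} (hz : z.2 < T) :
    ContDiffAt ℝ (⊤ : ℕ∞) (gTh a T e i) z :=
  (gD2_contDiffAt a i e hz).sub (contDiffAt_const.mul (gL_contDiffAt a hz))
lemma gTh1_contDiffAt (a : E3) {T : ℝ} (e i j : Fin 3) {z : ZT} (hz : z.2 < T) :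
    ContDiffAt ℝ (⊤ : ℕ∞) (gTh1 a T e i j) z :=
  (gD3_contDiffAt a i e j hz).sub (contDiffAt_const.mul
    (ContDiffAt.sum fun k _ => gD3_contDiffAt a k k j hz))
lemma fd_comb {f : ZT → ℝ} {g : Fin 3 → ZT → ℝ} {z : ZT} (c : ℝ) (hf : DifferentiableAt ℝ f z)
    (hg : ∀ k, DifferentiableAt ℝ (g k) z) (w : ZT) :
    fderiv ℝ (fun z => f z - c * ∑ k, g k z) z w = fderiv ℝ f z w - c * ∑ k, fderiv ℝ (g k) z w := by
  have h0 : HD f w z (fderiv ℝ f z w) := ⟨hf, rfl⟩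
  have h1 : ∀ k, HD (g k) w z (fderiv ℝ (g k) z w) := fun k => ⟨hg k, rfl⟩
  have := h0.sub ((((h1 0).add (h1 1)).add (h1 2)).cmul c)
  simpa only [Fin.sum_univ_three] using this.2
lemma gTh_sdz (a : E3) {T : ℝ} (e i j : Fin 3) {z : ZT} (hz : z.2 < T) :
    sdz (gTh a T e i) j z = gTh1 a T e i j z := by
  have := fd_comb (gd i e) ((gD2_contDiffAt a i e hz).differentiableAt (by simp))
    (fun k => (gD2_contDiffAt a k k hz).differentiableAt (by simp)) (EuclideanSpace.single j 1, 0)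
  unfold sdz gTh gL gTh1
  rw [this]
  have h2 := fun i k => hd_D2 a i k j hz
  unfold sdz at h2
  simp only [h2]
lemma gTh_heat (a : E3) {T : ℝ} (e i : Fin 3) {z : ZT} (hz : z.2 < T) :
    tdz (gTh a T e i) z + ∑ j, sdz (gTh1 a T e i j) j z = 0 := by
  have h1 := fd_comb (gd i e) ((gD2_contDiffAt a i e hz).differentiableAt (by simp))
    (fun k => (gD2_contDiffAt a k k hz).differentiableAt (by simp)) (0, 1)
  have h2 := fun j => fd_comb (gd i e) ((gD3_contDiffAt a i e j hz).differentiableAt (by simp))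
    (fun k => (gD3_contDiffAt a k k j hz).differentiableAt (by simp)) (EuclideanSpace.single j 1, 0)
  have h3 := fun i j => hd_D3 a i j hz
  unfold tdz sdz at h3
  unfold tdz sdz gTh gL gTh1
  simp only [h1, h2]
  have k0 := h3 i e
  have k1 := h3 0 0
  have k2 := h3 1 1
  have k3 := h3 2 2
  simp only [Fin.sum_univ_three] at k0 k1 k2 k3 ⊢
  linear_combination k0 - gd i e * (k1 + k2 + k3)
lemma gTh_div (a : E3) {T : ℝ} (e : Fin 3) (z : ZT) :
    ∑ i, gTh1 a T e i i z = 0 := by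
  unfold gTh1 gD3
  simp only [Fin.sum_univ_three]
  fin_cases e <;> simp [gd] <;> ring
lemma gD2_symm (a : E3) (T : ℝ) (i j : Fin 3) (z : ZT) : gD2 a T i j z = gD2 a T j i z := by
  unfold gD2 gd; rw [mul_comm (gX a i z)]; simp only [eq_comm]
lemma cut_identity {A : ZT → ℝ} {t₁ T : ℝ} (hA : ContDiff ℝ (⊤ : ℕ∞) A)
    (hA0 : ∀ z, t₁ ≤ z.2 → A z = 0) (hT : t₁ < T) (a : E3) (e : Fin 3) (u : E3) (q : ℝ) (z : ZT) :
    ((∑ i, u i * (tdz (fun z => A z * gTh a T e i z) z +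
        ∑ j, sdz (fun w => sdz (fun z => A z * gTh a T e i z) j w) j z))
      + (∑ i, ∑ j, u i * u j * sdz (fun z => A z * gTh a T e i z) j z)
      + q * ∑ i, sdz (fun z => A z * gTh a T e i z) i z)
    = (∑ i, u i * ((tdz A z + ∑ j, sdz (sdz A j) j z) * gTh a T e i z
          + 2 * ∑ j, sdz A j z * gTh1 a T e i j z))
      + (∑ i, ∑ j, u i * u j * (sdz A j z * gTh a T e i z + A z * gTh1 a T e i j z))
      + q * ∑ i, sdz A i z * gTh a T e i z := by
  have hc := fun i (z : ZT) (hz : z.2 < T) => gTh_contDiffAt a e i hz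
  have h2 := fun i j => cut_sdz2 hA hA0 hT (hc i) j (fun z hz => gTh1_contDiffAt a e i j hz)
    (fun z hz => gTh_sdz a e i j hz) z
  have h1 : ∀ i j, sdz (fun z => A z * gTh a T e i z) j z = sdz A j z * gTh a T e i z
      + A z * gTh1 a T e i j z := fun i j => by
    rw [cut_sdz hA hA0 hT (hc i)]
    by_cases hz : z.2 < T
    · rw [gTh_sdz a e i j hz]
    · rw [hA0 z (by linarith)]; simp
  have h3 : ∀ i, tdz (fun z => A z * gTh a T e i z) z = tdz A z * gTh a T e i z + A z * tdz (gTh a T e i) z :=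
    fun i => cut_fderiv hA hA0 hT (fun z hz => (hc i z hz).differentiableAt (by simp)) z _
  have h4 : ∀ i, A z * (tdz (gTh a T e i) z + ∑ j, sdz (gTh1 a T e i j) j z) = 0 := fun i => by
    by_cases hz : z.2 < T
    · rw [gTh_heat a e i hz]; simp
    · rw [hA0 z (by linarith)]; simp
  have h5 := gTh_div a (T := T) e z
  simp only [h1, h2, h3]
  simp only [Fin.sum_univ_three] at h4 h5 ⊢
  linear_combination u 0 * h4 0 + u 1 * h4 1 + u 2 * h4 2 + q * A z * h5
end
section
def stp : ℝ → ℝ := Real.smoothTransition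
def lam : ℝ → ℝ := deriv stp
lemma stp_contDiff : ContDiff ℝ (⊤ : ℕ∞) stp := Real.smoothTransition.contDiff
lemma lam_contDiff : ContDiff ℝ (⊤ : ℕ∞) lam := by
  have := stp_contDiff
  exact (contDiff_infty_iff_deriv.1 this).2
lemma stp_hasDeriv (s : ℝ) : HasDerivAt stp (lam s) s :=
  (stp_contDiff.differentiable (by simp) s).hasDerivAt
lemma stp_zero {s : ℝ} (hs : s ≤ 0) : stp s = 0 := Real.smoothTransition.zero_of_nonpos hs
lemma stp_one {s : ℝ} (hs : 1 ≤ s) : stp s = 1 := Real.smoothTransition.one_of_one_le hs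
lemma stp_abs (s : ℝ) : |stp s| ≤ 1 := abs_le.2
  ⟨le_trans (by norm_num) (Real.smoothTransition.nonneg s : 0 ≤ stp s), Real.smoothTransition.le_one s⟩
lemma lam_zero {s : ℝ} (hs : s ≤ 0) : lam s = 0 := by
  have : IsLocalMin stp s := Filter.Eventually.of_forall fun y => by
    rw [stp_zero hs]; exact Real.smoothTransition.nonneg y
  exact this.deriv_eq_zero
lemma lam_zero' {s : ℝ} (hs : 1 ≤ s) : lam s = 0 := by
  have : IsLocalMax stp s := Filter.Eventually.of_forall fun y => by
    rw [stp_one hs]; exact Real.smoothTransition.le_one y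
  exact this.deriv_eq_zero
lemma lam_compact : HasCompactSupport lam := by
  refine HasCompactSupport.intro (isCompact_Icc (a := (0:ℝ)) (b := 1)) fun x hx => ?_
  rw [mem_Icc, not_and_or, not_le, not_le] at hx
  rcases hx with h | h
  · exact lam_zero h.le
  · exact lam_zero' h.le
lemma lam_bdd : ∃ L : ℝ, 0 < L ∧ ∀ s, |lam s| ≤ L := by
  obtain ⟨C, hC⟩ := lam_compact.exists_bound_of_continuous lam_contDiff.continuous
  exact ⟨|C| + 1, by positivity, fun s => (hC s).trans (by linarith [le_abs_self C])⟩
lemma tc_contDiff {F : ZT → ℝ} {g : ℝ → ℝ} (hF : ContDiff ℝ (⊤ : ℕ∞) F) (hg : ContDiff ℝ (⊤ : ℕ∞) g) (h t₁ : ℝ) :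
    ContDiff ℝ (⊤ : ℕ∞) (fun z : ZT => F z * g (h⁻¹ * (t₁ - z.2))) :=
  hF.mul (hg.comp (contDiff_const.mul (contDiff_const.sub contDiff_snd)))
lemma tc_hd {F : ZT → ℝ} {g : ℝ → ℝ} (hF : ContDiff ℝ (⊤ : ℕ∞) F) (hg : ContDiff ℝ (⊤ : ℕ∞) g) (h t₁ : ℝ)
    (w z : ZT) : fderiv ℝ (fun z : ZT => F z * g (h⁻¹ * (t₁ - z.2))) z w
      = fderiv ℝ F z w * g (h⁻¹ * (t₁ - z.2)) - h⁻¹ * (F z * deriv g (h⁻¹ * (t₁ - z.2))) * w.2 := by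
  have h0 : HD F w z (fderiv ℝ F z w) := ⟨hF.differentiable (by simp) z, rfl⟩
  have h1 := HD.of_real (f := fun z : ZT => h⁻¹ * (t₁ - z.2)) (hg.differentiable (by simp) _).hasDerivAt ((hd_t t₁ w z).cmul h⁻¹)
  rw [(h0.mul h1).2]; ring
lemma tc_sdz {F : ZT → ℝ} {g : ℝ → ℝ} (hF : ContDiff ℝ (⊤ : ℕ∞) F) (hg : ContDiff ℝ (⊤ : ℕ∞) g) (h t₁ : ℝ)
    (j : Fin 3) : sdz (fun z : ZT => F z * g (h⁻¹ * (t₁ - z.2))) j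
      = fun z => sdz F j z * g (h⁻¹ * (t₁ - z.2)) := by
  funext z; unfold sdz; rw [tc_hd hF hg]; simp
structure Cut (x0 : E3) (t0 r : ℝ) (A0 : ZT → ℝ) (L : ℝ) : Prop where
  sm : ContDiff ℝ (⊤ : ℕ∞) A0
  cs : HasCompactSupport A0
  supp : tsupport A0 ⊆ Metric.ball x0 r ×ˢ Ioi (t0 - r ^ 2)
  nn : ∀ z, 0 ≤ A0 z
  le : ∀ z, A0 z ≤ 1
  L0 : 0 < L
  bs : ∀ j z, |sdz A0 j z| ≤ L
  bt : ∀ z, |tdz A0 z| ≤ L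
  bss : ∀ j z, |sdz (sdz A0 j) j z| ≤ L
  flat : ∀ z ∈ Metric.ball x0 (r/2) ×ˢ Ioo (t0 - r^2/2) t0, A0 z = 1 ∧ (∀ j, sdz A0 j z = 0) ∧ tdz A0 z = 0 ∧
    ∀ j, sdz (sdz A0 j) j z = 0
lemma hcs_fderiv {F : ZT → ℝ} (hF : HasCompactSupport F) (w : ZT) : HasCompactSupport (fun z => fderiv ℝ F z w) :=
  hF.fderiv_apply ℝ w
lemma cut_exists (x0 : E3) (t0 : ℝ) {r : ℝ} (hr : 0 < r) : ∃ A0 L, Cut x0 t0 r A0 L := by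
  let b1 : ContDiffBump x0 := ⟨r/2, 3*r/4, by positivity, by linarith⟩
  let b2 : ContDiffBump t0 := ⟨r^2/2, 3*r^2/4, by positivity, by nlinarith [sq_pos_of_pos hr]⟩
  let A : ZT → ℝ := fun z => b1 z.1 * b2 z.2
  have sm : ContDiff ℝ (⊤ : ℕ∞) A := (b1.contDiff.comp contDiff_fst).mul (b2.contDiff.comp contDiff_snd)
  have hsub : Function.support A ⊆ Metric.closedBall x0 (3*r/4) ×ˢ Metric.closedBall t0 (3*r^2/4) := by
    intro z hz
    have h1 : b1 z.1 ≠ 0 := left_ne_zero_of_mul hz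
    have h2 : b2 z.2 ≠ 0 := right_ne_zero_of_mul hz
    have h1' : z.1 ∈ Function.support b1 := h1
    have h2' : z.2 ∈ Function.support b2 := h2
    rw [b1.support_eq] at h1'
    rw [b2.support_eq] at h2'
    exact ⟨Metric.ball_subset_closedBall h1', Metric.ball_subset_closedBall h2'⟩
  have hK : IsCompact (Metric.closedBall x0 (3*r/4) ×ˢ Metric.closedBall t0 (3*r^2/4)) :=
    (isCompact_closedBall _ _).prod (isCompact_closedBall _ _)
  have hts : tsupport A ⊆ _ := closure_minimal hsub hK.isClosed
  have cs : HasCompactSupport A := HasCompactSupport.of_support_subset_isCompact hK hsub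
  have cb : ∀ F : ZT → ℝ, HasCompactSupport F → Continuous F → ∃ C, ∀ z, |F z| ≤ C := fun F h1 h2 => by
    obtain ⟨C, hC⟩ := h1.exists_bound_of_continuous h2
    exact ⟨C, hC⟩
  have hcf : ∀ F : ZT → ℝ, ContDiff ℝ (⊤ : ℕ∞) F → ∀ w, Continuous fun z => fderiv ℝ F z w := fun F hF w =>
    (hF.continuous_fderiv (by simp)).clm_apply continuous_const
  choose C1 hC1 using fun j => cb (sdz A j) (hcs_fderiv cs _) (hcf A sm _)
  obtain ⟨C2, hC2⟩ := cb (tdz A) (hcs_fderiv cs _) (hcf A sm _)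
  choose C3 hC3 using fun j => cb (sdz (sdz A j) j) (hcs_fderiv (hcs_fderiv cs _) _) (hcf _ (sdz_contDiff sm j) _)
  have flat1 : ∀ z ∈ Metric.ball x0 (r/2) ×ˢ Metric.ball t0 (r^2/2), A z = 1 := fun z hz => by
    have h1 : b1 z.1 = 1 := b1.one_of_mem_closedBall (Metric.ball_subset_closedBall hz.1)
    have h2 : b2 z.2 = 1 := b2.one_of_mem_closedBall (Metric.ball_subset_closedBall hz.2)
    simp [A, h1, h2]
  have ho : IsOpen (Metric.ball x0 (r/2) ×ˢ Metric.ball t0 (r^2/2)) := Metric.isOpen_ball.prod Metric.isOpen_ball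
  have fz : ∀ z ∈ Metric.ball x0 (r/2) ×ˢ Metric.ball t0 (r^2/2), ∀ w, fderiv ℝ A z w = 0 := fun z hz w => by
    have : A =ᶠ[nhds z] fun _ => 1 := by
      filter_upwards [ho.mem_nhds hz] with y hy using flat1 y hy
    rw [this.fderiv_eq]; simp
  have fzz : ∀ j, ∀ z ∈ Metric.ball x0 (r/2) ×ˢ Metric.ball t0 (r^2/2), ∀ w, fderiv ℝ (sdz A j) z w = 0 := fun j z hz w => by
    have : sdz A j =ᶠ[nhds z] fun _ => 0 := by
      filter_upwards [ho.mem_nhds hz] with y hy using fz y hy _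
    rw [this.fderiv_eq]; simp
  have a1 := fun j => (abs_nonneg _).trans (hC1 j 0)
  have a2 := (abs_nonneg _).trans (hC2 0)
  have a3 := fun j => (abs_nonneg _).trans (hC3 j 0)
  have s1 := fun j => Finset.single_le_sum (f := C1) (fun i _ => a1 i) (Finset.mem_univ j)
  have s3 := fun j => Finset.single_le_sum (f := C3) (fun i _ => a3 i) (Finset.mem_univ j)
  have p1 := Finset.sum_nonneg (fun i (_ : i ∈ Finset.univ) => a1 i)
  have p3 := Finset.sum_nonneg (fun i (_ : i ∈ Finset.univ) => a3 i)
  refine ⟨A, ∑ j, C1 j + C2 + ∑ j, C3 j + 1, sm, cs, ?_, fun z => mul_nonneg b1.nonneg b2.nonneg,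
    fun z => mul_le_one₀ b1.le_one b2.nonneg b2.le_one, by positivity, fun j z => (hC1 j z).trans (by linarith [s1 j]),
    fun z => (hC2 z).trans (by linarith), fun j z => (hC3 j z).trans (by linarith [s3 j]), ?_⟩
  · refine hts.trans (prod_mono (Metric.closedBall_subset_ball (by linarith)) ?_)
    intro s hs
    rw [Metric.mem_closedBall, Real.dist_eq, abs_le] at hs
    have := sq_pos_of_pos hr
    show t0 - r^2 < s
    linarith [hs.1]
  · intro z hz
    have hz' : z ∈ Metric.ball x0 (r/2) ×ˢ Metric.ball t0 (r^2/2) := by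
      refine ⟨hz.1, ?_⟩
      rw [Metric.mem_ball, Real.dist_eq, abs_lt]
      have := hz.2.1; have := hz.2.2; have := sq_pos_of_pos hr
      constructor <;> linarith
    exact ⟨flat1 z hz', fun j => fz z hz' _, fz z hz' _, fun j => fzz j z hz' _⟩
end
section
def rem5 (A0 : ZT → ℝ) (h t₁ : ℝ) (a : E3) (T : ℝ) (e : Fin 3) (u : E3) (q : ℝ) (z : ZT) : ℝ :=
  (stp (h⁻¹ * (t₁ - z.2))) * (
    (∑ i, u i * ((tdz A0 z + ∑ j, sdz (sdz A0 j) j z) * gTh a T e i z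
          + 2 * ∑ j, sdz A0 j z * gTh1 a T e i j z))
      + (∑ i, ∑ j, u i * u j * (sdz A0 j z * gTh a T e i z + A0 z * gTh1 a T e i j z))
      + q * ∑ i, sdz A0 i z * gTh a T e i z)
  + h⁻¹ * (lam (h⁻¹ * (t₁ - z.2)) * ∑ i, u i * (sdz A0 i z * gD1 a T e z))
lemma rem5_eq {x0 : E3} {t0 r : ℝ} {A0 : ZT → ℝ} {L : ℝ} (hc : Cut x0 t0 r A0 L) {h t₁ T : ℝ} (hh : 0 < h)
    (hT : t₁ < T) (a : E3) (e : Fin 3) (u : E3) (q : ℝ) (z : ZT) :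
    ((∑ i, u i * (tdz (fun z => (A0 z * stp (h⁻¹ * (t₁ - z.2))) * gTh a T e i z) z +
        ∑ j, sdz (fun w => sdz (fun z => (A0 z * stp (h⁻¹ * (t₁ - z.2))) * gTh a T e i z) j w) j z))
      + (∑ i, ∑ j, u i * u j * sdz (fun z => (A0 z * stp (h⁻¹ * (t₁ - z.2))) * gTh a T e i z) j z)
      + q * ∑ i, sdz (fun z => (A0 z * stp (h⁻¹ * (t₁ - z.2))) * gTh a T e i z) i z)
    + h⁻¹ * ∑ i, u i * sdz (fun z => (A0 z * lam (h⁻¹ * (t₁ - z.2))) * gD1 a T e z) i z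
    - h⁻¹ * (u e * ((A0 z * lam (h⁻¹ * (t₁ - z.2))) * gL a T z)) = rem5 A0 h t₁ a T e u q z := by
  have z1 : ∀ z : ZT, t₁ ≤ z.2 → A0 z * stp (h⁻¹ * (t₁ - z.2)) = 0 := fun z hz => by
    rw [stp_zero (mul_nonpos_of_nonneg_of_nonpos (by positivity) (by linarith))]; simp
  have z2 : ∀ z : ZT, t₁ ≤ z.2 → A0 z * lam (h⁻¹ * (t₁ - z.2)) = 0 := fun z hz => by
    rw [lam_zero (mul_nonpos_of_nonneg_of_nonpos (by positivity) (by linarith))]; simp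
  rw [cut_identity (tc_contDiff hc.sm stp_contDiff h t₁) z1 hT]
  have d1 : ∀ i, sdz (fun z => (A0 z * lam (h⁻¹ * (t₁ - z.2))) * gD1 a T e z) i z
      = sdz A0 i z * lam (h⁻¹ * (t₁ - z.2)) * gD1 a T e z + A0 z * lam (h⁻¹ * (t₁ - z.2)) * gD2 a T i e z := fun i => by
    rw [cut_sdz (tc_contDiff hc.sm lam_contDiff h t₁) z2 hT (fun z hz => gD1_contDiffAt a e hz),
      tc_sdz hc.sm lam_contDiff]
    by_cases hz : z.2 < T
    · rw [hd_D1 a e i hz, gD2_symm a T e i]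
    · rw [z2 z (by linarith)]; simp
  have d2 : tdz (fun z : ZT => A0 z * stp (h⁻¹ * (t₁ - z.2))) z = tdz A0 z * stp (h⁻¹ * (t₁ - z.2))
      - h⁻¹ * (A0 z * lam (h⁻¹ * (t₁ - z.2))) := by
    unfold tdz; rw [tc_hd hc.sm stp_contDiff]; simp [lam]
  have d3 : ∀ j, sdz (fun z : ZT => A0 z * stp (h⁻¹ * (t₁ - z.2))) j = fun z => sdz A0 j z * stp (h⁻¹ * (t₁ - z.2)) :=
    fun j => tc_sdz hc.sm stp_contDiff h t₁ j
  have d4 : ∀ j, sdz (fun z => sdz A0 j z * stp (h⁻¹ * (t₁ - z.2))) j = fun z => sdz (sdz A0 j) j z * stp (h⁻¹ * (t₁ - z.2)) :=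
    fun j => tc_sdz (sdz_contDiff hc.sm j) stp_contDiff h t₁ j
  simp only [d1, d2, d3, d4]
  unfold rem5
  have hth : ∀ i, gTh a T e i z = gD2 a T i e z - gd i e * gL a T z := fun i => rfl
  simp only [hth]
  generalize gL a T z = l at *
  simp only [Fin.sum_univ_three]
  fin_cases e <;> simp [gd] <;> ring
end
section
lemma sum3_bound {f g : Fin 3 → ℝ} {U B : ℝ} (hU : 0 ≤ U) (hf : ∀ i, |f i| ≤ U) (hg : ∀ i, |g i| ≤ B) :
    |∑ i, f i * g i| ≤ 3 * (U * B) := by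
  refine (Finset.abs_sum_le_sum_abs _ _).trans ?_
  calc ∑ i, |f i * g i| ≤ ∑ i : Fin 3, U * B := Finset.sum_le_sum fun i _ => by
        rw [abs_mul]; exact mul_le_mul (hf i) (hg i) (abs_nonneg _) hU
    _ = _ := by simp
lemma gTh_bounds {K : ℝ} (hK : 0 < K) {a : E3} {T : ℝ} {z : ZT}
    (hb : (∀ i j, |gD2 a T i j z| ≤ K / gR a T z ^ 5) ∧ (∀ i j k, |gD3 a T i j k z| ≤ K / gR a T z ^ 6)) (e i j : Fin 3) :
    |gTh a T e i z| ≤ 4 * K / gR a T z ^ 5 ∧ |gTh1 a T e i j z| ≤ 4 * K / gR a T z ^ 6 := by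
  have key : ∀ (x B : ℝ) (y : Fin 3 → ℝ), |x| ≤ B → (∀ k, |y k| ≤ B) → |x - gd i e * ∑ k, y k| ≤ 4 * B := by
    intro x B y hx hy
    have h1 : |gd i e * ∑ k, y k| ≤ 1 * (3 * B) := by
      rw [abs_mul]
      refine mul_le_mul (abs_gd_le _ _) ?_ (abs_nonneg _) (by norm_num)
      refine (Finset.abs_sum_le_sum_abs _ _).trans ((Finset.sum_le_sum fun k _ => hy k).trans (by simp))
    have h2 := abs_sub x (gd i e * ∑ k, y k)
    linarith
  refine ⟨?_, ?_⟩
  · rw [mul_div_assoc]; exact key _ _ (fun k => gD2 a T k k z) (hb.1 i e) fun k => hb.1 k k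
  · rw [mul_div_assoc]; exact key _ _ (fun k => gD3 a T k k j z) (hb.2 i e j) fun k => hb.2 k k j
lemma rem5_bound {K : ℝ} (hK : 0 < K) (hg : ∀ a T z, z.2 < T → |gG a T z| ≤ K / gR a T z ^ 3 ∧
     (∀ i, |gD1 a T i z| ≤ K / gR a T z ^ 4) ∧ (∀ i j, |gD2 a T i j z| ≤ K / gR a T z ^ 5) ∧
     (∀ i j k, |gD3 a T i j k z| ≤ K / gR a T z ^ 6))
    {L1 : ℝ} (hL1 : 0 < L1) (hlam : ∀ s, |lam s| ≤ L1)
    {x0 : E3} {t0 r : ℝ} (hr : 0 < r) {A0 : ZT → ℝ} {L : ℝ} (hc : Cut x0 t0 r A0 L) :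
    ∃ B : ℝ, 0 < B ∧ ∀ (h t₁ T : ℝ) (a : E3) (e : Fin 3) (u : E3) (q : ℝ) (z : ZT), 0 < h →
     a ∈ Metric.ball x0 (r/4) → t₁ ∈ Ioo (t0 - r^2/4) t0 → t₁ < T →
     |rem5 A0 h t₁ a T e u q z| ≤ B * (1 + ‖u‖^2 + |q|)
       + (if z.2 < t₁ then 36 * K * (‖u‖^2 / gR a T z ^ 6) else 0)
       + (if z.2 ∈ Ioo (t₁ - h) t₁ then B * (h⁻¹ * (1 + ‖u‖^2)) else 0) := by
  set d := r / 4 with hd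
  have hd0 : 0 < d := by positivity
  have hL := hc.L0
  set B := K * L * (4/d^5 + 4/d^6 + 1/d^4) with hB
  have hB0 : 0 < B := by positivity
  refine ⟨39 * B + 3 * L1 * B, by positivity, ?_⟩
  intro h t₁ T a e u q z hh ha ht hT
  have hu0 := norm_nonneg u
  have hq0 := abs_nonneg q
  have hrhs1 : 0 ≤ (39 * B + 3 * L1 * B) * (1 + ‖u‖^2 + |q|) := by positivity
  by_cases hz : z.2 < t₁
  swap
  · have : rem5 A0 h t₁ a T e u q z = 0 := by
      unfold rem5
      rw [stp_zero (mul_nonpos_of_nonneg_of_nonpos (by positivity) (by linarith)),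
        lam_zero (mul_nonpos_of_nonneg_of_nonpos (by positivity) (by linarith))]; simp
    rw [this, abs_zero, if_neg hz, if_neg (fun h' => hz h'.2)]
    linarith
  have hzT : z.2 < T := hz.trans hT
  obtain ⟨-, g1, g2, g3⟩ := hg a T z hzT
  set R := gR a T z with hR
  have hR2 : 0 < ‖z.1 - a‖^2 + (T - z.2) := by have := sub_pos.2 hzT; positivity
  have hR0 : 0 < R := by rw [hR]; unfold gR; exact Real.sqrt_pos.2 hR2
  have hTh := fun i => (gTh_bounds hK ⟨g2, g3⟩ e i 0).1
  have hTh1 := fun i j => (gTh_bounds hK ⟨g2, g3⟩ e i j).2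
  have hfar : (∀ X : ℝ, |X| ≤ L → (z ∈ Metric.ball x0 (r/2) ×ˢ Ioo (t0 - r^2/2) t0 → X = 0) →
      (∀ i, |X * gTh a T e i z| ≤ B) ∧ (∀ i j, |X * gTh1 a T e i j z| ≤ B) ∧ |X * gD1 a T e z| ≤ B) := by
    intro X hX hX0
    by_cases hf : z ∈ Metric.ball x0 (r/2) ×ˢ Ioo (t0 - r^2/2) t0
    · rw [hX0 hf]; simp [hB0.le]
    · have hdR : d ≤ R := by
        rw [hR]; unfold gR
        refine Real.le_sqrt_of_sq_le ?_
        by_cases h1 : z.1 ∈ Metric.ball x0 (r/2)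
        · have h2 : ¬ z.2 ∈ Ioo (t0 - r^2/2) t0 := fun h2 => hf ⟨h1, h2⟩
          have h3 : z.2 ≤ t0 - r^2/2 := by
            by_contra h4; exact h2 ⟨not_le.1 h4, hz.trans ht.2⟩
          have h4 := ht.1
          have : d^2 ≤ r^2/4 := by rw [hd]; nlinarith
          nlinarith [sq_nonneg ‖z.1 - a‖]
        · have h2 : r/2 ≤ dist z.1 x0 := by simpa using h1
          have h3 : dist a x0 < r/4 := ha
          have h4 := dist_triangle z.1 a x0
          have h5 : d ≤ ‖z.1 - a‖ := by rw [← dist_eq_norm]; linarith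
          have h6 : d^2 ≤ ‖z.1 - a‖^2 := by gcongr
          linarith
      have e5 : 4 * K / R^5 ≤ 4 * K / d^5 := by gcongr
      have e6 : 4 * K / R^6 ≤ 4 * K / d^6 := by gcongr
      have e4 : K / R^4 ≤ K / d^4 := by gcongr
      have f4 : 0 < K * L * (1/d^4) := by positivity
      have f5 : 0 < K * L * (4/d^5) := by positivity
      have f6 : 0 < K * L * (4/d^6) := by positivity
      refine ⟨fun i => ?_, fun i j => ?_, ?_⟩
      · rw [abs_mul]
        calc |X| * |gTh a T e i z| ≤ L * (4 * K / d^5) :=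
              mul_le_mul hX ((hTh i).trans e5) (abs_nonneg _) hL.le
          _ = K * L * (4/d^5) := by ring
          _ ≤ B := by rw [hB]; linarith
      · rw [abs_mul]
        calc |X| * |gTh1 a T e i j z| ≤ L * (4 * K / d^6) :=
              mul_le_mul hX ((hTh1 i j).trans e6) (abs_nonneg _) hL.le
          _ = K * L * (4/d^6) := by ring
          _ ≤ B := by rw [hB]; linarith
      · rw [abs_mul]
        calc |X| * |gD1 a T e z| ≤ L * (K / d^4) :=
              mul_le_mul hX ((g1 e).trans e4) (abs_nonneg _) hL.le
          _ = K * L * (1/d^4) := by ring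
          _ ≤ B := by rw [hB]; linarith
  have k1 := fun j => hfar _ (hc.bs j z) (fun hf => (hc.flat z hf).2.1 j)
  have k2 := hfar _ (hc.bt z) (fun hf => (hc.flat z hf).2.2.1)
  have k3 := fun j => hfar _ (hc.bss j z) (fun hf => (hc.flat z hf).2.2.2 j)
  have hui : ∀ i, |u i| ≤ ‖u‖ := fun i => by simpa using PiLp.norm_apply_le u i
  have t1 : |∑ i, u i * ((tdz A0 z + ∑ j, sdz (sdz A0 j) j z) * gTh a T e i z
          + 2 * ∑ j, sdz A0 j z * gTh1 a T e i j z)| ≤ 3 * (‖u‖ * (10 * B)) := by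
    refine sum3_bound hu0 hui fun i => ?_
    have a0 := abs_le.1 (k2.1 i)
    have a1 := fun j => abs_le.1 ((k3 j).1 i)
    have a2 := fun j => abs_le.1 ((k1 j).2.1 i j)
    have b0 := a1 0; have b1 := a1 1; have b2 := a1 2
    have c0 := a2 0; have c1 := a2 1; have c2 := a2 2
    simp only [Fin.sum_univ_three, add_mul]
    rw [abs_le]; constructor <;> linarith [a0.1, a0.2, b0.1, b0.2, b1.1, b1.2, b2.1, b2.2, c0.1, c0.2, c1.1, c1.2, c2.1, c2.2]
  have t2 : |∑ i, ∑ j, u i * u j * (sdz A0 j z * gTh a T e i z + A0 z * gTh1 a T e i j z)| ≤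
      3 * (‖u‖ * (3 * (‖u‖ * (B + 4 * K / R^6)))) := by
    have : ∀ i, ∑ j, u i * u j * (sdz A0 j z * gTh a T e i z + A0 z * gTh1 a T e i j z) = u i *
       ∑ j, u j * (sdz A0 j z * gTh a T e i z + A0 z * gTh1 a T e i j z) := fun i => by
      rw [Finset.mul_sum]; refine Finset.sum_congr rfl fun j _ => by ring
    simp only [this]
    refine sum3_bound hu0 hui fun i => sum3_bound hu0 hui fun j => ?_
    refine (abs_add_le _ _).trans (add_le_add ((k1 j).1 i) ?_)
    rw [abs_mul, abs_of_nonneg (hc.nn z)]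
    exact (mul_le_of_le_one_left (abs_nonneg _) (hc.le z)).trans (hTh1 i j)
  have t3 : |q * ∑ i, sdz A0 i z * gTh a T e i z| ≤ |q| * (3 * B) := by
    rw [abs_mul]; gcongr
    refine (Finset.abs_sum_le_sum_abs _ _).trans ((Finset.sum_le_sum fun k _ => (k1 k).1 k).trans (by simp))
  have t4 : |∑ i, u i * (sdz A0 i z * gD1 a T e z)| ≤ 3 * (‖u‖ * B) := sum3_bound hu0 hui fun i => (k1 i).2.2
  have hu2 : ‖u‖ ≤ 1 + ‖u‖^2 := by nlinarith [sq_nonneg (‖u‖ - 1)]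
  have t5 : |h⁻¹ * (lam (h⁻¹ * (t₁ - z.2)) * ∑ i, u i * (sdz A0 i z * gD1 a T e z))| ≤
      (if z.2 ∈ Ioo (t₁ - h) t₁ then (39 * B + 3 * L1 * B) * (h⁻¹ * (1 + ‖u‖^2)) else 0) := by
    split_ifs with h1
    · rw [abs_mul, abs_mul, abs_of_pos (inv_pos.2 hh)]
      calc h⁻¹ * (|lam (h⁻¹ * (t₁ - z.2))| * |∑ i, u i * (sdz A0 i z * gD1 a T e z)|)
          ≤ h⁻¹ * (L1 * (3 * (‖u‖ * B))) := by gcongr; exact hlam _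
        _ ≤ h⁻¹ * (L1 * (3 * ((1 + ‖u‖^2) * B))) := by gcongr
        _ = (3 * L1 * B) * (h⁻¹ * (1 + ‖u‖^2)) := by ring
        _ ≤ _ := by gcongr; linarith
    · have : t₁ - h ≥ z.2 := by
        by_contra h2; exact h1 ⟨not_le.1 h2, hz⟩
      rw [lam_zero' ?_]; · simp
      rw [inv_mul_eq_div, le_div_iff₀ hh]; linarith
  unfold rem5
  rw [if_pos hz]
  refine (abs_add_le _ _).trans (add_le_add ?_ t5)
  rw [abs_mul]
  refine (mul_le_of_le_one_left (abs_nonneg _) (stp_abs _)).trans ?_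
  refine (abs_add_three _ _ _).trans ((add_le_add_three t1 t2 t3).trans ?_)
  have q1 : 0 ≤ L1 * B := by positivity
  have q2 : 0 ≤ B * |q| := by positivity
  have q3 : 0 ≤ B * ‖u‖^2 := by positivity
  have q4 := mul_le_mul_of_nonneg_left hu2 hB0.le
  have q5 : 0 ≤ L1 * B * (1 + ‖u‖^2 + |q|) := by positivity
  have q6 : 3 * (‖u‖ * (3 * (‖u‖ * (B + 4 * K / R^6)))) = 9 * (B * ‖u‖^2) + 36 * K * (‖u‖^2 / R^6) := by ring
  rw [q6]
  nlinarith
end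
section
structure CH (v : ZT → E3) (p : ZT → ℝ) (x0 : E3) (t0 r : ℝ) (K2 : ℝ≥0∞) : Prop where
  mv : Measurable v
  mp : Measurable p
  hK : K2 ≠ ∞
  vb : ∀ᵐ t ∂(volume.restrict (Ioo (t0 - r^2) t0)), ∫⁻ x in Metric.ball x0 r, ‖v (x,t)‖ₑ ^ 2 ≤ K2
  ip : IntegrableOn p (pcyl (x0, t0) r)
  hB : CB v p (pcyl (x0, t0) r)
  hD : CD v (pcyl (x0, t0) r)
lemma restrict_pcyl (x0 : E3) (t0 r : ℝ) : (volume : Measure ZT).restrict (pcyl (x0, t0) r)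
    = (volume.restrict (Metric.ball x0 r)).prod (volume.restrict (Ioo (t0 - r^2) t0)) := by
  unfold pcyl; rw [Measure.prod_restrict]; rfl
lemma lint_pcyl (x0 : E3) (t0 r : ℝ) {f : ZT → ℝ≥0∞} (hf : Measurable f) :
    ∫⁻ z in pcyl (x0, t0) r, f z = ∫⁻ t in Ioo (t0 - r^2) t0, ∫⁻ x in Metric.ball x0 r, f (x, t) := by
  rw [restrict_pcyl, lintegral_prod_symm _ hf.aemeasurable]
lemma meas_pcyl (x0 : E3) (t0 r : ℝ) : MeasurableSet (pcyl (x0, t0) r) :=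
  measurableSet_ball.prod measurableSet_Ioo
lemma vol_pcyl_lt (x0 : E3) (t0 r : ℝ) : volume (pcyl (x0, t0) r) < ∞ := by
  unfold pcyl
  rw [Measure.volume_eq_prod, Measure.prod_prod]
  exact mul_lt_top measure_ball_lt_top (by simp)
variable {v : ZT → E3} {p : ZT → ℝ} {x0 : E3} {t0 r : ℝ} {K2 : ℝ≥0∞}
lemma CH.v2 (H : CH v p x0 t0 r K2) : ∫⁻ z in pcyl (x0, t0) r, ‖v z‖ₑ ^ 2 < ∞ := by
  have := H.mv
  rw [lint_pcyl _ _ _ (by fun_prop)]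
  calc _ ≤ ∫⁻ t in Ioo (t0 - r^2) t0, K2 := lintegral_mono_ae H.vb
    _ < ∞ := by simp only [lintegral_const]; exact mul_lt_top H.hK.lt_top (by simp)
lemma CH.iv2 (H : CH v p x0 t0 r K2) : IntegrableOn (fun z => ‖v z‖ ^ 2) (pcyl (x0, t0) r) := by
  have := H.mv
  refine ⟨by fun_prop, ?_⟩
  have h2 := H.v2
  rw [hasFiniteIntegral_iff_enorm]
  simpa using h2
lemma CH.i1 : IntegrableOn (fun _ : ZT => (1:ℝ)) (pcyl (x0, t0) r) := by
  rw [integrableOn_const_iff]; right; exact vol_pcyl_lt _ _ _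
lemma abs_apply_le (u : E3) (i : Fin 3) : |u i| ≤ ‖u‖ := by simpa using PiLp.norm_apply_le u i
lemma CH.ivi (H : CH v p x0 t0 r K2) (i : Fin 3) : IntegrableOn (fun z => v z i) (pcyl (x0, t0) r) := by
  have := H.mv
  refine Integrable.mono' (CH.i1.add H.iv2) (by fun_prop) (ae_of_all _ fun z => ?_)
  have h1 := abs_apply_le (v z) i
  simp only [Pi.add_apply, Real.norm_eq_abs]
  nlinarith [sq_nonneg (‖v z‖ - 1)]
lemma CH.ivij (H : CH v p x0 t0 r K2) (i j : Fin 3) : IntegrableOn (fun z => v z i * v z j) (pcyl (x0, t0) r) := by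
  have := H.mv
  refine Integrable.mono' H.iv2 (by fun_prop) (ae_of_all _ fun z => ?_)
  rw [Real.norm_eq_abs, abs_mul, pow_two]
  exact mul_le_mul (abs_apply_le _ _) (abs_apply_le _ _) (abs_nonneg _) (norm_nonneg _)
lemma int_mul_cc {g f : ZT → ℝ} {Q : Set ZT} (hg : IntegrableOn g Q) (hf : Continuous f) (hc : HasCompactSupport f) :
    IntegrableOn (fun z => g z * f z) Q := by
  obtain ⟨C, hC⟩ := hc.exists_bound_of_continuous hf
  exact Integrable.mul_bdd (c := C) hg hf.aestronglyMeasurable (ae_of_all _ hC)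
lemma cont_fd {F : ZT → ℝ} (hF : ContDiff ℝ (⊤ : ℕ∞) F) (w : ZT) : Continuous fun z => fderiv ℝ F z w :=
  (hF.continuous_fderiv (by simp)).clm_apply continuous_const
lemma CH.int_CB (H : CH v p x0 t0 r K2) {φ : Fin 3 → ZT → ℝ} (h1 : ∀ i, ContDiff ℝ (⊤ : ℕ∞) (φ i))
    (h2 : ∀ i, HasCompactSupport (φ i)) : IntegrableOn (fun z =>
      ((∑ i, v z i * (tdz (φ i) z + ∑ j, sdz (fun w => sdz (φ i) j w) j z))
      + (∑ i, ∑ j, v z i * v z j * sdz (φ i) j z) + p z * ∑ i, sdz (φ i) i z)) (pcyl (x0, t0) r) := by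
  have c1 : ∀ i j, Continuous (sdz (φ i) j) := fun i j => cont_fd (h1 i) _
  have c2 : ∀ i j, Continuous (fun z => sdz (fun w => sdz (φ i) j w) j z) := fun i j => cont_fd (sdz_contDiff (h1 i) j) _
  have c3 : ∀ i, Continuous (tdz (φ i)) := fun i => cont_fd (h1 i) _
  have s1 : ∀ i j, HasCompactSupport (sdz (φ i) j) := fun i j => hcs_fderiv (h2 i) _
  have s2 : ∀ i j, HasCompactSupport (fun z => sdz (fun w => sdz (φ i) j w) j z) := fun i j => hcs_fderiv (s1 i j) _
  have s3 : ∀ i, HasCompactSupport (tdz (φ i)) := fun i => hcs_fderiv (h2 i) _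
  refine Integrable.add (Integrable.add ?_ ?_) ?_
  · refine integrable_finsetSum _ fun i _ => int_mul_cc (H.ivi i) ?_ ?_
    · exact (c3 i).add (continuous_finsetSum _ fun j _ => c2 i j)
    · simp only [Fin.sum_univ_three]
      exact (s3 i).add (((s2 i 0).add (s2 i 1)).add (s2 i 2))
  · exact integrable_finsetSum _ fun i _ => integrable_finsetSum _ fun j _ => int_mul_cc (H.ivij i j) (c1 i j) (s1 i j)
  · refine int_mul_cc H.ip (continuous_finsetSum _ fun j _ => c1 j j) ?_
    simp only [Fin.sum_univ_three]
    exact (((s1 0 0).add (s1 1 1)).add (s1 2 2))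
lemma CH.int_CD (H : CH v p x0 t0 r K2) {ψ : ZT → ℝ} (h1 : ContDiff ℝ (⊤ : ℕ∞) ψ)
    (h2 : HasCompactSupport ψ) : IntegrableOn (fun z => ∑ i, v z i * sdz ψ i z) (pcyl (x0, t0) r) :=
  integrable_finsetSum _ fun i _ => int_mul_cc (H.ivi i) (cont_fd h1 _) (hcs_fderiv h2 _)
lemma Cut.tsupp {A0 : ZT → ℝ} {L : ℝ} (hc : Cut x0 t0 r A0 L) {t₁ : ℝ} (ht : t₁ < t0) {F : ZT → ℝ}
    (h1 : ∀ z, A0 z = 0 → F z = 0) (h2 : ∀ z, t₁ ≤ z.2 → F z = 0) :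
    HasCompactSupport F ∧ tsupport F ⊆ pcyl (x0, t0) r := by
  have hs : Function.support F ⊆ tsupport A0 ∩ {z | z.2 ≤ t₁} := fun z hz =>
    ⟨subset_tsupport _ (fun h => hz (h1 z h)), by
      by_contra h; exact hz (h2 z (le_of_lt (not_le.1 h)))⟩
  have hcl : IsClosed (tsupport A0 ∩ {z : ZT | z.2 ≤ t₁}) :=
    (isClosed_tsupport _).inter (isClosed_le continuous_snd continuous_const)
  refine ⟨HasCompactSupport.of_support_subset_isCompact (hc.cs.isCompact.inter_right
    (isClosed_le continuous_snd continuous_const)) hs, (closure_minimal hs hcl).trans ?_⟩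
  intro z hz
  have := hc.supp hz.1
  exact ⟨this.1, this.2, lt_of_le_of_lt hz.2 ht⟩
lemma CH.slab (H : CH v p x0 t0 r K2) {h : ℝ} (hh : 0 < h) (t₁ : ℝ) :
    ∫⁻ z in pcyl (x0, t0) r, (if z.2 ∈ Ioo (t₁ - h) t₁ then (ENNReal.ofReal h⁻¹ * (1 + ‖v z‖ₑ^2)) else 0)
     ≤ volume (Metric.ball x0 r) + K2 := by
  have mv := H.mv
  have m2 : Measurable (fun z : ZT => if z.2 ∈ Ioo (t₁ - h) t₁ then (ENNReal.ofReal h⁻¹ * (1 + ‖v z‖ₑ^2)) else 0) := by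
    refine Measurable.ite (measurable_snd measurableSet_Ioo) (by fun_prop) measurable_const
  rw [lint_pcyl _ _ _ m2]
  calc _ ≤ ∫⁻ t in Ioo (t0 - r^2) t0, (Ioo (t₁ - h) t₁).indicator (fun _ => (ENNReal.ofReal h⁻¹ *
        (volume (Metric.ball x0 r) + K2))) t := by
        refine lintegral_mono_ae ?_
        filter_upwards [H.vb] with t ht2
        by_cases h3 : t ∈ Ioo (t₁ - h) t₁
        · simp only [h3, if_true, indicator_of_mem]
          rw [lintegral_const_mul _ (by fun_prop), lintegral_add_left (by fun_prop)]
          simp only [lintegral_const, one_mul, Measure.restrict_apply_univ]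
          gcongr
        · simp [h3]
    _ ≤ ∫⁻ t, (Ioo (t₁ - h) t₁).indicator (fun _ => (ENNReal.ofReal h⁻¹ *
        (volume (Metric.ball x0 r) + K2))) t := setLIntegral_le_lintegral _ _
    _ = ((ENNReal.ofReal h⁻¹ * ENNReal.ofReal h) * (volume (Metric.ball x0 r) + K2)) := by
        rw [lintegral_indicator measurableSet_Ioo]; simp; ring
    _ = _ := by rw [← ofReal_mul (by positivity), inv_mul_cancel₀ hh.ne']; simp
lemma CH.key (H : CH v p x0 t0 r K2) (hr : 0 < r) {A0 : ZT → ℝ} {L : ℝ} (hc : Cut x0 t0 r A0 L)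
   {K : ℝ} (hK : 0 < K) (hg : ∀ a T z, z.2 < T → |gG a T z| ≤ K / gR a T z ^ 3 ∧
     (∀ i, |gD1 a T i z| ≤ K / gR a T z ^ 4) ∧ (∀ i j, |gD2 a T i j z| ≤ K / gR a T z ^ 5) ∧
     (∀ i j k, |gD3 a T i j k z| ≤ K / gR a T z ^ 6)) :
    ∃ M : ℝ≥0∞, M ≠ ∞ ∧ ∀ (h t₁ T : ℝ) (a : E3) (e : Fin 3), 0 < h →
     a ∈ Metric.ball x0 (r/4) → t₁ ∈ Ioo (t0 - r^2/4) t0 → t₁ < T →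
     ‖∫ z in pcyl (x0, t0) r, h⁻¹ * (v z e * ((A0 z * lam (h⁻¹ * (t₁ - z.2))) * gL a T z))‖ₑ ≤
       M + ∫⁻ z in pcyl (x0, t0) r, (if z.2 < t₁ then ENNReal.ofReal (36 * K) * (‖v z‖ₑ ^ 2 *
         ENNReal.ofReal (1 / gR a T z ^ 6)) else 0) := by
  obtain ⟨L1, hL1, hlam⟩ := lam_bdd
  obtain ⟨B, hB, hrem⟩ := rem5_bound hK hg hL1 hlam hr hc
  have mv := H.mv
  have mp := H.mp
  have hM1 : ∫⁻ z in pcyl (x0, t0) r, ENNReal.ofReal (B * (1 + ‖v z‖^2 + |p z|)) < ∞ := by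
    have : IntegrableOn (fun z => B * (1 + ‖v z‖^2 + |p z|)) (pcyl (x0, t0) r) :=
      ((CH.i1.add H.iv2).add H.ip.abs).const_mul B
    exact this.lintegral_lt_top
  have hM2 : ENNReal.ofReal B * (volume (Metric.ball x0 r) + K2) < ∞ :=
    mul_lt_top ofReal_lt_top (add_lt_top.2 ⟨measure_ball_lt_top, H.hK.lt_top⟩)
  refine ⟨_, (add_lt_top.2 ⟨hM1, hM2⟩).ne, ?_⟩
  intro h t₁ T a e hh ha ht hT
  have z1 : ∀ z : ZT, t₁ ≤ z.2 → A0 z * stp (h⁻¹ * (t₁ - z.2)) = 0 := fun z hz => by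
    rw [stp_zero (mul_nonpos_of_nonneg_of_nonpos (by positivity) (by linarith))]; simp
  have z2 : ∀ z : ZT, t₁ ≤ z.2 → A0 z * lam (h⁻¹ * (t₁ - z.2)) = 0 := fun z hz => by
    rw [lam_zero (mul_nonpos_of_nonneg_of_nonpos (by positivity) (by linarith))]; simp
  have f1 : ∀ i, ContDiff ℝ (⊤ : ℕ∞) (fun z => (A0 z * stp (h⁻¹ * (t₁ - z.2))) * gTh a T e i z) := fun i =>
    cut_contDiff (tc_contDiff hc.sm stp_contDiff h t₁) z1 hT (fun z hz => gTh_contDiffAt a e i hz)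
  have f2 : ContDiff ℝ (⊤ : ℕ∞) (fun z => (A0 z * lam (h⁻¹ * (t₁ - z.2))) * gD1 a T e z) :=
    cut_contDiff (tc_contDiff hc.sm lam_contDiff h t₁) z2 hT (fun z hz => gD1_contDiffAt a e hz)
  have f3 : ContDiff ℝ (⊤ : ℕ∞) (fun z => (A0 z * lam (h⁻¹ * (t₁ - z.2))) * gL a T z) :=
    cut_contDiff (tc_contDiff hc.sm lam_contDiff h t₁) z2 hT (fun z hz => gL_contDiffAt a hz)
  have g1 := fun i => hc.tsupp ht.2 (F := fun z => (A0 z * stp (h⁻¹ * (t₁ - z.2))) * gTh a T e i z)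
    (fun z hz => by simp [hz]) (fun z hz => by simp only [z1 z hz]; simp)
  have g2 := hc.tsupp ht.2 (F := fun z => (A0 z * lam (h⁻¹ * (t₁ - z.2))) * gD1 a T e z)
    (fun z hz => by simp [hz]) (fun z hz => by simp only [z2 z hz]; simp)
  have g3 := hc.tsupp ht.2 (F := fun z => (A0 z * lam (h⁻¹ * (t₁ - z.2))) * gL a T z)
    (fun z hz => by simp [hz]) (fun z hz => by simp only [z2 z hz]; simp)
  have i1 := H.int_CB f1 (fun i => (g1 i).1)
  have e1 := H.hB _ f1 (fun i => (g1 i).1) (fun i => (g1 i).2)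
  have i2 := (H.int_CD f2 g2.1).const_mul h⁻¹
  have e2 := H.hD _ f2 g2.1 g2.2
  have i3 := (int_mul_cc (H.ivi e) f3.continuous g3.1).const_mul h⁻¹
  have tot := integral_sub (i1.add i2) i3
  rw [integral_add' i1 i2, e1, integral_const_mul h⁻¹ (fun z => ∑ i, v z i * _), e2] at tot
  simp only [mul_zero, zero_add, zero_sub, Pi.add_apply] at tot
  rw [← enorm_neg, ← tot]
  have hre : ∀ z, _ = rem5 A0 h t₁ a T e (v z) (p z) z := fun z => rem5_eq hc hh hT a e (v z) (p z) z
  rw [integral_congr_ae (ae_of_all _ hre)]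
  refine (enorm_integral_le_lintegral_enorm _).trans ?_
  have step : ∀ z, ‖rem5 A0 h t₁ a T e (v z) (p z) z‖ₑ ≤ ENNReal.ofReal (B * (1 + ‖v z‖^2 + |p z|))
     + (if z.2 ∈ Ioo (t₁ - h) t₁ then ENNReal.ofReal B * (ENNReal.ofReal h⁻¹ * (1 + ‖v z‖ₑ^2)) else 0)
     + (if z.2 < t₁ then ENNReal.ofReal (36 * K) * (‖v z‖ₑ ^ 2 * ENNReal.ofReal (1 / gR a T z ^ 6)) else 0) := by
    intro z
    have h1 := hrem h t₁ T a e (v z) (p z) z hh ha ht hT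
    have e0 : ‖v z‖ₑ ^ 2 = ENNReal.ofReal (‖v z‖ ^ 2) := by
      rw [ofReal_pow (norm_nonneg _), ofReal_norm]
    have e1 : (if z.2 < t₁ then ENNReal.ofReal (36 * K) * (‖v z‖ₑ ^ 2 * ENNReal.ofReal (1 / gR a T z ^ 6)) else 0)
       = ENNReal.ofReal (if z.2 < t₁ then 36 * K * (‖v z‖^2 / gR a T z ^ 6) else 0) := by
      split_ifs
      · rw [e0, ← ofReal_mul (by positivity), ← ofReal_mul (by positivity)]; congr 1; ring
      · simp
    have e2 : (if z.2 ∈ Ioo (t₁ - h) t₁ then ENNReal.ofReal B * (ENNReal.ofReal h⁻¹ * (1 + ‖v z‖ₑ^2)) else 0)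
       = ENNReal.ofReal (if z.2 ∈ Ioo (t₁ - h) t₁ then B * (h⁻¹ * (1 + ‖v z‖^2)) else 0) := by
      split_ifs
      · rw [e0, ofReal_mul hB.le, ofReal_mul (by positivity), ofReal_add (by norm_num) (by positivity)]
        simp
      · simp
    rw [e1, e2, ← ofReal_add (by positivity) (by positivity), ← ofReal_add (by positivity) ?_, ← ofReal_norm]
    · refine ofReal_le_ofReal (h1.trans (by linarith))
    · have : 0 ≤ gR a T z := Real.sqrt_nonneg _
      positivity
  refine (lintegral_mono step).trans ?_
  have m2 : Measurable (fun z : ZT => if z.2 ∈ Ioo (t₁ - h) t₁ then ENNReal.ofReal B * (ENNReal.ofReal h⁻¹ * (1 + ‖v z‖ₑ^2)) else 0) := by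
    refine Measurable.ite (measurable_snd measurableSet_Ioo) (by fun_prop) measurable_const
  rw [lintegral_add_left (by fun_prop), lintegral_add_left (by fun_prop)]
  gcongr
  calc _ = ∫⁻ z in pcyl (x0, t0) r, ENNReal.ofReal B *
        (if z.2 ∈ Ioo (t₁ - h) t₁ then (ENNReal.ofReal h⁻¹ * (1 + ‖v z‖ₑ^2)) else 0) := by
        congr 1; ext z; split_ifs <;> simp
    _ = ENNReal.ofReal B * ∫⁻ z in pcyl (x0, t0) r,
        (if z.2 ∈ Ioo (t₁ - h) t₁ then (ENNReal.ofReal h⁻¹ * (1 + ‖v z‖ₑ^2)) else 0) :=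
        lintegral_const_mul' _ _ ofReal_ne_top
    _ ≤ _ := by gcongr; exact H.slab hh t₁
end
section
lemma gL_eq (a : E3) (T : ℝ) (z : ZT) : gL a T z = (gc T z * gc T z * gq a z - 3 * gc T z) * gG a T z := by
  unfold gL gD2 gq; simp only [Fin.sum_univ_three]; simp [gd]; ring
lemma gG_shift (a : E3) (T T' : ℝ) (z : ZT) : gG a T z = gG a T' (z.1, z.2 + T' - T) := by
  have : T' - (z.2 + T' - T) = T - z.2 := by ring
  simp only [gG, gc, gq, gX, this]
lemma gL_shift (a : E3) (T T' : ℝ) (z : ZT) : gL a T z = gL a T' (z.1, z.2 + T' - T) := by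
  rw [gL_eq, gL_eq, gG_shift a T T']
  have : T' - (z.2 + T' - T) = T - z.2 := by ring
  simp only [gc, gq, gX, this]
lemma gG_hasDerivAt (a : E3) {T : ℝ} {z : ZT} (hz : z.2 < T) : HasDerivAt (fun T => gG a T z) (gL a T z) T := by
  have e : (fun T' => gG a T' z) = (fun T' => gG a T (z.1, z.2 + T - T')) := by
    funext T'; exact gG_shift a T' T z
  rw [e]
  have h1 := hd_G a (0, -1) (z := (z.1, z.2 + T - T)) (T := T) (by simpa using hz)
  have h2 : HasDerivAt (fun T' : ℝ => ((z.1, z.2 + T - T') : ZT)) (0, -1) T :=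
    (hasDerivAt_const _ _).prodMk ((hasDerivAt_id _).const_sub _)
  have h3 := h1.1.hasFDerivAt.comp_hasDerivAt T h2
  rw [h1.2] at h3
  refine HasDerivAt.congr_deriv h3 ?_
  rw [gL_eq]
  simp
lemma gL_contOn (a : E3) (z : ZT) : ContinuousOn (fun T => gL a T z) (Ioi z.2) := by
  intro T hT
  have e : (fun T' => gL a T' z) = (fun T' => gL a T (z.1, z.2 + T - T')) := by
    funext T'; exact gL_shift a T' T z
  rw [e]
  have h0 : ContinuousAt (gL a T) (z.1, z.2 + T - T) := (gL_contDiffAt a (by simpa using hT)).continuousAt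
  have h1 : ContinuousAt (fun T' : ℝ => ((z.1, z.2 + T - T') : ZT)) T := by fun_prop
  exact (ContinuousAt.comp (f := fun T' : ℝ => ((z.1, z.2 + T - T') : ZT)) (g := gL a T) h0 h1).continuousWithinAt
lemma gL_ftc (a : E3) {α β : ℝ} (hab : α ≤ β) {z : ZT} (hz : z.2 < α) :
    ∫ T in Ioc α β, gL a T z = gG a β z - gG a α z := by
  rw [← intervalIntegral.integral_of_le hab]
  refine intervalIntegral.integral_eq_sub_of_hasDerivAt (fun T hT => gG_hasDerivAt a ?_) ?_
  · rw [uIcc_of_le hab] at hT; linarith [hT.1]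
  · refine ContinuousOn.intervalIntegrable ((gL_contOn a z).mono fun T hT => ?_)
    rw [uIcc_of_le hab] at hT; exact lt_of_lt_of_le hz hT.1
lemma cube_int {b α β t₁ : ℝ} (hab : α ≤ β) (h1 : t₁ ≤ α) (hb : 0 < b + t₁) :
    ∫⁻ T in Ioc α β, ENNReal.ofReal (1 / (b + T)^3) ≤ ENNReal.ofReal (1/2 * (1 / (b + t₁)^2)) := by
  have hpos : ∀ T ∈ Icc α β, 0 < b + T := fun T hT => by linarith [hT.1]
  have hc : ContinuousOn (fun T : ℝ => 1 / (b + T)^3) (Icc α β) := by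
    refine ContinuousOn.div continuousOn_const (by fun_prop) fun T hT => (pow_pos (hpos T hT) 3).ne'
  have hi : IntegrableOn (fun T : ℝ => 1 / (b + T)^3) (Ioc α β) :=
    (hc.integrableOn_Icc).mono_set Ioc_subset_Icc_self
  rw [← ofReal_integral_eq_lintegral_ofReal hi]
  · refine ofReal_le_ofReal ?_
    rw [← intervalIntegral.integral_of_le hab]
    have : ∫ T in α..β, 1 / (b + T)^3 = (-(1/2) * (1 / (b + β)^2)) - (-(1/2) * (1 / (b + α)^2)) := by
      refine intervalIntegral.integral_eq_sub_of_hasDerivAt (f := fun T => -(1/2) * (1 / (b + T)^2)) (fun T hT => ?_) ?_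
      · rw [uIcc_of_le hab] at hT
        have hp := hpos T hT
        have h2 : HasDerivAt (fun T : ℝ => (b + T)^2) (2 * (b + T)) T := by
          refine HasDerivAt.congr_deriv (((hasDerivAt_id T).const_add b).pow 2) ?_
          simp
        have h3 := ((h2.inv (pow_pos hp 2).ne')).const_mul (-(1/2) : ℝ)
        have e : (fun T : ℝ => -(1/2) * (1/(b+T)^2)) = fun y => -(1/2) * (fun T : ℝ => (b+T)^2)⁻¹ y := by
          funext y; simp
        rw [e]
        refine HasDerivAt.congr_deriv h3 ?_
        field_simp
      · refine ContinuousOn.intervalIntegrable ?_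
        rwa [uIcc_of_le hab]
    rw [this]
    have h5 : 0 < b + β := hpos β ⟨hab, le_rfl⟩
    have h4 : 1 / (b + α)^2 ≤ 1 / (b + t₁)^2 := by gcongr
    have h6 : 0 < 1 / (b + β)^2 := by positivity
    linarith
  · filter_upwards [ae_restrict_mem measurableSet_Ioc] with T hT
    have := hpos T (Ioc_subset_Icc_self hT)
    simp only [Pi.zero_apply]; positivity
lemma gR6_int {a : E3} {t₁ α β : ℝ} (hab : α ≤ β) (h1 : t₁ ≤ α) {z : ZT} (hz : z.2 < t₁) :
    ∫⁻ T in Ioc α β, ENNReal.ofReal (1 / gR a T z ^ 6) ≤ pk 4 (a, t₁) z := by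
  have e : ∀ T ∈ Ioc α β, ENNReal.ofReal (1 / gR a T z ^ 6) = ENNReal.ofReal (1 / ((‖z.1 - a‖^2 - z.2) + T)^3) := by
    intro T hT
    have : gR a T z ^ 6 = (gR a T z ^ 2)^3 := by ring
    rw [this, gR, Real.sq_sqrt (by have := hT.1; nlinarith [sq_nonneg ‖z.1 - a‖])]
    congr 3; ring
  rw [setLIntegral_congr_fun measurableSet_Ioc e]
  have hb : 0 < (‖z.1 - a‖^2 - z.2) + t₁ := by nlinarith [sq_nonneg ‖z.1 - a‖]
  refine (cube_int hab h1 hb).trans ?_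
  unfold pk
  set d := pd (a, t₁) z with hd
  have hd0 : 0 < d := lt_of_lt_of_le (Real.sqrt_pos.2 (abs_pos.2 (by simp; linarith))) (le_max_right _ _)
  have hd2 : d^2 ≤ (‖z.1 - a‖^2 - z.2) + t₁ := by
    rw [hd]; unfold pd
    rcases max_choice ‖a - z.1‖ (√|t₁ - z.2|) with h | h
    · rw [h, norm_sub_rev]; linarith
    · rw [h, Real.sq_sqrt (abs_nonneg _), abs_of_pos (by linarith)]; nlinarith [sq_nonneg ‖z.1 - a‖]
  rw [ofReal_rpow_of_pos hd0]
  refine ofReal_le_ofReal ?_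
  rw [Real.rpow_neg hd0.le, show (4:ℝ) = ((4:ℕ):ℝ) by norm_num, Real.rpow_natCast]
  have : 1 / ((‖z.1 - a‖^2 - z.2) + t₁)^2 ≤ 1 / (d^2)^2 := by gcongr
  have h6 : 0 < 1 / ((‖z.1 - a‖^2 - z.2) + t₁)^2 := by positivity
  rw [← pow_mul] at this
  rw [one_div (d ^ _)] at this
  linarith
lemma gG_meas (a : E3) : Measurable (fun q : ℝ × ZT => gG a q.1 q.2) := by
  unfold gG gc gq gX; fun_prop
lemma gL_meas (a : E3) : Measurable (fun q : ℝ × ZT => gL a q.1 q.2) := by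
  simp only [gL_eq]
  unfold gG gc gq gX; fun_prop
lemma gR_meas (a : E3) : Measurable (fun q : ℝ × ZT => gR a q.1 q.2) := by
  unfold gR; fun_prop
end
section
variable {v : ZT → E3} {p : ZT → ℝ} {x0 : E3} {t0 r : ℝ} {K2 : ℝ≥0∞}
lemma gR_lower {a : E3} {T s : ℝ} {z : ZT} (hs : 0 ≤ s) (h : s^2 ≤ T - z.2) : s ≤ gR a T z := by
  unfold gR
  exact Real.le_sqrt_of_sq_le (by nlinarith [sq_nonneg ‖z.1 - a‖])
lemma lam_supp {h t₁ τ : ℝ} (hh : 0 < h) (hz : τ ∉ Ioo (t₁ - h) t₁) : lam (h⁻¹ * (t₁ - τ)) = 0 := by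
  rw [mem_Ioo, not_and_or, not_lt, not_lt] at hz
  rcases hz with h1 | h1
  · apply lam_zero'
    rw [inv_mul_eq_div, le_div_iff₀ hh]; linarith
  · exact lam_zero (mul_nonpos_of_nonneg_of_nonpos (by positivity) (by linarith))
lemma CH.key2 (H : CH v p x0 t0 r K2) (hr : 0 < r) {A0 : ZT → ℝ} {L : ℝ} (hc : Cut x0 t0 r A0 L)
   {K : ℝ} (hK : 0 < K) (hg : ∀ a T z, z.2 < T → |gG a T z| ≤ K / gR a T z ^ 3 ∧
     (∀ i, |gD1 a T i z| ≤ K / gR a T z ^ 4) ∧ (∀ i j, |gD2 a T i j z| ≤ K / gR a T z ^ 5) ∧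
     (∀ i j k, |gD3 a T i j k z| ≤ K / gR a T z ^ 6)) :
    ∃ M : ℝ≥0∞, M ≠ ∞ ∧ ∀ (h t₁ : ℝ) (a : E3) (e : Fin 3), 0 < h →
     a ∈ Metric.ball x0 (r/4) → t₁ ∈ Ioo (t0 - r^2/4) t0 →
     ‖∫ z in pcyl (x0, t0) r, h⁻¹ * (v z e * ((A0 z * lam (h⁻¹ * (t₁ - z.2))) * gG a (t₁ + h) z))‖ₑ ≤
       M + ENNReal.ofReal (36 * K) * ∫⁻ z in pcyl (x0, t0) r, pk 4 (a, t₁) z * ‖v z‖ₑ ^ 2 := by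
  obtain ⟨M, hM, hkey⟩ := H.key hr hc hK hg
  obtain ⟨L1, hL1, hlam⟩ := lam_bdd
  have mv := H.mv
  have hM2 : ENNReal.ofReal (L1 * (K / r^3)) * (volume (Metric.ball x0 r) + K2) < ∞ :=
    mul_lt_top ofReal_lt_top (add_lt_top.2 ⟨measure_ball_lt_top, H.hK.lt_top⟩)
  have hM3 : M * ENNReal.ofReal (r^2) < ∞ := mul_lt_top hM.lt_top ofReal_lt_top
  refine ⟨_, (add_lt_top.2 ⟨hM2, hM3⟩).ne, ?_⟩
  intro h t₁ a e hh ha ht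
  set Q := pcyl (x0, t0) r with hQ
  set α := t₁ + h with hα
  set β := t₁ + h + r^2 with hβ
  have hr2 : 0 < r^2 := by positivity
  have hαβ : α ≤ β := by linarith
  set W : ZT → ℝ := fun z => h⁻¹ * (v z e * (A0 z * lam (h⁻¹ * (t₁ - z.2)))) with hW
  have z2 : ∀ z : ZT, t₁ ≤ z.2 → A0 z * lam (h⁻¹ * (t₁ - z.2)) = 0 := fun z hz => by
    rw [lam_zero (mul_nonpos_of_nonneg_of_nonpos (by positivity) (by linarith))]; simp
  have W0 : ∀ z : ZT, t₁ ≤ z.2 → W z = 0 := fun z hz => by simp only [hW, z2 z hz]; simp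
  have hWe : ∀ (z : ZT) (x : ℝ), h⁻¹ * (v z e * ((A0 z * lam (h⁻¹ * (t₁ - z.2))) * x)) = W z * x := fun z x => by
    simp only [hW]; ring
  simp only [hWe]
  have f0 := tc_contDiff hc.sm lam_contDiff h t₁
  have g0 := hc.tsupp ht.2 (F := fun z => (A0 z * lam (h⁻¹ * (t₁ - z.2))))
    (fun z hz => by simp [hz]) (fun z hz => by simp only [z2 z hz])
  have iW : IntegrableOn W Q := (int_mul_cc (H.ivi e) f0.continuous g0.1).const_mul h⁻¹
  have mW : Measurable W := by
    have : Continuous (fun z : ZT => (A0 z * lam (h⁻¹ * (t₁ - z.2)))) := f0.continuous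
    have := this.measurable
    simp only [hW]; fun_prop
  have iG : ∀ T, t₁ < T → IntegrableOn (fun z => W z * gG a T z) Q := fun T hT => by
    have f3 : ContDiff ℝ (⊤ : ℕ∞) (fun z => (A0 z * lam (h⁻¹ * (t₁ - z.2))) * gG a T z) :=
      cut_contDiff f0 z2 hT (fun z hz => gG_contDiffAt a hz)
    have g3 := hc.tsupp ht.2 (F := fun z => (A0 z * lam (h⁻¹ * (t₁ - z.2))) * gG a T z)
      (fun z hz => by simp [hz]) (fun z hz => by simp only [z2 z hz]; simp)
    have := (int_mul_cc (H.ivi e) f3.continuous g3.1).const_mul h⁻¹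
    simp only [hWe] at this
    exact this
  set s := √h with hs
  have hs0 : 0 < s := Real.sqrt_pos.2 hh
  have hs2 : s^2 = h := Real.sq_sqrt hh.le
  have iP : Integrable (fun q : ℝ × ZT => W q.2 * gL a q.1 q.2)
      ((volume.restrict (Ioc α β)).prod (volume.restrict Q)) := by
    have i0 : Integrable (fun q : ℝ × ZT => W q.2 * (3 * K / s^5)) ((volume.restrict (Ioc α β)).prod (volume.restrict Q)) :=
      (Integrable.comp_snd iW (volume.restrict (Ioc α β))).mul_const _
    refine Integrable.mono i0 ((mW.comp measurable_snd).mul (gL_meas a)).aestronglyMeasurable ?_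
    rw [Measure.prod_restrict]
    filter_upwards [ae_restrict_mem (measurableSet_Ioc.prod (meas_pcyl _ _ _))] with q hq
    by_cases hz : q.2.2 < t₁
    · have hT : h ≤ q.1 - q.2.2 := by have := hq.1.1; linarith
      change ‖W q.2 * gL a q.1 q.2‖ ≤ ‖W q.2 * (3 * K / s^5)‖
      rw [norm_mul (W q.2), norm_mul (W q.2)]
      refine mul_le_mul_of_nonneg_left ?_ (norm_nonneg _)
      have hge : s ≤ gR a q.1 q.2 := gR_lower hs0.le (by rw [hs2]; exact hT)
      have h2 := (hg a q.1 q.2 (by linarith)).2.2.1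
      rw [Real.norm_of_nonneg (by positivity : 0 ≤ 3 * K / s^5), Real.norm_eq_abs]
      unfold gL
      calc |∑ k, gD2 a q.1 k k q.2| ≤ ∑ k, |gD2 a q.1 k k q.2| := Finset.abs_sum_le_sum_abs _ _
        _ ≤ ∑ k : Fin 3, K / s^5 := Finset.sum_le_sum fun k _ => (h2 k k).trans (by gcongr)
        _ = 3 * K / s^5 := by simp; ring
    · rw [W0 _ (not_lt.1 hz)]; simp
  have swap := integral_integral_swap (f := fun T z => W z * gL a T z) iP
  simp only [integral_const_mul] at swap
  have inner : ∀ z, W z * ∫ T in Ioc α β, gL a T z = W z * gG a β z - W z * gG a α z := fun z => by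
    by_cases hz : z.2 < t₁
    · rw [gL_ftc a hαβ (by linarith)]; ring
    · rw [W0 _ (not_lt.1 hz)]; simp
  simp only [inner] at swap
  rw [integral_sub (iG β (by linarith)) (iG α (by linarith))] at swap
  have main : ∫ z in Q, W z * gG a α z = (∫ z in Q, W z * gG a β z) - ∫ T in Ioc α β, ∫ z in Q, W z * gL a T z := by
    rw [swap]; ring
  rw [main]
  refine (enorm_sub_le).trans ?_
  rw [add_assoc]
  refine add_le_add ?_ ?_
  · refine (enorm_integral_le_lintegral_enorm _).trans ?_
    calc _ ≤ ∫⁻ z in Q, ENNReal.ofReal (L1 * (K / r^3)) *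
        (if z.2 ∈ Ioo (t₁ - h) t₁ then (ENNReal.ofReal h⁻¹ * (1 + ‖v z‖ₑ^2)) else 0) := by
          refine lintegral_mono fun z => ?_
          split_ifs with h1
          · have e0 : ‖v z‖ₑ ^ 2 = ENNReal.ofReal (‖v z‖ ^ 2) := by
              rw [ofReal_pow (norm_nonneg _), ofReal_norm]
            rw [e0, ← ofReal_one, ← ofReal_add (by norm_num) (by positivity),
              ← ofReal_mul (by positivity), ← ofReal_mul (by positivity), ← ofReal_norm]
            refine ofReal_le_ofReal ?_
            have hb := (hg a β z (by linarith [h1.2])).1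
            have hge : r ≤ gR a β z := gR_lower hr.le (by linarith [h1.2])
            have hb2 : |gG a β z| ≤ K / r^3 := hb.trans (by gcongr)
            have hv := abs_apply_le (v z) e
            have hv2 : |v z e| ≤ 1 + ‖v z‖^2 := by nlinarith [sq_nonneg (‖v z‖ - 1)]
            have hA : |A0 z| ≤ 1 := by rw [abs_of_nonneg (hc.nn z)]; exact hc.le z
            simp only [hW, Real.norm_eq_abs, abs_mul, abs_of_pos (inv_pos.2 hh)]
            calc h⁻¹ * (|v z e| * (|A0 z| * |lam (h⁻¹ * (t₁ - z.2))|)) * |gG a β z|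
                ≤ h⁻¹ * ((1 + ‖v z‖^2) * (1 * L1)) * (K / r^3) := by gcongr; exact hlam _
              _ = _ := by ring
          · simp only [hW, lam_supp hh h1]; simp
      _ = ENNReal.ofReal (L1 * (K / r^3)) * ∫⁻ z in Q,
        (if z.2 ∈ Ioo (t₁ - h) t₁ then (ENNReal.ofReal h⁻¹ * (1 + ‖v z‖ₑ^2)) else 0) :=
          lintegral_const_mul' _ _ ofReal_ne_top
      _ ≤ _ := by gcongr; exact H.slab hh t₁
  · refine (enorm_integral_le_lintegral_enorm _).trans ?_
    calc _ ≤ ∫⁻ T in Ioc α β, (M + ∫⁻ z in Q, (if z.2 < t₁ then ENNReal.ofReal (36 * K) * (‖v z‖ₑ ^ 2 *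
         ENNReal.ofReal (1 / gR a T z ^ 6)) else 0)) := by
          refine lintegral_mono_ae ?_
          filter_upwards [ae_restrict_mem measurableSet_Ioc] with T hT
          have := hkey h t₁ T a e hh ha ht (by linarith [hT.1])
          simpa only [hWe] using this
      _ = M * ENNReal.ofReal (r^2) + ∫⁻ T in Ioc α β, ∫⁻ z in Q, (if z.2 < t₁ then ENNReal.ofReal (36 * K) * (‖v z‖ₑ ^ 2 *
         ENNReal.ofReal (1 / gR a T z ^ 6)) else 0) := by
          rw [lintegral_add_left measurable_const]
          simp only [lintegral_const, Measure.restrict_apply_univ, Real.volume_Ioc]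
          congr 3; simp only [hα, hβ]; ring
      _ = M * ENNReal.ofReal (r^2) + ∫⁻ z in Q, ∫⁻ T in Ioc α β, (if z.2 < t₁ then ENNReal.ofReal (36 * K) * (‖v z‖ₑ ^ 2 *
         ENNReal.ofReal (1 / gR a T z ^ 6)) else 0) := by
          rw [lintegral_lintegral_swap]
          refine Measurable.aemeasurable ?_
          refine Measurable.ite (measurableSet_lt (by fun_prop) measurable_const) ?_ measurable_const
          have := gR_meas a
          have h3 : Measurable (fun q : ℝ × ZT => ENNReal.ofReal (1 / gR a q.1 q.2 ^ 6)) := by fun_prop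
          exact measurable_const.mul (Measurable.mul (by fun_prop) h3)
      _ ≤ _ := by
          gcongr
          rw [← lintegral_const_mul' _ _ ofReal_ne_top]
          refine lintegral_mono fun z => ?_
          by_cases hz : z.2 < t₁
          · simp only [hz, if_true]
            rw [lintegral_const_mul' _ _ ofReal_ne_top, lintegral_const_mul' _ _ (by simp)]
            rw [mul_comm (pk 4 (a, t₁) z)]
            gcongr
            exact gR6_int hαβ (by linarith) hz
          · simp [hz]
end
section
section moll
variable {V : Type*} [NormedAddCommGroup V] [NormedSpace ℝ V] [FiniteDimensional ℝ V] [MeasurableSpace V] [BorelSpace V]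
  {μ : Measure V} [μ.IsAddHaarMeasure]
lemma trans_cont {p : ℝ≥0∞} (h1 : 1 ≤ p) (hp : p ≠ ∞) {u : V → ℝ} (hu : MemLp u p μ) :
    Tendsto (fun y => eLpNorm (fun x => u (x - y) - u x) p μ) (nhds 0) (nhds 0) := by
  haveI : Fact (1 ≤ p) := ⟨h1⟩
  haveI : Fact (p ≠ ∞) := ⟨hp⟩
  have hc : Continuous (fun y : V => (DomAddAct.mk (-y)) +ᵥ hu.toLp u) := by
    have : Continuous (fun y : V => (DomAddAct.mk (-y), hu.toLp u)) := by
      refine Continuous.prodMk ?_ continuous_const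
      exact (DomAddAct.mkHomeomorph.continuous).comp continuous_neg
    exact continuous_vadd.comp this
  have h2 := (hc.tendsto 0).edist (tendsto_const_nhds (x := hu.toLp u))
  simp only [neg_zero, DomAddAct.mk_zero, zero_vadd, edist_self] at h2
  refine h2.congr fun y => ?_
  rw [DomAddAct.mk_vadd_toLp, Lp.edist_toLp_toLp]
  congr 1
  ext x
  simp only [Pi.sub_apply, vadd_eq_add]
  rw [neg_add_eq_sub]
lemma jensen_pm {W : Type*} [MeasurableSpace W] {ν : Measure W} [IsProbabilityMeasure ν] {p : ℝ} (hp : 1 ≤ p)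
    {f : W → ℝ≥0∞} (hf : AEMeasurable f ν) : (∫⁻ w, f w ∂ν) ^ p ≤ ∫⁻ w, f w ^ p ∂ν := by
  rcases eq_or_lt_of_le hp with rfl | h1
  · simp
  have hq := Real.HolderConjugate.conjExponent h1
  have := lintegral_mul_le_Lp_mul_Lq ν hq hf (aemeasurable_const (b := (1:ℝ≥0∞)))
  simp only [Pi.mul_apply, mul_one, one_rpow, lintegral_const, measure_univ] at this
  calc (∫⁻ w, f w ∂ν) ^ p ≤ ((∫⁻ w, f w ^ p ∂ν) ^ (1/p)) ^ p := by gcongr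
    _ = _ := by rw [← rpow_mul, one_div_mul_cancel (by linarith), rpow_one]
lemma moll_step {p : ℝ} (hp : 1 ≤ p) {u : V → ℝ} (hu : Measurable u) {ν : Measure V} [IsProbabilityMeasure ν] :
    ∫⁻ x, (∫⁻ w, ‖u (x - w) - u x‖ₑ ∂ν) ^ p ∂μ ≤ ∫⁻ w, (eLpNorm (fun x => u (x - w) - u x) (ENNReal.ofReal p) μ) ^ p ∂ν := by
  have hm : Measurable (fun q : V × V => ‖u (q.1 - q.2) - u q.1‖ₑ ^ p) := by fun_prop
  calc _ ≤ ∫⁻ x, ∫⁻ w, ‖u (x - w) - u x‖ₑ ^ p ∂ν ∂μ := by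
        refine lintegral_mono fun x => jensen_pm hp ?_
        fun_prop
    _ = ∫⁻ w, ∫⁻ x, ‖u (x - w) - u x‖ₑ ^ p ∂μ ∂ν := lintegral_lintegral_swap hm.aemeasurable
    _ = _ := by
        refine lintegral_congr fun w => ?_
        rw [eLpNorm_eq_lintegral_rpow_enorm_toReal (by simp; linarith) (by simp), toReal_ofReal (by linarith),
          ← rpow_mul, one_div_mul_cancel (by linarith), rpow_one]
lemma moll_ball {p : ℝ} (hp : 1 ≤ p) {u : V → ℝ} (hm : Measurable u) (hu : MemLp u (ENNReal.ofReal p) μ)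
    {ν : ℕ → Measure V} [∀ n, IsProbabilityMeasure (ν n)] {κ : ℕ → ℝ} (hκ : Tendsto κ atTop (nhds 0))
    (hν : ∀ n, ∀ᵐ w ∂(ν n), ‖w‖ ≤ κ n) :
    Tendsto (fun n => ∫⁻ x, (∫⁻ w, ‖u (x - w) - u x‖ₑ ∂(ν n)) ^ p ∂μ) atTop (nhds 0) := by
  have h0 := trans_cont (by simpa using hp) (by simp) hu
  have h1 : Tendsto (fun y => eLpNorm (fun x => u (x - y) - u x) (ENNReal.ofReal p) μ ^ p) (nhds 0) (nhds 0) := by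
    have := (continuous_rpow_const (y := p)).tendsto 0 |>.comp h0
    rwa [zero_rpow_of_pos (by linarith)] at this
  rw [ENNReal.tendsto_nhds_zero]
  intro ε hε
  have h2 := (ENNReal.tendsto_nhds_zero.1 h1) ε hε
  rw [Metric.eventually_nhds_iff] at h2
  obtain ⟨d, hd, h3⟩ := h2
  filter_upwards [hκ.eventually (gt_mem_nhds hd)] with n hn
  refine (moll_step hp hm).trans ?_
  calc _ ≤ ∫⁻ w, ε ∂(ν n) := by
        refine lintegral_mono_ae ?_
        filter_upwards [hν n] with w hw
        exact h3 (by rw [dist_zero_right]; linarith)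
    _ = ε := by simp
lemma moll_dil {u : V → ℝ} (hm : Measurable u) (hu : Integrable u μ)
    {ν : Measure V} [IsProbabilityMeasure ν] {δ : ℕ → V → V} (mδ : ∀ n, Measurable (δ n))
    (hδ : ∀ w, Tendsto (fun n => δ n w) atTop (nhds 0)) :
    Tendsto (fun n => ∫⁻ x, (∫⁻ w, ‖u (x - δ n w) - u x‖ₑ ∂ν) ∂μ) atTop (nhds 0) := by
  have hm2 : Measurable (fun q : V × V => ‖u (q.1 - q.2) - u q.1‖ₑ) := by fun_prop
  have hom : Measurable (fun y => ∫⁻ x, ‖u (x - y) - u x‖ₑ ∂μ) := hm2.lintegral_prod_left'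
  have e1 : ∀ n, ∫⁻ x, (∫⁻ w, ‖u (x - δ n w) - u x‖ₑ ∂ν) ∂μ = ∫⁻ w, (∫⁻ x, ‖u (x - δ n w) - u x‖ₑ ∂μ) ∂ν := fun n => by
    have := mδ n
    exact lintegral_lintegral_swap (by fun_prop)
  simp_rw [e1]
  have h0 := trans_cont le_rfl (by simp) (memLp_one_iff_integrable.2 hu)
  simp only [eLpNorm_one_eq_lintegral_enorm] at h0
  have := tendsto_lintegral_of_dominated_convergence (μ := ν) (F := fun n w => ∫⁻ x, ‖u (x - δ n w) - u x‖ₑ ∂μ) (f := fun _ => 0)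
    (fun _ => 2 * ∫⁻ x, ‖u x‖ₑ ∂μ) (fun n => hom.comp (mδ n)) (fun n => ae_of_all _ fun w => ?_) ?_
    (ae_of_all _ fun w => h0.comp (hδ w))
  · simpa using this
  · calc _ ≤ ∫⁻ x, (‖u (x - δ n w)‖ₑ + ‖u x‖ₑ) ∂μ := lintegral_mono fun x => enorm_sub_le
      _ = ∫⁻ x, ‖u (x - δ n w)‖ₑ ∂μ + ∫⁻ x, ‖u x‖ₑ ∂μ := lintegral_add_right _ (by fun_prop)
      _ = _ := by rw [lintegral_sub_right_eq_self (fun x => ‖u x‖ₑ), two_mul]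
  · simp only [lintegral_const, measure_univ, mul_one]
    exact (mul_lt_top (by simp) hu.2).ne
end moll
end
section
instance : (volume : Measure ZT).IsAddHaarMeasure := by
  rw [Measure.volume_eq_prod]; infer_instance
lemma scale_int {h : ℝ} (hh : 0 < h) (F : ZT → ℝ) :
    ∫ w, F w = (√h ^ 3 * h) * ∫ w : ZT, F (√h • w.1, h * w.2) := by
  have hs : 0 < √h := Real.sqrt_pos.2 hh
  let f : ZT →ₗ[ℝ] ZT := LinearMap.prodMap (√h • LinearMap.id) (h • LinearMap.id)
  have hdet : LinearMap.det f = √h ^ 3 * h := by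
    rw [LinearMap.det_prodMap, LinearMap.det_smul, LinearMap.det_smul]; simp
  have hpos : 0 < √h ^ 3 * h := by positivity
  have hmap := Measure.map_linearMap_addHaar_eq_smul_addHaar (volume : Measure ZT) (f := f) (by rw [hdet]; exact hpos.ne')
  have hf : MeasurableEmbedding f := by
    let e := LinearEquiv.ofIsUnitDet (f := f) (v := Module.finBasis ℝ ZT) (v' := Module.finBasis ℝ ZT) (by
      rw [LinearMap.det_toMatrix, hdet]; exact hpos.ne'.isUnit)
    exact e.toContinuousLinearEquiv.toHomeomorph.measurableEmbedding
  have h1 := hf.integral_map (μ := volume) F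
  rw [hmap, integral_smul_measure, hdet, abs_of_pos (inv_pos.2 hpos), toReal_ofReal (inv_pos.2 hpos).le] at h1
  have h2 : ∫ w : ZT, F (√h • w.1, h * w.2) = ∫ w, F (f w) := rfl
  rw [h2, ← h1, smul_eq_mul, mul_inv_cancel_left₀ hpos.ne']
lemma lam_nn (s : ℝ) : 0 ≤ lam s := Real.smoothTransition.monotone.deriv_nonneg
def k1 (w : ZT) : ℝ := lam w.2 * gG 0 1 (-w)
lemma gG_pos {a : E3} {T : ℝ} {z : ZT} (h : z.2 < T) : 0 < gG a T z := by
  unfold gG; exact mul_pos (Real.rpow_pos_of_pos (by linarith) _) (Real.exp_pos _)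
lemma k1_nn (w : ZT) : 0 ≤ k1 w := by
  unfold k1
  by_cases h : 0 < w.2
  · exact mul_nonneg (lam_nn _) (gG_pos (by simp; linarith)).le
  · rw [lam_zero (not_lt.1 h)]; simp
lemma k1_meas : Measurable k1 := by
  have h := gG_meas 0
  have : Continuous lam := lam_contDiff.continuous
  have h2 : Measurable (fun w : ZT => gG 0 1 (-w)) := h.comp (by fun_prop : Measurable fun w : ZT => ((1:ℝ), -w))
  exact (this.measurable.comp measurable_snd).mul h2
lemma k1_int : Integrable k1 := by
  obtain ⟨L1, hL1, hlam⟩ := lam_bdd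
  have i1 : Integrable (fun x : E3 => Real.exp (-(1/8) * ‖x‖^2)) := by
    have := GaussianFourier.integrable_cexp_neg_mul_sq_norm_add (V := E3) (b := 1/8) (by norm_num) 0 0
    refine (this.norm).congr (ae_of_all _ fun x => ?_)
    simp only [Complex.norm_exp]
    congr 1
    simp [← Complex.ofReal_pow]
  have i2 : Integrable lam := lam_contDiff.continuous.integrable_of_hasCompactSupport lam_compact
  refine (i1.mul_prod i2).mono k1_meas.aestronglyMeasurable (ae_of_all _ fun w => ?_)
  rw [Real.norm_of_nonneg (k1_nn w), Real.norm_of_nonneg (mul_nonneg (Real.exp_pos _).le (lam_nn _)), mul_comm]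
  unfold k1
  by_cases h : 0 < w.2 ∧ w.2 < 1
  · refine mul_le_mul_of_nonneg_left ?_ (lam_nn _)
    unfold gG
    have e1 : gq 0 (-w) = ‖w.1‖^2 := by
      unfold gq gX; rw [EuclideanSpace.norm_sq_eq, Fin.sum_univ_three]; simp; ring
    have e2 : (1:ℝ) - (-w).2 = 1 + w.2 := by simp
    have h3 : ((1:ℝ) - (-w).2) ^ (-(3/2) : ℝ) ≤ 1 :=
      Real.rpow_le_one_of_one_le_of_nonpos (by rw [e2]; linarith) (by norm_num)
    have h4 : (1/8 : ℝ) ≤ 1/2 * gc 1 (-w) := by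
      unfold gc; rw [e2, ← one_div, div_mul_div_comm, div_le_div_iff₀ (by norm_num) (by linarith)]; linarith
    calc _ ≤ 1 * Real.exp (-(1/8) * ‖w.1‖^2) := by
          refine mul_le_mul h3 (Real.exp_le_exp.2 ?_) (Real.exp_pos _).le zero_le_one
          rw [e1]; nlinarith [sq_nonneg ‖w.1‖]
      _ = _ := one_mul _
  · have : lam w.2 = 0 := by
      rw [not_and_or, not_lt, not_lt] at h
      rcases h with h | h
      · exact lam_zero h
      · exact lam_zero' h
    rw [this]; simp
def c0 : ℝ≥0∞ := ∫⁻ w, ENNReal.ofReal (k1 w)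
lemma c0_top : c0 ≠ ∞ := (k1_int.lintegral_lt_top).ne
lemma c0_ne : c0 ≠ 0 := by
  refine (pos_iff_ne_zero.1 ?_)
  unfold c0
  rw [lintegral_pos_iff_support (k1_meas.ennreal_ofReal)]
  have hlc : Continuous lam := lam_contDiff.continuous
  have ho : IsOpen {w : ZT | 0 < lam w.2} := isOpen_lt continuous_const (hlc.comp continuous_snd)
  have hne : {w : ZT | 0 < lam w.2}.Nonempty := by
    by_contra hcon
    have h0 : ∀ s, lam s = 0 := fun s => by
      by_contra hs
      exact hcon ⟨(0, s), lt_of_le_of_ne (lam_nn s) (Ne.symm hs)⟩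
    have := is_const_of_deriv_eq_zero (f := stp) (fun s => (stp_hasDeriv s).differentiableAt) h0 0 1
    rw [stp_zero le_rfl, stp_one le_rfl] at this
    norm_num at this
  refine (ho.measure_pos volume hne).trans_le (measure_mono ?_)
  intro w hw
  simp only [Function.mem_support, ne_eq, ofReal_eq_zero, not_le]
  have h2 : 0 < w.2 := by
    by_contra h; rw [mem_ofPred_eq, lam_zero (not_lt.1 h)] at hw; exact lt_irrefl _ hw
  exact mul_pos hw (gG_pos (by simp; linarith))
def nu1 : Measure ZT := volume.withDensity (fun w => c0⁻¹ * ENNReal.ofReal (k1 w))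
instance : IsProbabilityMeasure nu1 := ⟨by
  unfold nu1
  rw [withDensity_apply _ MeasurableSet.univ, Measure.restrict_univ, lintegral_const_mul _ k1_meas.ennreal_ofReal]
  exact ENNReal.inv_mul_cancel c0_ne c0_top⟩
lemma nu1_int (f : ZT → ℝ) : ∫ w, f w * k1 w = c0.toReal * ∫ w, f w ∂nu1 := by
  unfold nu1
  have hm : Measurable (fun w => c0⁻¹ * ENNReal.ofReal (k1 w)) := measurable_const.mul k1_meas.ennreal_ofReal
  rw [integral_withDensity_eq_integral_toReal_smul hm
    (ae_of_all _ fun w => mul_lt_top (inv_lt_top.2 (pos_iff_ne_zero.2 c0_ne)) ofReal_lt_top), ← integral_const_mul]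
  refine integral_congr_ae (ae_of_all _ fun w => ?_)
  have : c0.toReal ≠ 0 := toReal_ne_zero.2 ⟨c0_ne, c0_top⟩
  simp only [toReal_mul, toReal_inv, toReal_ofReal (k1_nn w), smul_eq_mul]
  field_simp
end
section
lemma enorm_le_sum (y : E3) : ‖y‖ₑ ≤ ∑ e, ‖y e‖ₑ := by
  have h2 : ‖y‖ ≤ ∑ e, |y e| := by
    have h3 := EuclideanSpace.norm_sq_eq y
    simp only [Fin.sum_univ_three, Real.norm_eq_abs] at h3 ⊢
    have a0 := abs_nonneg (y 0)
    have a1 := abs_nonneg (y 1)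
    have a2 := abs_nonneg (y 2)
    refine (le_abs_self _).trans (abs_le_of_sq_le_sq ?_ (by positivity))
    nlinarith [mul_nonneg a0 a1, mul_nonneg a0 a2, mul_nonneg a1 a2]
  rw [← ofReal_norm]
  refine (ofReal_le_ofReal h2).trans ?_
  rw [ofReal_sum_of_nonneg fun _ _ => abs_nonneg _]
  exact Finset.sum_le_sum fun e _ => by rw [← Real.norm_eq_abs, ofReal_norm]
lemma gG_trans (a : E3) (t h : ℝ) (z : ZT) : gG a (t + h) z = gG 0 h (z - (a, t)) := by
  unfold gG gc gq gX; simp only [Prod.snd_sub, Prod.fst_sub, PiLp.sub_apply, PiLp.zero_apply, sub_zero]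
  rw [show t + h - z.2 = h - (z.2 - t) by ring]
lemma gG_scale {h : ℝ} (hh : 0 < h) {w : ZT} (hw : 0 < w.2) :
    gG 0 h (-((√h • w.1, h * w.2) : ZT)) = (√h ^ 3)⁻¹ * gG 0 1 (-w) := by
  unfold gG gc gq gX
  have e : √h * √h = h := Real.mul_self_sqrt hh.le
  have e1 : h - (-((√h • w.1, h * w.2) : ZT)).2 = h * (1 + w.2) := by simp; ring
  have e2 : 1 - (-w).2 = 1 + w.2 := by simp
  rw [e1, e2, Real.mul_rpow hh.le (by linarith), mul_assoc]
  have e3 : h ^ (-(3/2) : ℝ) = (√h ^ 3)⁻¹ := by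
    rw [Real.rpow_neg hh.le, Real.sqrt_eq_rpow, ← Real.rpow_natCast, ← Real.rpow_mul hh.le]; norm_num
  rw [e3]
  congr 3
  simp only [Prod.fst_neg, PiLp.neg_apply, PiLp.smul_apply, PiLp.zero_apply, smul_eq_mul, sub_zero]
  have : (1 + w.2) ≠ 0 := by linarith
  field_simp
  rw [show √h ^ 2 = h from Real.sq_sqrt hh.le]
def dil (h : ℝ) (w : ZT) : ZT := (√h • w.1, h * w.2)
lemma vh_eq {u : ZT → ℝ} {h : ℝ} (hh : 0 < h) (ζ : ZT) :
    ∫ z, h⁻¹ * (u z * (lam (h⁻¹ * (ζ.2 - z.2)) * gG ζ.1 (ζ.2 + h) z)) = c0.toReal * ∫ w, u (ζ - dil h w) ∂nu1 := by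
  rw [← nu1_int, ← integral_sub_left_eq_self _ _ ζ, scale_int hh, ← integral_const_mul]
  refine integral_congr_ae (ae_of_all _ fun w => ?_)
  have hs : 0 < √h := Real.sqrt_pos.2 hh
  simp only [gG_trans]
  have e1 : ζ - (√h • w.1, h * w.2) - (ζ.1, ζ.2) = -((√h • w.1, h * w.2) : ZT) := by
    rw [Prod.mk.eta]; abel
  have e2 : h⁻¹ * (ζ.2 - (ζ - (√h • w.1, h * w.2)).2) = w.2 := by
    simp; rw [inv_mul_cancel_left₀ hh.ne']
  rw [e1, e2]
  unfold k1 dil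
  by_cases hw : 0 < w.2
  · rw [gG_scale hh hw]; field_simp
  · rw [lam_zero (not_lt.1 hw)]; simp
lemma rep : ∃ C : ℝ≥0∞, C ≠ ∞ ∧ ∀ (v : ZT → E3) (p : ZT → ℝ) (x0 : E3) (t0 r : ℝ) (K2 : ℝ≥0∞), CH v p x0 t0 r K2 → 0 < r →
    ∃ M : ℝ≥0∞, M ≠ ∞ ∧ ∀ᵐ z : ZT, z ∈ Metric.ball x0 (r/4) ×ˢ Ioo (t0 - r^2/4) t0 →
      ‖v z‖ₑ ≤ M + C * ∫⁻ w in pcyl (x0, t0) r, pk 4 z w * ‖v w‖ₑ ^ 2 := by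
  obtain ⟨K, hK, hg⟩ := gauss_bounds
  refine ⟨3 * (c0⁻¹ * ENNReal.ofReal (36 * K)), ?_, ?_⟩
  · exact mul_ne_top (by simp) (mul_ne_top (inv_ne_top.2 c0_ne) ofReal_ne_top)
  intro v p x0 t0 r K2 H hr
  obtain ⟨A0, L, hc⟩ := cut_exists x0 t0 hr
  obtain ⟨M, hM, key⟩ := H.key2 hr hc hK hg
  refine ⟨3 * (c0⁻¹ * M), mul_ne_top (by simp) (mul_ne_top (inv_ne_top.2 c0_ne) hM), ?_⟩
  set Q := pcyl (x0, t0) r with hQ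
  have comp : ∀ e : Fin 3, ∀ᵐ z : ZT, z ∈ Metric.ball x0 (r/4) ×ˢ Ioo (t0 - r^2/4) t0 →
      c0 * ‖v z e‖ₑ ≤ M + ENNReal.ofReal (36 * K) * ∫⁻ w in Q, pk 4 z w * ‖v w‖ₑ ^ 2 := by
    intro e
    set u : ZT → ℝ := Q.indicator (fun z => v z e * A0 z) with hu
    have mQ : MeasurableSet Q := meas_pcyl _ _ _
    have mv := H.mv
    have mA := hc.sm.continuous.measurable
    have mu : Measurable u := Measurable.indicator (by fun_prop) mQ
    have iu : Integrable u := (integrable_indicator_iff mQ).2 (int_mul_cc (H.ivi e) hc.sm.continuous hc.cs)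
    set hn : ℕ → ℝ := fun n => 1 / ((n:ℝ) + 1) with hhn
    have hn0 : ∀ n, 0 < hn n := fun n => by simp only [hhn]; positivity
    have hnt : Tendsto hn atTop (nhds 0) := tendsto_one_div_add_atTop_nhds_zero_nat
    have mdil : ∀ n, Measurable (dil (hn n)) := fun n => by unfold dil; fun_prop
    have T := moll_dil (μ := volume) mu iu (ν := nu1) (δ := fun n => dil (hn n)) mdil (fun w => by
      unfold dil
      have h1 : Tendsto (fun n => √(hn n) • w.1) atTop (nhds 0) := by
        have := ((Real.continuous_sqrt.tendsto 0).comp hnt).smul_const w.1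
        simpa using this
      have h2 : Tendsto (fun n => hn n * w.2) atTop (nhds 0) := by simpa using hnt.mul_const w.2
      exact h1.prodMk_nhds h2)
    set R : ℕ → ZT → ℝ≥0∞ := fun n x => ∫⁻ w, ‖u (x - dil (hn n) w) - u x‖ₑ ∂nu1 with hR
    have mR : ∀ n, Measurable (R n) := fun n => by
      have := mdil n
      exact Measurable.lintegral_prod_right' (f := fun q : ZT × ZT => ‖u (q.1 - dil (hn n) q.2) - u q.1‖ₑ) (by fun_prop)
    have F := lintegral_liminf_le (u := atTop) (μ := (volume : Measure ZT)) mR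
    rw [T.liminf_eq, nonpos_iff_eq_zero, lintegral_eq_zero_iff (Measurable.liminf mR)] at F
    filter_upwards [F] with z hz hzm
    have hzQ : z ∈ Q := ⟨Metric.ball_subset_ball (by linarith) hzm.1, by have := hzm.2.1; constructor <;> nlinarith [hzm.2.2, sq_pos_of_pos hr]⟩
    have hA : A0 z = 1 := (hc.flat z ⟨Metric.ball_subset_ball (by linarith) hzm.1, by
      have := hzm.2.1; constructor <;> nlinarith [hzm.2.2, sq_pos_of_pos hr]⟩).1
    have huz : u z = v z e := by simp [hu, indicator_of_mem hzQ, hA]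
    refine ENNReal.le_of_forall_pos_le_add fun ε hε _ => ?_
    have hε' : (0:ℝ≥0∞) < c0⁻¹ * ε := ENNReal.mul_pos (ENNReal.inv_ne_zero.2 c0_top) (by exact_mod_cast hε.ne')
    have hlim : liminf (fun n => R n z) atTop < min (c0⁻¹ * ε) 1 := by
      rw [hz]; exact lt_min hε' (by simp)
    obtain ⟨n, hn1⟩ := (frequently_lt_of_liminf_lt (by isBoundedDefault) hlim).exists
    have hn2 := lt_min_iff.1 hn1
    have md := mdil n
    have i1 : Integrable (fun w => u (z - dil (hn n) w) - u z) nu1 :=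
      ⟨Measurable.aestronglyMeasurable (by fun_prop), hn2.2.trans (by simp)⟩
    have i2 : Integrable (fun w => u (z - dil (hn n) w)) nu1 := by
      have := i1.add (integrable_const (u z))
      refine this.congr (ae_of_all _ fun w => by simp)
    have hv := vh_eq (u := u) (hn0 n) z
    have hk := key (hn n) z.2 z.1 e (hn0 n) hzm.1 hzm.2
    have e1 : ∫ y in Q, (hn n)⁻¹ * (v y e * ((A0 y * lam ((hn n)⁻¹ * (z.2 - y.2))) * gG z.1 (z.2 + hn n) y))
        = ∫ y, (hn n)⁻¹ * (u y * (lam ((hn n)⁻¹ * (z.2 - y.2)) * gG z.1 (z.2 + hn n) y)) := by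
      rw [← integral_indicator mQ]
      refine integral_congr_ae (ae_of_all _ fun y => ?_)
      by_cases hy : y ∈ Q
      · simp only [hu, indicator_of_mem hy]; ring
      · simp only [hu, indicator_of_notMem hy]; ring
    rw [e1, hv] at hk
    have e2 : v z e = (∫ w, u (z - dil (hn n) w) ∂nu1) - ∫ w, (u (z - dil (hn n) w) - u z) ∂nu1 := by
      rw [integral_sub i2 (integrable_const _)]; simp [huz]
    have ec : ‖c0.toReal‖ₑ = c0 := by
      rw [Real.enorm_of_nonneg toReal_nonneg, ofReal_toReal c0_top]
    rw [enorm_mul, ec] at hk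
    calc c0 * ‖v z e‖ₑ ≤ c0 * (‖∫ w, u (z - dil (hn n) w) ∂nu1‖ₑ + R n z) := by
          gcongr
          rw [e2]
          exact enorm_sub_le.trans (add_le_add le_rfl (enorm_integral_le_lintegral_enorm _))
      _ ≤ c0 * ‖∫ w, u (z - dil (hn n) w) ∂nu1‖ₑ + c0 * (c0⁻¹ * ε) := by
          rw [mul_add]; gcongr; exact hn2.1.le
      _ ≤ _ := by
          refine add_le_add hk ?_
          rw [← mul_assoc, ENNReal.mul_inv_cancel c0_ne c0_top, one_mul]
  filter_upwards [ae_all_iff.2 comp] with z hz hzm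
  have h1 := enorm_le_sum (v z)
  refine h1.trans ?_
  set I := ∫⁻ w in Q, pk 4 z w * ‖v w‖ₑ ^ 2
  have h3 : ∀ e, ‖v z e‖ₑ ≤ c0⁻¹ * (M + ENNReal.ofReal (36 * K) * I) := fun e => by
    have := hz e hzm
    calc ‖v z e‖ₑ = c0⁻¹ * (c0 * ‖v z e‖ₑ) := by rw [← mul_assoc, ENNReal.inv_mul_cancel c0_ne c0_top, one_mul]
      _ ≤ _ := by gcongr
  calc ∑ e, ‖v z e‖ₑ ≤ ∑ e : Fin 3, c0⁻¹ * (M + ENNReal.ofReal (36 * K) * I) := Finset.sum_le_sum fun e _ => h3 e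
    _ = _ := by simp; ring
end
section
def WG (u : E3 → ℝ) (g : Fin 3 → E3 → ℝ) (B : Set E3) : Prop :=
  ∀ ψ : E3 → ℝ, ContDiff ℝ (⊤ : ℕ∞) ψ → HasCompactSupport ψ → tsupport ψ ⊆ B → ∀ i,
    ∫ x in B, u x * fderiv ℝ ψ x (EuclideanSpace.single i 1) = - ∫ x in B, g i x * ψ x
lemma dense_test (x0 : E3) (r : ℝ) : ∃ P : ℕ → E3 → ℝ, (∀ n, ContDiff ℝ (⊤ : ℕ∞) (P n) ∧ HasCompactSupport (P n) ∧
    tsupport (P n) ⊆ Metric.ball x0 r) ∧ ∀ ψ : E3 → ℝ, ContDiff ℝ (⊤ : ℕ∞) ψ → HasCompactSupport ψ → tsupport ψ ⊆ Metric.ball x0 r →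
    ∀ ε > 0, ∃ n, ∀ x ∈ Metric.ball x0 r, |ψ x - P n x| ≤ ε ∧ ‖fderiv ℝ ψ x - fderiv ℝ (P n) x‖ ≤ ε := by
  set K := Metric.closedBall x0 r
  haveI : CompactSpace K := isCompact_iff_compactSpace.1 (isCompact_closedBall x0 r)
  let Tst := {ψ : E3 → ℝ // ContDiff ℝ (⊤ : ℕ∞) ψ ∧ HasCompactSupport ψ ∧ tsupport ψ ⊆ Metric.ball x0 r}
  let J : Tst → C(K, ℝ × (E3 →L[ℝ] ℝ)) := fun ψ => ⟨fun x => (ψ.1 x, fderiv ℝ ψ.1 x), by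
    have h1 := ψ.2.1.continuous
    have h2 : Continuous (fderiv ℝ ψ.1) := ψ.2.1.continuous_fderiv (by simp)
    fun_prop⟩
  have hsep : TopologicalSpace.IsSeparable (range J) := TopologicalSpace.IsSeparable.of_separableSpace _
  obtain ⟨c, hcs, hcc, hcd⟩ := hsep.exists_countable_dense_subset
  have hne : (range J).Nonempty := ⟨J ⟨fun _ => 0, contDiff_const, HasCompactSupport.zero, by simp [tsupport]⟩, mem_range_self _⟩
  have hcne : c.Nonempty := by
    by_contra h
    rw [not_nonempty_iff_eq_empty] at h
    obtain ⟨y, hy⟩ := hne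
    have := hcd hy
    simp [h] at this
  obtain ⟨f, hf⟩ := hcc.exists_eq_range hcne
  have hfr : ∀ n, f n ∈ range J := fun n => hcs (hf ▸ mem_range_self n)
  choose P hP using hfr
  refine ⟨fun n => (P n).1, fun n => (P n).2, fun ψ h1 h2 h3 ε hε => ?_⟩
  have := hcd (mem_range_self (⟨ψ, h1, h2, h3⟩ : Tst))
  obtain ⟨b, hb, hd⟩ := (Metric.mem_closure_iff (α := C(K, ℝ × (E3 →L[ℝ] ℝ)))).1 this ε hε
  rw [hf] at hb
  obtain ⟨n, rfl⟩ := hb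
  refine ⟨n, fun x hx => ?_⟩
  rw [← hP n] at hd
  have h4 := (ContinuousMap.dist_apply_le_dist (f := J ⟨ψ, h1, h2, h3⟩) (g := J (P n)) (⟨x, Metric.ball_subset_closedBall hx⟩ : K)).trans hd.le
  rw [Prod.dist_eq] at h4
  have h5 := max_le_iff.1 h4
  refine ⟨?_, ?_⟩
  · have := h5.1; rwa [Real.dist_eq] at this
  · have := h5.2; rwa [dist_eq_norm] at this
lemma WG_of_dense {u : E3 → ℝ} {g : Fin 3 → E3 → ℝ} {x0 : E3} {r : ℝ} {P : ℕ → E3 → ℝ}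
    (hP : (∀ n, ContDiff ℝ (⊤ : ℕ∞) (P n) ∧ HasCompactSupport (P n) ∧
    tsupport (P n) ⊆ Metric.ball x0 r) ∧ ∀ ψ : E3 → ℝ, ContDiff ℝ (⊤ : ℕ∞) ψ → HasCompactSupport ψ → tsupport ψ ⊆ Metric.ball x0 r →
    ∀ ε > 0, ∃ n, ∀ x ∈ Metric.ball x0 r, |ψ x - P n x| ≤ ε ∧ ‖fderiv ℝ ψ x - fderiv ℝ (P n) x‖ ≤ ε)
    (hu : IntegrableOn u (Metric.ball x0 r)) (hg : ∀ i, IntegrableOn (g i) (Metric.ball x0 r))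
    (h : ∀ n i, ∫ x in Metric.ball x0 r, u x * fderiv ℝ (P n) x (EuclideanSpace.single i 1) = - ∫ x in Metric.ball x0 r, g i x * (P n) x) :
    WG u g (Metric.ball x0 r) := by
  intro ψ h1 h2 h3 i
  set B := Metric.ball x0 r
  have ic : ∀ f : E3 → ℝ, IntegrableOn f B → ∀ F : E3 → ℝ, Continuous F → HasCompactSupport F → IntegrableOn (fun x => f x * F x) B := by
    intro f hf F hF hFc
    obtain ⟨C, hC⟩ := hFc.exists_bound_of_continuous hF
    exact Integrable.mul_bdd (c := C) hf hF.aestronglyMeasurable (ae_of_all _ hC)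
  have cd : ∀ f : E3 → ℝ, ContDiff ℝ (⊤ : ℕ∞) f → Continuous (fun x => fderiv ℝ f x (EuclideanSpace.single i 1)) := fun f hf =>
    (hf.continuous_fderiv (by simp)).clm_apply continuous_const
  have key : ∀ ε > 0, |(∫ x in B, u x * fderiv ℝ ψ x (EuclideanSpace.single i 1)) + ∫ x in B, g i x * ψ x|
     ≤ ε * ((∫ x in B, |u x|) + ∫ x in B, |g i x|) := by
    intro ε hε
    obtain ⟨n, hn⟩ := hP.2 ψ h1 h2 h3 ε hε
    obtain ⟨p1, p2, p3⟩ := hP.1 n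
    have e1 := h n i
    have i1 := ic u hu _ (cd ψ h1) (h2.fderiv_apply ℝ _)
    have i2 := ic u hu _ (cd _ p1) (p2.fderiv_apply ℝ _)
    have i3 := ic _ (hg i) _ h1.continuous h2
    have i4 := ic _ (hg i) _ p1.continuous p2
    have : (∫ x in B, u x * fderiv ℝ ψ x (EuclideanSpace.single i 1)) + ∫ x in B, g i x * ψ x =
       (∫ x in B, (u x * fderiv ℝ ψ x (EuclideanSpace.single i 1) - u x * fderiv ℝ (P n) x (EuclideanSpace.single i 1)))
       + ∫ x in B, (g i x * ψ x - g i x * P n x) := by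
      rw [integral_sub i1 i2, integral_sub i3 i4, e1]; ring
    rw [this, mul_add]
    refine (abs_add_le _ _).trans (add_le_add ?_ ?_)
    · rw [← integral_const_mul, ← Real.norm_eq_abs]
      refine norm_integral_le_of_norm_le (hu.abs.const_mul ε) ?_
      filter_upwards [ae_restrict_mem measurableSet_ball] with x hx
      rw [← mul_sub, norm_mul, Real.norm_eq_abs, mul_comm]
      refine mul_le_mul_of_nonneg_right ?_ (abs_nonneg _)
      rw [← sub_apply]
      refine (ContinuousLinearMap.le_opNorm _ _).trans ?_
      simpa using (hn x hx).2
    · rw [← integral_const_mul, ← Real.norm_eq_abs]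
      refine norm_integral_le_of_norm_le ((hg i).abs.const_mul ε) ?_
      filter_upwards [ae_restrict_mem measurableSet_ball] with x hx
      rw [← mul_sub, norm_mul, Real.norm_eq_abs, mul_comm]
      exact mul_le_mul_of_nonneg_right (hn x hx).1 (abs_nonneg _)
  rw [← add_eq_zero_iff_eq_neg, ← abs_nonpos_iff]
  set A := (∫ x in B, |u x|) + ∫ x in B, |g i x|
  have hA : 0 ≤ A := add_nonneg (integral_nonneg fun _ => abs_nonneg _) (integral_nonneg fun _ => abs_nonneg _)
  refine le_of_forall_pos_le_add fun ε hε => ?_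
  refine (key (ε / (A + 1)) (by positivity)).trans ?_
  rw [zero_add, div_mul_eq_mul_div, div_le_iff₀ (by positivity)]
  nlinarith
end
section
def bn (n : ℕ) : ContDiffBump (0 : E3) := ⟨1 / (2 * ((n:ℝ) + 1)), 1 / ((n:ℝ) + 1), by positivity, by
  rw [div_lt_div_iff₀ (by positivity) (by positivity)]; nlinarith [(Nat.cast_nonneg n : (0:ℝ) ≤ n)]⟩
def ph (n : ℕ) : E3 → ℝ := (bn n).normed volume
def ml (n : ℕ) (w : E3 → ℝ) (x : E3) : ℝ := ∫ y, ph n y * w (x - y)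
lemma bn_rOut (n : ℕ) : (bn n).rOut = 1 / ((n:ℝ) + 1) := rfl
lemma ph_nn (n : ℕ) (x : E3) : 0 ≤ ph n x := (bn n).nonneg_normed x
lemma ph_cd (n : ℕ) : ContDiff ℝ (⊤ : ℕ∞) (ph n) := (bn n).contDiff_normed
lemma ph_cs (n : ℕ) : HasCompactSupport (ph n) := (bn n).hasCompactSupport_normed
lemma ph_ts (n : ℕ) : tsupport (ph n) = Metric.closedBall 0 (1 / ((n:ℝ) + 1)) := (bn n).tsupport_normed_eq
lemma ml_conv_eq (n : ℕ) (w : E3 → ℝ) : ml n w = MeasureTheory.convolution (ph n) w (ContinuousLinearMap.lsmul ℝ ℝ) volume := by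
  ext x; simp [ml, MeasureTheory.convolution]
lemma ml_contDiff (n : ℕ) {w : E3 → ℝ} (hw : LocallyIntegrable w volume) : ContDiff ℝ (⊤ : ℕ∞) (ml n w) := by
  rw [ml_conv_eq]
  exact (ph_cs n).contDiff_convolution_left _ (ph_cd n) hw
lemma ml_fderiv (n : ℕ) {w : E3 → ℝ} (hw : LocallyIntegrable w volume) (x e : E3) :
    fderiv ℝ (ml n w) x e = ∫ y, w y * fderiv ℝ (ph n) (x - y) e := by
  have h1 := (ph_cs n).hasFDerivAt_convolution_left (ContinuousLinearMap.lsmul ℝ ℝ) ((ph_cd n).of_le (by simp)) hw x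
  rw [← ml_conv_eq] at h1
  rw [h1.fderiv]
  have hex : ConvolutionExistsAt (fderiv ℝ (ph n)) w x ((ContinuousLinearMap.lsmul ℝ ℝ).precompL E3) volume :=
    ((ph_cs n).fderiv (𝕜 := ℝ)).convolutionExists_left _ ((ph_cd n).continuous_fderiv (by simp)) hw x
  unfold MeasureTheory.convolution
  rw [ContinuousLinearMap.integral_apply hex]
  rw [← integral_sub_left_eq_self _ _ x]
  refine integral_congr_ae (ae_of_all _ fun y => ?_)
  simp [ContinuousLinearMap.precompL, mul_comm]
def pnu (n : ℕ) : Measure E3 := volume.withDensity (fun y => ENNReal.ofReal (ph n y))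
instance (n : ℕ) : IsProbabilityMeasure (pnu n) := ⟨by
  unfold pnu
  rw [withDensity_apply _ MeasurableSet.univ, Measure.restrict_univ, ← ofReal_integral_eq_lintegral_ofReal
    ((ph_cd n).continuous.integrable_of_hasCompactSupport (ph_cs n)) (ae_of_all _ (ph_nn n))]
  unfold ph
  rw [(bn n).integral_normed]; simp⟩
lemma ph_meas (n : ℕ) : Measurable (fun y => ENNReal.ofReal (ph n y)) := ((ph_cd n).continuous.measurable).ennreal_ofReal
lemma ml_pnu (n : ℕ) (w : E3 → ℝ) (x : E3) : ml n w x = ∫ y, w (x - y) ∂(pnu n) := by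
  unfold pnu ml
  rw [integral_withDensity_eq_integral_toReal_smul (ph_meas n) (ae_of_all _ fun w => ofReal_lt_top)]
  refine integral_congr_ae (ae_of_all _ fun y => ?_)
  simp [toReal_ofReal (ph_nn n y)]
lemma pnu_supp (n : ℕ) : ∀ᵐ y ∂(pnu n), ‖y‖ ≤ 1 / ((n:ℝ) + 1) := by
  unfold pnu
  rw [ae_withDensity_iff (ph_meas n)]
  refine ae_of_all _ fun y hy => ?_
  have : y ∈ tsupport (ph n) := subset_closure (by
    intro h; apply hy; simp [h])
  rw [ph_ts] at this
  simpa using this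
lemma ml_sub (n : ℕ) {w : E3 → ℝ} (hw : Measurable w) (x : E3) :
    ‖ml n w x - w x‖ₑ ≤ ∫⁻ y, ‖w (x - y) - w x‖ₑ ∂(pnu n) := by
  by_cases h : ∫⁻ y, ‖w (x - y) - w x‖ₑ ∂(pnu n) = ∞
  · rw [h]; simp
  have i1 : Integrable (fun y => w (x - y) - w x) (pnu n) :=
    ⟨Measurable.aestronglyMeasurable (by fun_prop), lt_top_iff_ne_top.2 h⟩
  have i2 : Integrable (fun y => w (x - y)) (pnu n) := by
    refine (i1.add (integrable_const (w x))).congr (ae_of_all _ fun w => by simp)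
  have : ml n w x - w x = ∫ y, (w (x - y) - w x) ∂(pnu n) := by
    rw [integral_sub i2 (integrable_const _), ml_pnu]; simp
  rw [this]
  exact enorm_integral_le_lintegral_enorm _
lemma kap_tendsto : Tendsto (fun n : ℕ => 1 / ((n:ℝ) + 1)) atTop (nhds 0) := tendsto_one_div_add_atTop_nhds_zero_nat
lemma ml_tendsto {p : ℝ} (hp : 1 ≤ p) {w : E3 → ℝ} (hm : Measurable w) (hw : MemLp w (ENNReal.ofReal p) volume) :
    Tendsto (fun n => ∫⁻ x, ‖ml n w x - w x‖ₑ ^ p) atTop (nhds 0) := by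
  refine tendsto_of_tendsto_of_tendsto_of_le_of_le tendsto_const_nhds (moll_ball hp hm hw kap_tendsto pnu_supp)
    (fun n => by simp) (fun n => lintegral_mono fun x => ?_)
  gcongr
  exact ml_sub n hm x
lemma ml_Lp {p : ℝ} (hp : 1 ≤ p) (n : ℕ) {w : E3 → ℝ} (hm : Measurable w) :
    ∫⁻ x, ‖ml n w x‖ₑ ^ p ≤ ∫⁻ x, ‖w x‖ₑ ^ p := by
  calc _ ≤ ∫⁻ x, (∫⁻ y, ‖w (x - y)‖ₑ ^ p ∂(pnu n)) := by
        refine lintegral_mono fun x => ?_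
        refine le_trans ?_ (jensen_pm hp (by fun_prop))
        gcongr
        rw [ml_pnu]
        exact enorm_integral_le_lintegral_enorm _
    _ = ∫⁻ y, (∫⁻ x, ‖w (x - y)‖ₑ ^ p) ∂(pnu n) := lintegral_lintegral_swap (by fun_prop)
    _ = ∫⁻ y, (∫⁻ x, ‖w x‖ₑ ^ p) ∂(pnu n) := by
        refine lintegral_congr fun y => ?_
        exact lintegral_sub_right_eq_self (fun x => ‖w x‖ₑ ^ p) y
    _ = _ := by simp
lemma ml_ae {w : E3 → ℝ} (hw : LocallyIntegrable w volume) : ∀ᵐ x, Tendsto (fun n => ml n w x) atTop (nhds (w x)) := by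
  have := ContDiffBump.ae_convolution_tendsto_right_of_locallyIntegrable (μ := (volume : Measure E3)) (φ := bn) (l := atTop) (K := 2)
    kap_tendsto (Eventually.of_forall fun n => by
      simp only [bn]; apply le_of_eq; field_simp) hw
  filter_upwards [this] with x hx
  simp only [ml_conv_eq]; exact hx
end
section
lemma clm_norm_le (L : E3 →L[ℝ] ℝ) : ‖L‖ₑ ≤ ∑ i, ‖L (EuclideanSpace.single i 1)‖ₑ := by
  have : ‖L‖ ≤ ∑ i, ‖L (EuclideanSpace.single i 1)‖ := by
    refine L.opNorm_le_bound (by positivity) fun x => ?_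
    have hx : x = ∑ i, x i • EuclideanSpace.single i (1:ℝ) := by
      ext k; simp [Fin.sum_univ_three]; fin_cases k <;> simp
    conv_lhs => rw [hx]
    rw [map_sum, Finset.sum_mul]
    refine (norm_sum_le _ _).trans (Finset.sum_le_sum fun i _ => ?_)
    rw [map_smul, norm_smul, mul_comm]
    gcongr
    exact PiLp.norm_apply_le x i
  rw [← ofReal_norm]
  refine (ofReal_le_ofReal this).trans ?_
  rw [ofReal_sum_of_nonneg fun _ _ => by positivity]
  simp only [ofReal_norm, le_refl]
lemma ml_wgrad (n : ℕ) {w : E3 → ℝ} {G : Fin 3 → E3 → ℝ} (hw : LocallyIntegrable w volume)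
    (h : ∀ ψ : E3 → ℝ, ContDiff ℝ (⊤ : ℕ∞) ψ → HasCompactSupport ψ → ∀ i,
      ∫ x, w x * fderiv ℝ ψ x (EuclideanSpace.single i 1) = - ∫ x, G i x * ψ x) (x : E3) (i : Fin 3) :
    fderiv ℝ (ml n w) x (EuclideanSpace.single i 1) = ml n (G i) x := by
  have hd : ∀ y, fderiv ℝ (fun y => ph n (x - y)) y (EuclideanSpace.single i 1) = - fderiv ℝ (ph n) (x - y) (EuclideanSpace.single i 1) := by
    intro y
    have h1 : HasFDerivAt (ph n) (fderiv ℝ (ph n) (x - y)) (x - y) := ((ph_cd n).differentiable (by simp) _).hasFDerivAt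
    have h2 : HasFDerivAt (fun y : E3 => x - y) (-(ContinuousLinearMap.id ℝ E3)) y := (hasFDerivAt_id y).const_sub x
    have := HasFDerivAt.comp y h1 h2
    have e : (fun y => ph n (x - y)) = (ph n) ∘ (fun y => x - y) := rfl
    rw [e, this.fderiv]; simp
  have hc : HasCompactSupport (fun y => ph n (x - y)) := (ph_cs n).comp_homeomorph (Homeomorph.subLeft x)
  have := h (fun y => ph n (x - y)) ((ph_cd n).comp (contDiff_const.sub contDiff_id)) hc i
  simp only [hd, mul_neg, integral_neg, neg_inj] at this
  rw [ml_fderiv n hw, this]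
  unfold ml
  rw [← integral_sub_left_eq_self _ _ x]
  refine integral_congr_ae (ae_of_all _ fun y => ?_)
  simp [mul_comm]
lemma ml_hcs (n : ℕ) {w : E3 → ℝ} (h : HasCompactSupport w) : HasCompactSupport (ml n w) := by
  rw [ml_conv_eq]; exact (ph_cs n).convolution _ h
lemma sum3_rpow {p : ℝ} (hp : 1 ≤ p) (a : Fin 3 → ℝ≥0∞) : (∑ i, a i) ^ p ≤ 3 ^ p * ∑ i, a i ^ p := by
  obtain ⟨k, -, hk⟩ := Finset.exists_max_image (Finset.univ : Finset (Fin 3)) a ⟨0, by simp⟩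
  calc (∑ i, a i) ^ p ≤ (3 * a k) ^ p := by
        gcongr
        refine (Finset.sum_le_sum (g := fun _ => a k) fun i hi => hk i hi).trans_eq ?_
        simp
    _ = 3 ^ p * a k ^ p := mul_rpow_of_nonneg _ _ (by linarith)
    _ ≤ _ := by
        gcongr
        exact Finset.single_le_sum (f := fun i => a i ^ p) (fun i _ => by simp) (Finset.mem_univ k)
lemma sob0 : ∃ C : ℝ≥0∞, C ≠ ∞ ∧ ∀ (w : E3 → ℝ) (G : Fin 3 → E3 → ℝ), Measurable w → (∀ i, Measurable (G i)) →
    Integrable w volume → HasCompactSupport w →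
    (∀ ψ : E3 → ℝ, ContDiff ℝ (⊤ : ℕ∞) ψ → HasCompactSupport ψ → ∀ i,
      ∫ x, w x * fderiv ℝ ψ x (EuclideanSpace.single i 1) = - ∫ x, G i x * ψ x) →
    ∫⁻ x, ‖w x‖ₑ ^ (3:ℝ) ≤ C * (∑ i, ∫⁻ x, ‖G i x‖ₑ ^ (3/2:ℝ)) ^ (2:ℝ) := by
  set C0 : ℝ≥0∞ := (SNormLESNormFDerivOfEqConst ℝ (volume : Measure E3) ((3/2 : NNReal):ℝ) : ℝ≥0∞) with hC0
  have hCt : C0 ≠ ∞ := by simp [C0]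
  clear_value C0
  refine ⟨C0 ^ (3:ℝ) * (3 ^ (3/2 : ℝ)) ^ (2:ℝ), by finiteness, fun w G mw mG iw cw h => ?_⟩
  have hn : ∀ n, ∫⁻ x, ‖ml n w x‖ₑ ^ (3:ℝ) ≤ C0 ^ (3:ℝ) * (3 ^ (3/2 : ℝ)) ^ (2:ℝ) * (∑ i, ∫⁻ x, ‖G i x‖ₑ ^ (3/2:ℝ)) ^ (2:ℝ) := by
    intro n
    have h1 := eLpNorm_le_eLpNorm_fderiv_of_eq (μ := (volume : Measure E3)) (F := ℝ) ((ml_contDiff n iw.locallyIntegrable).of_le (by simp)) (ml_hcs n cw)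
      (p := 3/2) (p' := 3) (by rw [← NNReal.coe_le_coe]; norm_num) (by simp) (by simp; norm_num)
    rw [eLpNorm_eq_lintegral_rpow_enorm_toReal (by simp) (by simp), eLpNorm_eq_lintegral_rpow_enorm_toReal (by simp) coe_ne_top, ← hC0] at h1
    have e1 : ((3:NNReal) : ℝ≥0∞).toReal = 3 := by simp
    have e2 : ((3/2:NNReal) : ℝ≥0∞).toReal = 3/2 := by simp
    rw [e1, e2] at h1
    have h2 := rpow_le_rpow h1 (by norm_num : (0:ℝ) ≤ 3)
    rw [← rpow_mul, mul_rpow_of_nonneg _ _ (by norm_num), ← rpow_mul] at h2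
    norm_num at h2
    refine le_trans (b := C0 ^ (3:ℝ) * (∫⁻ x, ‖fderiv ℝ (ml n w) x‖ₑ ^ (3/2:ℝ)) ^ (2:ℝ)) (by simpa using h2) ?_
    rw [mul_assoc]
    gcongr
    rw [← mul_rpow_of_nonneg _ _ (by norm_num)]
    gcongr
    calc ∫⁻ x, ‖fderiv ℝ (ml n w) x‖ₑ ^ (3/2:ℝ) ≤ ∫⁻ x, 3 ^ (3/2 : ℝ) * ∑ i, ‖ml n (G i) x‖ₑ ^ (3/2:ℝ) := by
          refine lintegral_mono fun x => ?_
          refine le_trans ?_ (sum3_rpow (by norm_num) _)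
          gcongr
          refine (clm_norm_le _).trans_eq ?_
          simp only [ml_wgrad n iw.locallyIntegrable h]
      _ ≤ _ := by
          have mm : ∀ i, Measurable (ml n (G i)) := by
            intro i
            have e : ml n (G i) = fun x => fderiv ℝ (ml n w) x (EuclideanSpace.single i 1) := by
              ext x; rw [ml_wgrad n iw.locallyIntegrable h]
            rw [e]
            have := (ml_contDiff n iw.locallyIntegrable).continuous_fderiv (by simp)
            fun_prop
          rw [lintegral_const_mul _ (by fun_prop), lintegral_finsetSum _ (by fun_prop)]
          exact mul_le_mul' le_rfl (Finset.sum_le_sum fun i _ => ml_Lp (by norm_num) n (mG i))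
  have : ∫⁻ x, ‖w x‖ₑ ^ (3:ℝ) ≤ liminf (fun n => ∫⁻ x, ‖ml n w x‖ₑ ^ (3:ℝ)) atTop := by
    have e : ∫⁻ x, ‖w x‖ₑ ^ (3:ℝ) = ∫⁻ x, liminf (fun n => ‖ml n w x‖ₑ ^ (3:ℝ)) atTop := by
      refine lintegral_congr_ae ?_
      filter_upwards [ml_ae iw.locallyIntegrable] with x hx
      refine (Tendsto.liminf_eq ?_).symm
      exact ((continuous_rpow_const (y := 3)).tendsto _).comp hx.enorm
    rw [e]
    refine lintegral_liminf_le fun n => ?_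
    have := (ml_contDiff n iw.locallyIntegrable).continuous
    fun_prop
  refine this.trans ?_
  refine liminf_le_of_frequently_le' (Frequently.of_forall hn)
end
section
lemma cutoff : ∃ C : ℝ, 0 < C ∧ ∀ (x0 : E3) (ρ : ℝ), 0 < ρ → ∃ η : E3 → ℝ, ContDiff ℝ (⊤ : ℕ∞) η ∧ HasCompactSupport η ∧
    tsupport η ⊆ Metric.ball x0 (2*ρ) ∧ (∀ x, 0 ≤ η x ∧ η x ≤ 1) ∧ (∀ x ∈ Metric.ball x0 ρ, η x = 1) ∧
    (∀ x ∈ Metric.ball x0 ρ, fderiv ℝ η x = 0) ∧ ∀ x, ‖fderiv ℝ η x‖ ≤ C / ρ := by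
  let b : ContDiffBump (0 : E3) := ⟨1, 3/2, by norm_num, by norm_num⟩
  obtain ⟨C, hC⟩ := (b.hasCompactSupport.fderiv (𝕜 := ℝ)).exists_bound_of_continuous (b.contDiff.continuous_fderiv (n := 1) (by simp))
  refine ⟨|C| + 1, by positivity, fun x0 ρ hρ => ?_⟩
  set η : E3 → ℝ := fun x => b (ρ⁻¹ • (x - x0))
  have h0 : ∀ x, HasFDerivAt η (ρ⁻¹ • fderiv ℝ b (ρ⁻¹ • (x - x0))) x := by
    intro x
    have h1 : HasFDerivAt b (fderiv ℝ b (ρ⁻¹ • (x - x0))) (ρ⁻¹ • (x - x0)) := ((b.contDiff (n := 1)).differentiable (by simp) _).hasFDerivAt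
    have h2 : HasFDerivAt (fun x : E3 => ρ⁻¹ • (x - x0)) (ρ⁻¹ • (ContinuousLinearMap.id ℝ E3)) x := ((hasFDerivAt_id x).sub_const x0).const_smul ρ⁻¹
    have := HasFDerivAt.comp x h1 h2
    have e : ρ⁻¹ • fderiv ℝ b (ρ⁻¹ • (x - x0)) = (fderiv ℝ b (ρ⁻¹ • (x - x0))).comp (ρ⁻¹ • (ContinuousLinearMap.id ℝ E3)) := by
      ext y; simp
    rw [e]; exact this
  have hs : tsupport η ⊆ Metric.closedBall x0 (3/2*ρ) := by
    refine closure_minimal (fun x hx => ?_) Metric.isClosed_closedBall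
    have : ρ⁻¹ • (x - x0) ∈ Function.support b := hx
    rw [b.support_eq] at this
    rw [mem_ball_zero_iff, norm_smul, norm_inv, Real.norm_of_nonneg hρ.le, inv_mul_lt_iff₀ hρ] at this
    rw [mem_closedBall_iff_norm]
    have e : b.rOut = 3/2 := rfl
    rw [e] at this; linarith
  have h1 : ∀ x ∈ Metric.ball x0 ρ, η x = 1 := by
    intro x hx
    refine b.one_of_mem_closedBall ?_
    rw [mem_ball_iff_norm] at hx
    rw [mem_closedBall_zero_iff, norm_smul, norm_inv, Real.norm_of_nonneg hρ.le, inv_mul_le_iff₀ hρ]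
    have e : b.rIn = 1 := rfl
    rw [e]; linarith
  refine ⟨η, b.contDiff.comp (by fun_prop),
    HasCompactSupport.of_support_subset_isCompact (isCompact_closedBall x0 (3/2*ρ)) (subset_closure.trans hs),
    hs.trans (Metric.closedBall_subset_ball (by linarith)), fun x => ⟨b.nonneg, b.le_one⟩, h1, fun x hx => ?_, fun x => ?_⟩
  · have : η =ᶠ[nhds x] fun _ => 1 := by
      filter_upwards [Metric.isOpen_ball.mem_nhds hx] with y hy using h1 y hy
    rw [this.fderiv_eq]; simp
  · rw [(h0 x).fderiv, norm_smul, norm_inv, Real.norm_of_nonneg hρ.le, inv_mul_eq_div]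
    gcongr
    exact (hC _).trans ((le_abs_self C).trans (by linarith))
lemma sob1 : ∃ C : ℝ≥0∞, C ≠ ∞ ∧ ∀ (x0 : E3) (R ρ : ℝ) (u : E3 → ℝ) (g : Fin 3 → E3 → ℝ), 0 < ρ → 2 * ρ ≤ R →
    Measurable u → (∀ i, Measurable (g i)) → IntegrableOn u (Metric.ball x0 R) → (∀ i, IntegrableOn (g i) (Metric.ball x0 R)) →
    WG u g (Metric.ball x0 R) →
    ∫⁻ x in Metric.ball x0 ρ, ‖u x‖ₑ ^ (3:ℝ) ≤ C * ((∑ i, ∫⁻ x in Metric.ball x0 R, ‖g i x‖ₑ ^ (3/2:ℝ))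
      + ENNReal.ofReal ρ ^ (-(3/2):ℝ) * ∫⁻ x in Metric.ball x0 (2*ρ) \ Metric.ball x0 ρ, ‖u x‖ₑ ^ (3/2:ℝ)) ^ (2:ℝ) := by
  obtain ⟨C0, hC0, h0⟩ := sob0
  obtain ⟨C1, hC1, h1⟩ := cutoff
  refine ⟨C0 * (2 ^ (3/2:ℝ) * (1 + 3 * ENNReal.ofReal C1 ^ (3/2:ℝ))) ^ (2:ℝ), by finiteness,
    fun x0 R ρ u g hρ hR mu mg iu ig hW => ?_⟩
  obtain ⟨η, ηs, ηc, ηt, ηb, η1, ηd, ηn⟩ := h1 x0 ρ hρ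
  have ηt' : tsupport η ⊆ Metric.ball x0 R := ηt.trans (Metric.ball_subset_ball hR)
  have cη := ηs.continuous
  have cd : Continuous (fderiv ℝ η) := ηs.continuous_fderiv (by simp)
  set G : Fin 3 → E3 → ℝ := fun i x => η x * g i x + u x * fderiv ℝ η x (EuclideanSpace.single i 1)
  set B := Metric.ball x0 R
  have z0 : ∀ x, x ∉ Metric.ball x0 (2*ρ) → η x = 0 := fun x hx => image_eq_zero_of_notMem_tsupport fun h => hx (ηt h)
  have zd : ∀ x, x ∉ Metric.ball x0 (2*ρ) → fderiv ℝ η x = 0 := fun x hx =>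
    image_eq_zero_of_notMem_tsupport fun h => hx (ηt (tsupport_fderiv_subset ℝ h))
  have hsub : Metric.ball x0 (2*ρ) ⊆ B := Metric.ball_subset_ball hR
  have z0' : ∀ x, x ∉ B → η x = 0 := fun x hx => z0 x fun h => hx (hsub h)
  have zd' : ∀ x, x ∉ B → fderiv ℝ η x = 0 := fun x hx => zd x fun h => hx (hsub h)
  have ic : ∀ f : E3 → ℝ, IntegrableOn f B → ∀ F : E3 → ℝ, Continuous F → HasCompactSupport F → IntegrableOn (fun x => f x * F x) B := by
    intro f hf F hF hFc
    obtain ⟨C, hC⟩ := hFc.exists_bound_of_continuous hF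
    exact Integrable.mul_bdd (c := C) hf hF.aestronglyMeasurable (ae_of_all _ hC)
  have iw : Integrable (fun x => η x * u x) volume := by
    rw [← integrableOn_iff_integrable_of_support_subset (s := B)]
    · exact (ic u iu η cη ηc).congr (ae_of_all _ fun x => mul_comm _ _)
    · intro x hx; by_contra h; exact hx (by simp [z0' x h])
  have key := h0 (fun x => η x * u x) G (by fun_prop) (fun i => by fun_prop) iw ηc.mul_right ?_
  · have k1 : ∫⁻ x in Metric.ball x0 ρ, ‖u x‖ₑ ^ (3:ℝ) ≤ ∫⁻ x, ‖η x * u x‖ₑ ^ (3:ℝ) := by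
      refine le_trans (le_of_eq ?_) (setLIntegral_le_lintegral (Metric.ball x0 ρ) _)
      refine setLIntegral_congr_fun measurableSet_ball fun x hx => ?_
      simp [η1 x hx]
    refine k1.trans (key.trans ?_)
    rw [mul_assoc, ← mul_rpow_of_nonneg _ _ (by norm_num)]
    set A := Metric.ball x0 (2*ρ) \ Metric.ball x0 ρ
    have mA : MeasurableSet A := measurableSet_ball.diff measurableSet_ball
    have k2 : ∀ i, ∫⁻ x, ‖G i x‖ₑ ^ (3/2:ℝ) ≤ 2 ^ (3/2:ℝ) * (∫⁻ x in B, ‖g i x‖ₑ ^ (3/2:ℝ)) +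
        2 ^ (3/2:ℝ) * (ENNReal.ofReal C1 ^ (3/2:ℝ) * (ENNReal.ofReal ρ ^ (-(3/2):ℝ) * ∫⁻ x in A, ‖u x‖ₑ ^ (3/2:ℝ))) := by
      intro i
      calc _ ≤ ∫⁻ x, (2 ^ (3/2:ℝ) * B.indicator (fun x => ‖g i x‖ₑ ^ (3/2:ℝ)) x +
            2 ^ (3/2:ℝ) * (ENNReal.ofReal (C1/ρ) ^ (3/2:ℝ) * A.indicator (fun x => ‖u x‖ₑ ^ (3/2:ℝ)) x)) := by
            refine lintegral_mono fun x => ?_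
            have p2 : ∀ a b : ℝ≥0∞, (a + b) ^ (3/2:ℝ) ≤ 2 ^ (3/2:ℝ) * a ^ (3/2:ℝ) + 2 ^ (3/2:ℝ) * b ^ (3/2:ℝ) := by
              intro a b
              rw [← mul_add]
              rcases le_total a b with h | h
              · calc _ ≤ (2 * b) ^ (3/2:ℝ) := by gcongr; rw [two_mul]; gcongr
                  _ = 2 ^ (3/2:ℝ) * b ^ (3/2:ℝ) := mul_rpow_of_nonneg _ _ (by norm_num)
                  _ ≤ _ := by gcongr; exact le_add_self
              · calc _ ≤ (2 * a) ^ (3/2:ℝ) := by gcongr; rw [two_mul]; gcongr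
                  _ = 2 ^ (3/2:ℝ) * a ^ (3/2:ℝ) := mul_rpow_of_nonneg _ _ (by norm_num)
                  _ ≤ _ := by gcongr; exact le_self_add
            calc ‖G i x‖ₑ ^ (3/2:ℝ) ≤ (‖η x * g i x‖ₑ + ‖u x * fderiv ℝ η x (EuclideanSpace.single i 1)‖ₑ) ^ (3/2:ℝ) := by
                  gcongr; exact enorm_add_le _ _
              _ ≤ _ := p2 _ _
              _ ≤ _ := by
                gcongr
                · by_cases hx : x ∈ B
                  · rw [indicator_of_mem hx, enorm_mul]
                    gcongr
                    calc ‖η x‖ₑ * ‖g i x‖ₑ ≤ 1 * ‖g i x‖ₑ := by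
                          gcongr
                          rw [Real.enorm_of_nonneg (ηb x).1]
                          exact ofReal_le_one.2 (ηb x).2
                      _ = _ := one_mul _
                  · rw [z0' x hx]; simp
                · by_cases hx : x ∈ A
                  · rw [indicator_of_mem hx, ← mul_rpow_of_nonneg _ _ (by norm_num), enorm_mul, mul_comm]
                    gcongr
                    rw [← ofReal_norm]
                    refine ofReal_le_ofReal (((fderiv ℝ η x).le_opNorm _).trans ?_)
                    simpa using ηn x
                  · have : fderiv ℝ η x = 0 := by
                      by_cases h2 : x ∈ Metric.ball x0 ρ
                      · exact ηd x h2
                      · exact zd x fun h => hx ⟨h, h2⟩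
                    simp [this]
        _ = _ := by
            have m1 : Measurable (B.indicator (fun x => ‖g i x‖ₑ ^ (3/2:ℝ))) := by
              refine Measurable.indicator ?_ measurableSet_ball
              have := mg i; fun_prop
            have m2 : Measurable (A.indicator (fun x => ‖u x‖ₑ ^ (3/2:ℝ))) := Measurable.indicator (by fun_prop) mA
            rw [lintegral_add_left (by fun_prop), lintegral_const_mul _ m1, lintegral_const_mul _ (by fun_prop), lintegral_const_mul _ m2,
              lintegral_indicator measurableSet_ball, lintegral_indicator mA]
            congr 2
            rw [← mul_assoc, ofReal_div_of_pos hρ, div_rpow_of_nonneg _ _ (by norm_num), rpow_neg, div_eq_mul_inv]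
    gcongr C0 * ?_ ^ (2:ℝ)
    refine (Finset.sum_le_sum fun i _ => k2 i).trans ?_
    rw [Finset.sum_add_distrib, ← Finset.mul_sum]
    simp only [Finset.sum_const, Finset.card_univ, Fintype.card_fin, nsmul_eq_mul]
    set a := ∑ i, ∫⁻ x in B, ‖g i x‖ₑ ^ (3/2:ℝ)
    set b := ENNReal.ofReal ρ ^ (-(3/2):ℝ) * ∫⁻ x in A, ‖u x‖ₑ ^ (3/2:ℝ)
    set c := ENNReal.ofReal C1 ^ (3/2:ℝ)
    set d := (2:ℝ≥0∞) ^ (3/2:ℝ)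
    calc _ ≤ d * a + d * (3 * (c * b)) + (d * b + d * (3 * c * a)) := by
          refine le_trans (le_of_eq ?_) le_self_add
          push_cast; ring
      _ = _ := by ring
  · intro ψ hψ cψ i
    have cψ' := hψ.continuous
    have cdψ : Continuous (fderiv ℝ ψ) := hψ.continuous_fderiv (by simp)
    have e1 : ∫ x, η x * u x * fderiv ℝ ψ x (EuclideanSpace.single i 1) = ∫ x in B, η x * u x * fderiv ℝ ψ x (EuclideanSpace.single i 1) :=
      (setIntegral_eq_integral_of_forall_compl_eq_zero fun x hx => by simp [z0' x hx]).symm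
    have e2 : ∫ x, G i x * ψ x = ∫ x in B, G i x * ψ x :=
      (setIntegral_eq_integral_of_forall_compl_eq_zero fun x hx => by simp [G, z0' x hx, zd' x hx]).symm
    have hp := hW (fun x => η x * ψ x) (ηs.mul hψ) ηc.mul_right ((tsupport_mul_subset_left).trans ηt') i
    have e3 : ∀ x, fderiv ℝ (fun x => η x * ψ x) x (EuclideanSpace.single i 1) = η x * fderiv ℝ ψ x (EuclideanSpace.single i 1) +
        ψ x * fderiv ℝ η x (EuclideanSpace.single i 1) := by
      intro x
      rw [fderiv_fun_mul (ηs.differentiable (by simp) x) (hψ.differentiable (by simp) x)]; simp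
    have i1 : IntegrableOn (fun x => u x * (η x * fderiv ℝ ψ x (EuclideanSpace.single i 1))) B := ic u iu _ (by fun_prop) ηc.mul_right
    have i2 : IntegrableOn (fun x => u x * (ψ x * fderiv ℝ η x (EuclideanSpace.single i 1))) B := ic u iu _ (by fun_prop) cψ.mul_right
    have i3 : IntegrableOn (fun x => g i x * (η x * ψ x)) B := ic _ (ig i) _ (by fun_prop) ηc.mul_right
    simp only [e3, mul_add] at hp
    rw [integral_add i1 i2] at hp
    rw [e1, e2]
    have e4 : ∫ x in B, G i x * ψ x = ∫ x in B, g i x * (η x * ψ x) + u x * (ψ x * fderiv ℝ η x (EuclideanSpace.single i 1)) := by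
      refine integral_congr_ae (ae_of_all _ fun x => ?_); simp only [G]; ring
    rw [e4, integral_add i3 i2]
    have e5 : ∫ x in B, η x * u x * fderiv ℝ ψ x (EuclideanSpace.single i 1) = ∫ x in B, u x * (η x * fderiv ℝ ψ x (EuclideanSpace.single i 1)) := by
      refine integral_congr_ae (ae_of_all _ fun x => ?_); simp only []; ring
    rw [e5]; linarith
end
section
lemma hol2 {W : Type*} [MeasurableSpace W] {ν : Measure W} {f : W → ℝ≥0∞} (hf : AEMeasurable f ν) :
    (∫⁻ w, f w ∂ν) ^ (2:ℝ) ≤ ν univ * ∫⁻ w, f w ^ (2:ℝ) ∂ν := by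
  have := lintegral_mul_le_Lp_mul_Lq ν (p := 2) (q := 2) ⟨by norm_num, by norm_num, by norm_num⟩ hf (aemeasurable_const (b := (1:ℝ≥0∞)))
  simp only [Pi.mul_apply, mul_one, one_rpow, lintegral_const, one_mul] at this
  refine (rpow_le_rpow this (by norm_num : (0:ℝ) ≤ 2)).trans_eq ?_
  rw [mul_rpow_of_nonneg _ _ (by norm_num), ← rpow_mul, ← rpow_mul, mul_comm]
  norm_num
lemma sq_add_le (a b : ℝ≥0∞) : (a + b) ^ (2:ℝ) ≤ 4 * (a ^ (2:ℝ) + b ^ (2:ℝ)) := by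
  have h4 : (2:ℝ≥0∞) ^ (2:ℝ) = 4 := by norm_num
  rcases le_total a b with h | h
  · calc _ ≤ (2 * b) ^ (2:ℝ) := by gcongr; rw [two_mul]; gcongr
      _ = 4 * b ^ (2:ℝ) := by rw [mul_rpow_of_nonneg _ _ (by norm_num), h4]
      _ ≤ _ := by gcongr; exact le_add_self
  · calc _ ≤ (2 * a) ^ (2:ℝ) := by gcongr; rw [two_mul]; gcongr
      _ = 4 * a ^ (2:ℝ) := by rw [mul_rpow_of_nonneg _ _ (by norm_num), h4]
      _ ≤ _ := by gcongr; exact le_self_add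
structure SL (x0 : E3) (R : ℝ) (u : E3 → ℝ) (g : Fin 3 → E3 → ℝ) : Prop where
  mu : Measurable u
  mg : ∀ i, Measurable (g i)
  iu : IntegrableOn u (Metric.ball x0 R)
  ig : ∀ i, IntegrableOn (g i) (Metric.ball x0 R)
  hW : WG u g (Metric.ball x0 R)
lemma sob2 : ∃ C : ℝ≥0∞, C ≠ ∞ ∧ ∀ (x0 : E3) (R ρ : ℝ) (u : E3 → ℝ) (g : Fin 3 → E3 → ℝ), 0 < ρ → 2 * ρ ≤ R →
    SL x0 R u g →
    ∫⁻ x in Metric.ball x0 ρ, ‖u x‖ₑ ^ (3:ℝ) ≤ C * ((∑ i, ∫⁻ x in Metric.ball x0 R, ‖g i x‖ₑ ^ (3/2:ℝ)) ^ (2:ℝ)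
      + ∫⁻ x in Metric.ball x0 (2*ρ) \ Metric.ball x0 ρ, ‖u x‖ₑ ^ (3:ℝ)) := by
  obtain ⟨C, hC, h⟩ := sob1
  set c := volume (Metric.ball (0:E3) 1)
  have hc : c ≠ ∞ := measure_ball_lt_top.ne
  refine ⟨C * 4 * (1 + 8 * c), by finiteness, fun x0 R ρ u g hρ hR hS => ?_⟩
  refine (h x0 R ρ u g hρ hR hS.mu hS.mg hS.iu hS.ig hS.hW).trans ?_
  set S := ∑ i, ∫⁻ x in Metric.ball x0 R, ‖g i x‖ₑ ^ (3/2:ℝ)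
  set A := Metric.ball x0 (2*ρ) \ Metric.ball x0 ρ
  set X := ∫⁻ x in A, ‖u x‖ₑ ^ (3:ℝ)
  have hb : (ENNReal.ofReal ρ ^ (-(3/2):ℝ) * ∫⁻ x in A, ‖u x‖ₑ ^ (3/2:ℝ)) ^ (2:ℝ) ≤ 8 * c * X := by
    have mu := hS.mu
    have h2 := hol2 (ν := volume.restrict A) (f := fun x => ‖u x‖ₑ ^ (3/2:ℝ)) (by fun_prop)
    simp only [← rpow_mul, Measure.restrict_apply_univ] at h2
    have h3 : volume A ≤ ENNReal.ofReal ρ ^ (3:ℝ) * 8 * c := by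
      refine (measure_mono sdiff_subset).trans ?_
      rw [Measure.addHaar_ball _ _ (by positivity)]
      simp only [finrank_euclideanSpace, Fintype.card_fin]
      rw [mul_pow, ofReal_mul (by norm_num), ofReal_pow hρ.le, mul_comm (ENNReal.ofReal (2^3)), show volume (Metric.ball (0:E3) 1) = c from rfl]
      norm_num
    rw [mul_rpow_of_nonneg _ _ (by norm_num), ← rpow_mul]
    calc _ ≤ ENNReal.ofReal ρ ^ (-(3/2) * 2:ℝ) * ((ENNReal.ofReal ρ ^ (3:ℝ) * 8 * c) * X) := by
          gcongr
          refine h2.trans ?_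
          have e : (3/2*2:ℝ) = 3 := by norm_num
          rw [e]
          exact mul_le_mul' h3 le_rfl
      _ = (ENNReal.ofReal ρ ^ (-(3/2) * 2:ℝ) * ENNReal.ofReal ρ ^ (3:ℝ)) * (8 * c * X) := by ring
      _ = 1 * (8 * c * X) := by
          rw [← rpow_add _ _ (by simpa using hρ) (by simp)]; norm_num
      _ = _ := one_mul _
  calc _ ≤ C * (4 * (S ^ (2:ℝ) + 8 * c * X)) := by
        gcongr
        refine (sq_add_le _ _).trans ?_
        gcongr
    _ ≤ C * (4 * (S ^ (2:ℝ) + 8 * c * X)) + C * (4 * (8 * c * S ^ (2:ℝ) + X)) := le_self_add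
    _ = _ := by ring
lemma slice3 : ∃ C : ℝ≥0∞, C ≠ ∞ ∧ ∀ (R : ℝ) (K ε : ℝ≥0∞), 0 < R → K ≠ ∞ → ε ≠ 0 → ε ≠ ∞ → ∃ ρ : ℝ, 0 < ρ ∧ ρ ≤ R ∧
    ∀ x0 u g, SL x0 R u g → (∑ i, ∫⁻ x in Metric.ball x0 R, ‖g i x‖ₑ ^ (3/2:ℝ)) ^ (2:ℝ) ≤ ε →
    ∫⁻ x in Metric.ball x0 R, ‖u x‖ₑ ^ (2:ℝ) ≤ K →
    ∫⁻ x in Metric.ball x0 ρ, ‖u x‖ₑ ^ (3:ℝ) ≤ C * ε := by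
  obtain ⟨C, hC, h⟩ := sob2
  obtain ⟨C', hC', h'⟩ := sob1
  refine ⟨1 + C, by finiteness, fun R K ε hR hK hε hε' => ?_⟩
  set θ := C / (1 + C)
  have hθ : θ < 1 := by
    refine (ENNReal.div_lt_iff (by simp) (by left; finiteness)).2 ?_
    rw [one_mul, add_comm]
    exact lt_add_right hC (by simp)
  have hθC : θ * (1 + C) = C := ENNReal.div_mul_cancel (by simp) (by finiteness)
  set M := C' * (ε ^ (1/2:ℝ) + ENNReal.ofReal (R/2) ^ (-(3/2):ℝ) * (volume (Metric.ball (0:E3) R) + K)) ^ (2:ℝ)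
  have hM : M ≠ ∞ := by
    have : volume (Metric.ball (0:E3) R) ≠ ∞ := measure_ball_lt_top.ne
    have h2 : ENNReal.ofReal (R/2) ^ (-(3/2):ℝ) ≠ ∞ := rpow_ne_top_of_ne_zero (by simpa using hR) (by simp)
    have h3 : ε ^ (1/2:ℝ) ≠ ∞ := by finiteness
    finiteness
  have ht : Tendsto (fun n : ℕ => θ ^ n * M) atTop (nhds 0) := by
    have := ENNReal.Tendsto.mul_const (ENNReal.tendsto_pow_atTop_nhds_zero_of_lt_one hθ) (Or.inr hM)
    simpa using this
  obtain ⟨N, hN⟩ := (ht.eventually_le_const (pos_iff_ne_zero.2 hε)).exists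
  refine ⟨R / 2 ^ (N+1), by positivity, div_le_self hR.le (one_le_pow₀ (by norm_num)), fun x0 u g hS hg hu => ?_⟩
  have mu := hS.mu
  set S := ∑ i, ∫⁻ x in Metric.ball x0 R, ‖g i x‖ₑ ^ (3/2:ℝ)
  have hX : ∀ n : ℕ, ∫⁻ x in Metric.ball x0 (R / 2^(n+1)), ‖u x‖ₑ ^ (3:ℝ) ≤ θ ^ n * M + C * ε := by
    intro n
    induction n with
    | zero =>
      refine le_trans ?_ le_self_add
      rw [pow_zero, one_mul]
      norm_num only
      have := h' x0 R (R/2) u g (by positivity) (by linarith) hS.mu hS.mg hS.iu hS.ig hS.hW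
      refine this.trans ?_
      have e1 : S ≤ ε ^ (1/2:ℝ) := by
        have := rpow_le_rpow hg (by norm_num : (0:ℝ) ≤ 1/2)
        rw [← rpow_mul] at this; norm_num at this; simpa using this
      have e2 : ∫⁻ x in Metric.ball x0 (2*(R/2)) \ Metric.ball x0 (R/2), ‖u x‖ₑ ^ (3/2:ℝ) ≤ volume (Metric.ball (0:E3) R) + K := by
        calc _ ≤ ∫⁻ x in Metric.ball x0 R, ‖u x‖ₑ ^ (3/2:ℝ) := lintegral_mono_set (by
              rw [mul_div_cancel₀ _ (by norm_num)]; exact sdiff_subset)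
          _ ≤ ∫⁻ x in Metric.ball x0 R, (1 + ‖u x‖ₑ ^ (2:ℝ)) := by
              refine lintegral_mono fun x => ?_
              rcases le_total ‖u x‖ₑ 1 with h | h
              · exact (rpow_le_one h (by norm_num)).trans le_self_add
              · exact (rpow_le_rpow_of_exponent_le h (by norm_num)).trans le_add_self
          _ ≤ _ := by
              rw [lintegral_add_left (by fun_prop)]
              gcongr
              simp [Measure.addHaar_ball_center]
      simp only [M]
      gcongr
    | succ n ih =>
      set ρ := R / 2^(n+1+1)
      have e : 2 * ρ = R / 2^(n+1) := by simp only [ρ]; rw [pow_succ 2 (n+1)]; field_simp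
      have hρ : 0 < ρ := by positivity
      have := h x0 R ρ u g hρ (by rw [e]; exact div_le_self hR.le (one_le_pow₀ (by norm_num))) hS
      rw [e] at this
      set B1 := Metric.ball x0 (R / 2^(n+1))
      set B2 := Metric.ball x0 ρ
      have hsub : B2 ⊆ B1 := Metric.ball_subset_ball (by linarith)
      have hsum : ∫⁻ x in B1, ‖u x‖ₑ ^ (3:ℝ) = (∫⁻ x in B1 \ B2, ‖u x‖ₑ ^ (3:ℝ)) + ∫⁻ x in B2, ‖u x‖ₑ ^ (3:ℝ) := by
        have := lintegral_inter_add_sdiff (μ := volume) (fun x => ‖u x‖ₑ ^ (3:ℝ)) B1 (measurableSet_ball (x := x0) (ε := ρ))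
        rw [← this, inter_eq_self_of_subset_right hsub, add_comm]
      set X1 := ∫⁻ x in B1, ‖u x‖ₑ ^ (3:ℝ)
      set X2 := ∫⁻ x in B2, ‖u x‖ₑ ^ (3:ℝ)
      have k : (1 + C) * X2 ≤ C * (ε + X1) := by
        calc (1 + C) * X2 = X2 + C * X2 := by ring
          _ ≤ C * (S ^ (2:ℝ) + ∫⁻ x in B1 \ B2, ‖u x‖ₑ ^ (3:ℝ)) + C * X2 := by gcongr
          _ ≤ C * (ε + ∫⁻ x in B1 \ B2, ‖u x‖ₑ ^ (3:ℝ)) + C * X2 := by gcongr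
          _ = _ := by rw [hsum]; ring
      have k2 : X2 ≤ θ * (ε + X1) := by
        have : X2 ≤ (C * (ε + X1)) / (1 + C) := by
          rw [ENNReal.le_div_iff_mul_le (by simp) (by left; finiteness), mul_comm]; exact k
        refine this.trans_eq ?_
        simp only [θ, div_eq_mul_inv]; ring
      calc X2 ≤ θ * (ε + (θ ^ n * M + C * ε)) := k2.trans (by gcongr)
        _ = θ ^ (n+1) * M + θ * (1 + C) * ε := by ring
        _ = _ := by rw [hθC]
  calc _ ≤ _ := hX N
    _ ≤ ε + C * ε := by gcongr
    _ = _ := by ring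
end
section
structure LS (v : ZT → E3) (Dv : ZT → Fin 3 → Fin 3 → ℝ) (x0 : E3) (t0 r : ℝ) : Prop where
  mv : Measurable v
  mD : Measurable Dv
  hI : IntegrableOn (fun z => ‖v z‖ ^ 2 + ∑ i, ∑ j, (Dv z i j) ^ 2) (pcyl (x0, t0) r)
  hs : ∀ᵐ t ∂(volume.restrict (Ioo (t0 - r^2) t0)), (∀ j, SL x0 r (fun x => v (x, t) j) (fun i x => Dv (x, t) i j)) ∧
    IntegrableOn (fun x => ‖v (x, t)‖ ^ 2 + ∑ i, ∑ j, (Dv (x, t) i j) ^ 2) (Metric.ball x0 r)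
lemma sq_le_ds (M : Fin 3 → Fin 3 → ℝ) (i j : Fin 3) : (M i j)^2 ≤ ∑ i, ∑ j, (M i j)^2 :=
  (Finset.single_le_sum (f := fun j => (M i j)^2) (fun _ _ => sq_nonneg _) (Finset.mem_univ j)).trans
    (Finset.single_le_sum (f := fun i => ∑ j, (M i j)^2) (fun _ _ => by positivity) (Finset.mem_univ i))
lemma int_aux {W : Type*} [MeasurableSpace W] {ν : Measure W} [IsFiniteMeasure ν] {f F : W → ℝ} (hf : Measurable f) (hF : Integrable F ν)
    (h : ∀ w, (f w)^2 ≤ F w) : Integrable f ν := by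
  refine Integrable.mono' ((integrable_const (1:ℝ)).add hF) hf.aestronglyMeasurable (ae_of_all _ fun w => ?_)
  have := h w
  simp only [Pi.add_apply, Real.norm_eq_abs]
  rw [← sq_abs] at this
  nlinarith [sq_nonneg (|f w| - 1), abs_nonneg (f w)]
lemma comp_sq_le (u : E3) (M : Fin 3 → Fin 3 → ℝ) (j : Fin 3) : (u j)^2 ≤ ‖u‖^2 + ∑ i, ∑ j, (M i j)^2 := by
  have h1 := abs_apply_le u j
  have : (u j)^2 ≤ ‖u‖^2 := by rw [← sq_abs]; gcongr
  have h2 : 0 ≤ ∑ i, ∑ j, (M i j)^2 := by positivity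
  linarith
lemma comp_sq_le2 (u : E3) (M : Fin 3 → Fin 3 → ℝ) (i j : Fin 3) : (M i j)^2 ≤ ‖u‖^2 + ∑ i, ∑ j, (M i j)^2 := by
  have := sq_le_ds M i j
  nlinarith [sq_nonneg ‖u‖]
instance (x0 : E3) (r : ℝ) : IsFiniteMeasure (volume.restrict (Metric.ball x0 r)) := ⟨by rw [Measure.restrict_apply_univ]; exact measure_ball_lt_top⟩
instance (x0 : E3) (t0 r : ℝ) : IsFiniteMeasure ((volume : Measure ZT).restrict (pcyl (x0, t0) r)) := ⟨by rw [Measure.restrict_apply_univ]; exact vol_pcyl_lt x0 t0 r⟩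
lemma LS_of {Ω : Set E3} {T : ℝ} {v : ZT → E3} {Dv : ZT → Fin 3 → Fin 3 → ℝ} {p : ZT → ℝ} {v₀ : E3 → E3} (hΩ : IsOpen Ω)
    (H : IsSuitableWeakSolution Ω T v Dv p v₀) {x0 : E3} {t0 r : ℝ} (hB : Metric.ball x0 r ⊆ Ω) (hI : Ioo (t0 - r^2) t0 ⊆ Ioo 0 T) :
    LS v Dv x0 t0 r := by
  have mv := H.meas_v
  have mD := H.meas_Dv
  have h1 : IntegrableOn (fun z => ‖v z‖ ^ 2 + ∑ i, ∑ j, (Dv z i j) ^ 2) (pcyl (x0, t0) r) :=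
    H.v_l2_w12.mono_set (prod_mono hB hI)
  refine ⟨H.meas_v, H.meas_Dv, h1, ?_⟩
  obtain ⟨P, hP⟩ := dense_test x0 r
  have h2 : ∀ᵐ t ∂(volume.restrict (Ioo (t0 - r^2) t0)), ∀ n, ∀ i j : Fin 3,
      ∫ x in Ω, v (x, t) j * fderiv ℝ (P n) x (EuclideanSpace.single i 1) = - ∫ x in Ω, Dv (x, t) i j * P n x := by
    rw [ae_all_iff]
    intro n
    exact ae_restrict_of_ae_restrict_of_subset hI (H.weak_grad (P n) (hP.1 n).1 (hP.1 n).2.1 ((hP.1 n).2.2.trans hB))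
  have h3 : Integrable (fun z => ‖v z‖ ^ 2 + ∑ i, ∑ j, (Dv z i j) ^ 2) ((volume.restrict (Metric.ball x0 r)).prod (volume.restrict (Ioo (t0 - r^2) t0))) := by
    rw [← restrict_pcyl]; exact h1
  filter_upwards [h2, h3.prod_left_ae] with t ht hi
  refine ⟨fun j => ?_, hi⟩
  have mu : Measurable (fun x => v (x, t) j) := by fun_prop
  have mg : ∀ i, Measurable (fun x => Dv (x, t) i j) := by
    intro i
    have e : Measurable (fun x : E3 => Dv (x, t)) := by fun_prop
    exact (measurable_pi_apply j).comp ((measurable_pi_apply i).comp e)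
  have iu : IntegrableOn (fun x => v (x, t) j) (Metric.ball x0 r) := int_aux mu hi fun x => comp_sq_le _ _ j
  have ig : ∀ i, IntegrableOn (fun x => Dv (x, t) i j) (Metric.ball x0 r) := fun i => int_aux (mg i) hi fun x => comp_sq_le2 _ _ i j
  refine ⟨mu, mg, iu, ig, WG_of_dense hP iu ig fun n i => ?_⟩
  have := ht n i j
  have hts := (hP.1 n).2.2
  rw [setIntegral_eq_of_subset_of_forall_sdiff_eq_zero hΩ.measurableSet hB, setIntegral_eq_of_subset_of_forall_sdiff_eq_zero hΩ.measurableSet hB] at this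
  · exact this
  · intro x hx
    rw [image_eq_zero_of_notMem_tsupport fun h => hx.2 (hts h)]; simp
  · intro x hx
    rw [image_eq_zero_of_notMem_tsupport (f := fderiv ℝ (P n)) fun h => hx.2 (hts (tsupport_fderiv_subset ℝ h))]; simp
lemma slice_test {ψ : ZT → ℝ} (h1 : ContDiff ℝ (⊤ : ℕ∞) ψ) (h2 : HasCompactSupport ψ) {x0 : E3} {t0 r : ℝ}
    (h3 : tsupport ψ ⊆ pcyl (x0, t0) r) (t : ℝ) : ContDiff ℝ (⊤ : ℕ∞) (fun x => ψ (x, t)) ∧ HasCompactSupport (fun x => ψ (x, t)) ∧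
    tsupport (fun x => ψ (x, t)) ⊆ Metric.ball x0 r ∧ ∀ x j, fderiv ℝ (fun x => ψ (x, t)) x (EuclideanSpace.single j 1) = sdz ψ j (x, t) := by
  have hs : tsupport (fun x => ψ (x, t)) ⊆ Prod.fst '' (tsupport ψ) := by
    refine closure_minimal ?_ (h2.isCompact.image continuous_fst).isClosed
    intro x hx
    exact ⟨(x, t), subset_closure hx, rfl⟩
  refine ⟨by fun_prop, ?_, ?_, fun x j => ?_⟩
  · exact HasCompactSupport.of_support_subset_isCompact (h2.isCompact.image continuous_fst) (subset_closure.trans hs)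
  · intro x hx
    obtain ⟨z, hz, rfl⟩ := hs hx
    exact (h3 hz).1
  · have h4 : HasFDerivAt ψ (fderiv ℝ ψ (x, t)) (x, t) := (h1.differentiable (by simp) _).hasFDerivAt
    have h5 : HasFDerivAt (fun x : E3 => (x, t)) (ContinuousLinearMap.inl ℝ E3 ℝ) x := hasFDerivAt_prodMk_left x t
    have := HasFDerivAt.comp x h4 h5
    have e : (fun x => ψ (x, t)) = ψ ∘ fun x => (x, t) := rfl
    rw [e, this.fderiv]; simp [sdz]
section
variable {v : ZT → E3} {Dv : ZT → Fin 3 → Fin 3 → ℝ} {x0 : E3} {t0 r : ℝ}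
lemma LS.mDij (H : LS v Dv x0 t0 r) (i j : Fin 3) : Measurable (fun z => Dv z i j) :=
  (measurable_pi_apply j).comp ((measurable_pi_apply i).comp H.mD)
lemma LS.iv (H : LS v Dv x0 t0 r) (i : Fin 3) : IntegrableOn (fun z => v z i) (pcyl (x0, t0) r) := by
  have := H.mv
  exact int_aux (by fun_prop) H.hI fun z => comp_sq_le _ _ i
lemma LS.iD (H : LS v Dv x0 t0 r) (i j : Fin 3) : IntegrableOn (fun z => Dv z i j) (pcyl (x0, t0) r) :=
  int_aux (H.mDij i j) H.hI fun z => comp_sq_le2 _ _ i j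
lemma int_pcyl {f : ZT → ℝ} (hf : IntegrableOn f (pcyl (x0, t0) r)) :
    ∫ z in pcyl (x0, t0) r, f z = ∫ t in Ioo (t0 - r^2) t0, ∫ x in Metric.ball x0 r, f (x, t) := by
  have h : Integrable f ((volume.restrict (Metric.ball x0 r)).prod (volume.restrict (Ioo (t0 - r^2) t0))) := by
    rw [← restrict_pcyl]; exact hf
  rw [restrict_pcyl, integral_prod_symm _ h]
lemma LS.ibp (H : LS v Dv x0 t0 r) {ψ : ZT → ℝ} (h1 : ContDiff ℝ (⊤ : ℕ∞) ψ) (h2 : HasCompactSupport ψ)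
    (h3 : tsupport ψ ⊆ pcyl (x0, t0) r) (i j : Fin 3) :
    ∫ z in pcyl (x0, t0) r, v z i * sdz ψ j z = - ∫ z in pcyl (x0, t0) r, Dv z j i * ψ z := by
  rw [int_pcyl (f := fun z => v z i * sdz ψ j z) (int_mul_cc (H.iv i) (cont_fd h1 _) (hcs_fderiv h2 _)), int_pcyl (int_mul_cc (H.iD j i) h1.continuous h2), ← integral_neg]
  refine integral_congr_ae ?_
  filter_upwards [H.hs] with t ht
  obtain ⟨k1, k2, k3, k4⟩ := slice_test h1 h2 h3 t
  have := (ht.1 i).hW _ k1 k2 k3 j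
  simp only [k4] at this
  exact this
lemma isOpen_pcyl (x0 : E3) (t0 r : ℝ) : IsOpen (pcyl (x0, t0) r) := Metric.isOpen_ball.prod isOpen_Ioo
lemma LS.div0 (H : LS v Dv x0 t0 r) (hd : CD v (pcyl (x0, t0) r)) :
    ∀ᵐ t ∂(volume.restrict (Ioo (t0 - r^2) t0)), ∀ᵐ x ∂(volume.restrict (Metric.ball x0 r)), ∑ j, Dv (x, t) j j = 0 := by
  have h : ∀ᵐ z ∂(volume : Measure ZT), z ∈ pcyl (x0, t0) r → ∑ j, Dv z j j = 0 := by
    refine IsOpen.ae_eq_zero_of_integral_contDiff_smul_eq_zero (isOpen_pcyl x0 t0 r) (IntegrableOn.locallyIntegrableOn ?_) ?_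
    · exact integrable_finsetSum _ fun j _ => H.iD j j
    · intro g hg hc hs
      have e1 : ∫ z, g z • ∑ j, Dv z j j = ∫ z in pcyl (x0, t0) r, ∑ j, Dv z j j * g z := by
        rw [← setIntegral_eq_integral_of_forall_compl_eq_zero (s := pcyl (x0, t0) r)]
        · refine integral_congr_ae (ae_of_all _ fun z => ?_)
          simp only [smul_eq_mul, mul_comm (g z), Finset.sum_mul]
        · intro z hz
          rw [image_eq_zero_of_notMem_tsupport fun h => hz (hs h)]; simp
      rw [e1, integral_finsetSum _ fun j _ => int_mul_cc (H.iD j j) hg.continuous hc]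
      have e2 := hd g hg hc hs
      rw [integral_finsetSum (f := fun j z => v z j * sdz g j z) _ fun j _ => int_mul_cc (H.iv j) (cont_fd hg _) (hcs_fderiv hc _)] at e2
      simp only [H.ibp hg hc hs, Finset.sum_neg_distrib, neg_eq_zero] at e2
      exact e2
  have h2 : ∀ᵐ z ∂((volume.restrict (Metric.ball x0 r)).prod (volume.restrict (Ioo (t0 - r^2) t0))), ∑ j, Dv z j j = 0 := by
    rw [← restrict_pcyl]
    exact (ae_restrict_iff' (meas_pcyl _ _ _)).2 h
  have h3 := (Measure.measurePreserving_swap (μ := volume.restrict (Ioo (t0 - r^2) t0)) (ν := volume.restrict (Metric.ball x0 r))).quasiMeasurePreserving.ae h2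
  exact Measure.ae_ae_of_ae_prod h3
end
end
section
lemma ph_refl (n : ℕ) (x y e : E3) : fderiv ℝ (fun y => ph n (x - y)) y e = - fderiv ℝ (ph n) (x - y) e := by
  have h1 : HasFDerivAt (ph n) (fderiv ℝ (ph n) (x - y)) (x - y) := ((ph_cd n).differentiable (by simp) _).hasFDerivAt
  have h2 : HasFDerivAt (fun y : E3 => x - y) (-(ContinuousLinearMap.id ℝ E3)) y := (hasFDerivAt_id y).const_sub x
  have := HasFDerivAt.comp y h1 h2
  have e : (fun y => ph n (x - y)) = (ph n) ∘ (fun y => x - y) := rfl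
  rw [e, this.fderiv]; simp
lemma sl_deriv {x0 : E3} {r : ℝ} {u : E3 → ℝ} {g : Fin 3 → E3 → ℝ} (h : SL x0 r u g) (n : ℕ) (x : E3)
    (hx : Metric.closedBall x (1 / ((n:ℝ) + 1)) ⊆ Metric.ball x0 r) (j : Fin 3) :
    fderiv ℝ (ml n ((Metric.ball x0 r).indicator u)) x (EuclideanSpace.single j 1) = ∫ y in Metric.ball x0 r, g j y * ph n (x - y) := by
  have hli : LocallyIntegrable ((Metric.ball x0 r).indicator u) volume :=
    ((integrable_indicator_iff measurableSet_ball).2 h.iu).locallyIntegrable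
  have hc : HasCompactSupport (fun y => ph n (x - y)) := (ph_cs n).comp_homeomorph (Homeomorph.subLeft x)
  have hs : tsupport (fun y => ph n (x - y)) ⊆ Metric.ball x0 r := by
    refine subset_trans (closure_minimal ?_ Metric.isClosed_closedBall) hx
    intro y hy
    have : x - y ∈ tsupport (ph n) := subset_closure hy
    rw [ph_ts, mem_closedBall_zero_iff] at this
    rwa [mem_closedBall_iff_norm']
  have := h.hW (fun y => ph n (x - y)) ((ph_cd n).comp (contDiff_const.sub contDiff_id)) hc hs j
  simp only [ph_refl, mul_neg, integral_neg, neg_inj] at this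
  rw [← this, ml_fderiv n hli, ← integral_indicator measurableSet_ball]
  refine integral_congr_ae (ae_of_all _ fun y => ?_)
  simp only [indicator]; split_ifs <;> simp
lemma ml_memLp (n : ℕ) {w : E3 → ℝ} (hm : Measurable w) (hw : MemLp w 2 volume) (hl : LocallyIntegrable w volume) : MemLp (ml n w) 2 volume := by
  refine ⟨(ml_contDiff n hl).continuous.aestronglyMeasurable, ?_⟩
  rw [eLpNorm_lt_top_iff_lintegral_rpow_enorm_lt_top (by simp) (by simp)]
  refine (ml_Lp (by norm_num) n hm).trans_lt ?_
  exact (eLpNorm_lt_top_iff_lintegral_rpow_enorm_lt_top (by simp) (by simp)).1 hw.2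
lemma conv_l2 {B : Set E3} {h w : E3 → ℝ} (hh : MemLp h 2 (volume.restrict B)) (hm : Measurable w) (hw : MemLp w 2 volume)
    (hl : LocallyIntegrable w volume) :
    Tendsto (fun n => ∫ x in B, h x * ml n w x) atTop (nhds (∫ x in B, h x * w x)) := by
  have iw := hh.integrable_mul (hw.restrict B)
  refine tendsto_integral_of_L1 _ iw.1
    (Eventually.of_forall fun n => hh.integrable_mul ((ml_memLp n hm hw hl).restrict B)) ?_
  have ht : Tendsto (fun n => (∫⁻ x in B, ‖h x‖ₑ ^ (2:ℝ)) ^ (1/2:ℝ) * (∫⁻ x, ‖ml n w x - w x‖ₑ ^ (2:ℝ)) ^ (1/2:ℝ)) atTop (nhds 0) := by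
    have h1 := ml_tendsto (p := 2) (by norm_num) hm (by simpa using hw)
    have h2 := ((continuous_rpow_const (y := 1/2)).tendsto 0).comp h1
    have h3 : (∫⁻ x in B, ‖h x‖ₑ ^ (2:ℝ)) ^ (1/2:ℝ) ≠ ∞ := by
      refine rpow_ne_top_of_nonneg (by norm_num) ?_
      simpa using ((eLpNorm_lt_top_iff_lintegral_rpow_enorm_lt_top (by simp) (by simp)).1 hh.2).ne
    have := ENNReal.Tendsto.const_mul h2 (Or.inr h3)
    simpa using this
  refine tendsto_of_tendsto_of_tendsto_of_le_of_le tendsto_const_nhds ht (fun n => by simp) fun n => ?_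
  have mc := (ml_contDiff n hl).continuous
  calc _ = ∫⁻ x in B, ((fun x => ‖h x‖ₑ) * (fun x => ‖ml n w x - w x‖ₑ)) x := by
        refine lintegral_congr fun x => ?_
        simp only [Pi.mul_apply]
        rw [← enorm_mul, mul_sub]
    _ ≤ _ := lintegral_mul_le_Lp_mul_Lq _ (p := 2) (q := 2) ⟨by norm_num, by norm_num, by norm_num⟩ hh.1.enorm (by fun_prop)
    _ ≤ _ := by
        gcongr
        exact Measure.restrict_le_self
lemma prod_rule {x0 : E3} {r : ℝ} {u : Fin 3 → E3 → ℝ} {g : Fin 3 → Fin 3 → E3 → ℝ} (h : ∀ j, SL x0 r (u j) (fun i => g i j))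
    (u2 : ∀ j, MemLp (u j) 2 (volume.restrict (Metric.ball x0 r))) (g2 : ∀ i j, MemLp (g i j) 2 (volume.restrict (Metric.ball x0 r)))
    (hd : ∀ᵐ x ∂(volume.restrict (Metric.ball x0 r)), ∑ j, g j j x = 0) {φ : E3 → ℝ} (h1 : ContDiff ℝ (⊤ : ℕ∞) φ)
    (h2 : HasCompactSupport φ) (h3 : tsupport φ ⊆ Metric.ball x0 r) (i : Fin 3) :
    ∑ j, ∫ x in Metric.ball x0 r, u j x * g j i x * φ x =
      - ∑ j, ∫ x in Metric.ball x0 r, u i x * u j x * fderiv ℝ φ x (EuclideanSpace.single j 1) := by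
  set B := Metric.ball x0 r
  set U : Fin 3 → E3 → ℝ := fun j => B.indicator (u j)
  have mU : ∀ j, Measurable (U j) := fun j => (h j).mu.indicator measurableSet_ball
  have lU : ∀ j, LocallyIntegrable (U j) volume := fun j => ((integrable_indicator_iff measurableSet_ball).2 (h j).iu).locallyIntegrable
  have U2 : ∀ j, MemLp (U j) 2 volume := fun j => (memLp_indicator_iff_restrict measurableSet_ball).2 (u2 j)
  have cφ := h1.continuous
  have cdφ : Continuous (fderiv ℝ φ) := h1.continuous_fderiv (by simp)
  have bd : ∀ f : E3 → ℝ, MemLp f 2 (volume.restrict B) → ∀ F : E3 → ℝ, Continuous F → HasCompactSupport F →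
      MemLp (fun x => f x * F x) 2 (volume.restrict B) := by
    intro f hf F hF hFc
    obtain ⟨C, hC⟩ := hFc.exists_bound_of_continuous hF
    refine (hf.const_mul C).mono (hf.1.mul hF.aestronglyMeasurable) (ae_of_all _ fun x => ?_)
    rw [norm_mul, norm_mul, mul_comm]
    gcongr
    exact (hC x).trans (le_abs_self C)
  have hcd : ∀ j, HasCompactSupport (fun x => fderiv ℝ φ x (EuclideanSpace.single j 1)) := fun j =>
    (h2.fderiv (𝕜 := ℝ)).comp_left (g := fun L : E3 →L[ℝ] ℝ => L (EuclideanSpace.single j 1)) (by simp)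
  have e1 : ∀ᶠ n : ℕ in atTop, ∑ j, ∫ x in B, (g j i x * φ x) * ml n (U j) x =
      - ∑ j, ∫ x in B, (u i x * fderiv ℝ φ x (EuclideanSpace.single j 1)) * ml n (U j) x := by
    obtain ⟨δ, hδ, hK⟩ := h2.isCompact.exists_cthickening_subset_open Metric.isOpen_ball h3
    have ev : ∀ᶠ n : ℕ in atTop, 1 / ((n:ℝ) + 1) < δ := kap_tendsto.eventually_lt_const hδ
    filter_upwards [ev] with n hn
    have cm : ∀ j, ContDiff ℝ (⊤ : ℕ∞) (ml n (U j)) := fun j => ml_contDiff n (lU j)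
    have cfm : ∀ j, Continuous (fderiv ℝ (ml n (U j))) := fun j => (cm j).continuous_fderiv (by simp)
    have cmc : ∀ j, Continuous (ml n (U j)) := fun j => (cm j).continuous
    have hdz : ∀ x, φ x * ∑ j, fderiv ℝ (ml n (U j)) x (EuclideanSpace.single j 1) = 0 := by
      intro x
      by_cases hx : x ∈ tsupport φ
      · have hb : Metric.closedBall x (1 / ((n:ℝ) + 1)) ⊆ B :=
          ((Metric.closedBall_subset_closedBall hn.le).trans (Metric.closedBall_subset_cthickening hx δ)).trans hK
        have : ∑ j, fderiv ℝ (ml n (U j)) x (EuclideanSpace.single j 1) = 0 := by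
          rw [Finset.sum_congr rfl fun j _ => sl_deriv (h j) n x hb j]
          rw [← integral_finsetSum]
          · rw [← integral_zero E3 ℝ]
            refine integral_congr_ae ?_
            filter_upwards [hd] with y hy
            rw [← Finset.sum_mul, hy, zero_mul]
          · intro j _
            have cp := (ph_cd n).continuous
            have cc : HasCompactSupport (fun y => ph n (x - y)) := (ph_cs n).comp_homeomorph (Homeomorph.subLeft x)
            exact (bd _ (g2 j j) (fun y => ph n (x - y)) (by fun_prop) cc).integrable (by norm_num)
        rw [this, mul_zero]
      · rw [image_eq_zero_of_notMem_tsupport hx, zero_mul]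
    have e2 : ∀ j, ∫ x in B, (g j i x * φ x) * ml n (U j) x = - (∫ x in B, (u i x * fderiv ℝ φ x (EuclideanSpace.single j 1)) * ml n (U j) x)
        - ∫ x in B, u i x * (φ x * fderiv ℝ (ml n (U j)) x (EuclideanSpace.single j 1)) := by
      intro j
      have := (h i).hW (fun x => φ x * ml n (U j) x) (h1.mul (cm j)) h2.mul_right ((tsupport_mul_subset_left).trans h3) j
      have e3 : ∀ x, fderiv ℝ (fun x => φ x * ml n (U j) x) x (EuclideanSpace.single j 1) = φ x * fderiv ℝ (ml n (U j)) x (EuclideanSpace.single j 1) +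
          fderiv ℝ φ x (EuclideanSpace.single j 1) * ml n (U j) x := by
        intro x
        rw [fderiv_fun_mul (h1.differentiable (by simp) x) ((cm j).differentiable (by simp) x)]; simp; ring
      simp only [e3, mul_add] at this
      have cfj := cfm j
      have cmj := cmc j
      rw [integral_add] at this
      · simp only [mul_assoc]; linarith
      · exact (bd _ (u2 i) _ (by fun_prop) h2.mul_right).integrable (by norm_num)
      · exact (bd _ (u2 i) _ (by fun_prop) (hcd j).mul_right).integrable (by norm_num)
    rw [Finset.sum_congr rfl fun j _ => e2 j, Finset.sum_sub_distrib, Finset.sum_neg_distrib]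
    have e4 : ∑ j, ∫ x in B, u i x * (φ x * fderiv ℝ (ml n (U j)) x (EuclideanSpace.single j 1)) = 0 := by
      rw [← integral_finsetSum]
      · simp only [← Finset.mul_sum, hdz, mul_zero, integral_zero]
      · intro j _
        have cfj := cfm j
        exact (bd _ (u2 i) _ (by fun_prop) h2.mul_right).integrable (by norm_num)
    rw [e4, sub_zero]
  have t1 : Tendsto (fun n => ∑ j, ∫ x in B, (g j i x * φ x) * ml n (U j) x) atTop (nhds (∑ j, ∫ x in B, (g j i x * φ x) * U j x)) :=
    tendsto_finsetSum _ fun j _ => conv_l2 (bd _ (g2 j i) φ cφ h2) (mU j) (U2 j) (lU j)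
  have t2 : Tendsto (fun n => - ∑ j, ∫ x in B, (u i x * fderiv ℝ φ x (EuclideanSpace.single j 1)) * ml n (U j) x) atTop
      (nhds (- ∑ j, ∫ x in B, (u i x * fderiv ℝ φ x (EuclideanSpace.single j 1)) * U j x)) :=
    (tendsto_finsetSum _ fun j _ => conv_l2 (bd _ (u2 i) _ (by fun_prop) (hcd j)) (mU j) (U2 j) (lU j)).neg
  have e5 := tendsto_nhds_unique (t1.congr' e1) t2
  have e6 : ∀ j, ∫ x in B, u j x * g j i x * φ x = ∫ x in B, (g j i x * φ x) * U j x := fun j =>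
    setIntegral_congr_fun measurableSet_ball fun x hx => by simp only [U, indicator_of_mem hx]; ring
  have e7 : ∀ j, ∫ x in B, u i x * u j x * fderiv ℝ φ x (EuclideanSpace.single j 1) =
      ∫ x in B, (u i x * fderiv ℝ φ x (EuclideanSpace.single j 1)) * U j x := fun j =>
    setIntegral_congr_fun measurableSet_ball fun x hx => by simp only [U, indicator_of_mem hx]; ring
  simp only [e6, e7]
  exact e5
end
section
section
variable {v : ZT → E3} {Dv : ZT → Fin 3 → Fin 3 → ℝ} {x0 : E3} {t0 r : ℝ}
lemma memLp2_aux {W : Type*} [MeasurableSpace W] {ν : Measure W} {f F : W → ℝ} (hf : Measurable f) (hF : Integrable F ν)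
    (h : ∀ w, (f w)^2 ≤ F w) : MemLp f 2 ν := by
  rw [memLp_two_iff_integrable_sq hf.aestronglyMeasurable]
  refine hF.mono' (by fun_prop) (ae_of_all _ fun w => ?_)
  rw [Real.norm_eq_abs, abs_of_nonneg (sq_nonneg _)]; exact h w
lemma int_mul_cc3 {g f : E3 → ℝ} {ν : Measure E3} (hg : Integrable g ν) (hf : Continuous f) (hc : HasCompactSupport f) :
    Integrable (fun z => g z * f z) ν := by
  obtain ⟨C, hC⟩ := hc.exists_bound_of_continuous hf
  exact Integrable.mul_bdd (c := C) hg hf.aestronglyMeasurable (ae_of_all _ hC)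
lemma int4 {ν : Measure ZT} {a b c d : ZT → ℝ} (ha : Integrable a ν) (hb : Integrable b ν) (hc : Integrable c ν) (hd : Integrable d ν) :
    ∫ z, (- a z + b z + c z - d z) ∂ν = - (∫ z, a z ∂ν) + (∫ z, b z ∂ν) + (∫ z, c z ∂ν) - ∫ z, d z ∂ν := by
  have h1 : Integrable (fun z => - a z) ν := ha.neg
  have h2 : Integrable (fun z => - a z + b z) ν := h1.add hb
  have h3 : Integrable (fun z => - a z + b z + c z) ν := h2.add hc
  rw [integral_sub h3 hd, integral_add h2 hc, integral_add h1 hb, integral_neg]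
lemma LS.nl (H : LS v Dv x0 t0 r) (hd : CD v (pcyl (x0, t0) r)) {ψ : ZT → ℝ} (h1 : ContDiff ℝ (⊤ : ℕ∞) ψ) (h2 : HasCompactSupport ψ)
    (h3 : tsupport ψ ⊆ pcyl (x0, t0) r) (i : Fin 3) :
    (∀ j, IntegrableOn (fun z => v z j * Dv z j i * ψ z) (pcyl (x0, t0) r)) ∧
    (∀ j, IntegrableOn (fun z => v z i * v z j * sdz ψ j z) (pcyl (x0, t0) r)) ∧
    ∑ j, ∫ z in pcyl (x0, t0) r, v z j * Dv z j i * ψ z = - ∑ j, ∫ z in pcyl (x0, t0) r, v z i * v z j * sdz ψ j z := by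
  have mv := H.mv
  have v2 : ∀ j, MemLp (fun z => v z j) 2 (volume.restrict (pcyl (x0, t0) r)) := fun j =>
    memLp2_aux (by fun_prop) H.hI fun z => comp_sq_le _ _ j
  have D2 : ∀ i j, MemLp (fun z => Dv z i j) 2 (volume.restrict (pcyl (x0, t0) r)) := fun i j =>
    memLp2_aux (H.mDij i j) H.hI fun z => comp_sq_le2 _ _ i j
  have i1 : ∀ j, IntegrableOn (fun z => v z j * Dv z j i * ψ z) (pcyl (x0, t0) r) := fun j =>
    int_mul_cc (f := fun z => ψ z) ((v2 j).integrable_mul (D2 j i)) h1.continuous h2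
  have i2 : ∀ j, IntegrableOn (fun z => v z i * v z j * sdz ψ j z) (pcyl (x0, t0) r) := fun j =>
    int_mul_cc (f := fun z => sdz ψ j z) ((v2 i).integrable_mul (v2 j)) (cont_fd h1 _) (hcs_fderiv h2 _)
  refine ⟨i1, i2, ?_⟩
  rw [← integral_finsetSum _ fun j _ => i1 j, ← integral_finsetSum _ fun j _ => i2 j,
    int_pcyl (integrable_finsetSum _ fun j _ => i1 j), int_pcyl (integrable_finsetSum _ fun j _ => i2 j), ← integral_neg]
  refine integral_congr_ae ?_
  filter_upwards [H.hs, H.div0 hd] with t ht hdt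
  obtain ⟨k1, k2, k3, k4⟩ := slice_test h1 h2 h3 t
  have a2 : ∀ j, MemLp (fun x => v (x, t) j) 2 (volume.restrict (Metric.ball x0 r)) := fun j =>
    memLp2_aux (by fun_prop) ht.2 fun z => comp_sq_le _ _ j
  have b2 : ∀ i j, MemLp (fun x => Dv (x, t) i j) 2 (volume.restrict (Metric.ball x0 r)) := fun i j =>
    memLp2_aux ((H.mDij i j).comp (by fun_prop)) ht.2 fun z => comp_sq_le2 _ _ i j
  have := prod_rule (u := fun j x => v (x, t) j) (g := fun i j x => Dv (x, t) i j) ht.1 a2 b2 hdt k1 k2 k3 i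
  simp only [k4] at this
  have cs : ∀ j, Continuous (fun x : E3 => sdz ψ j (x, t)) := fun j => (cont_fd h1 _).comp (by fun_prop)
  rw [integral_finsetSum, integral_finsetSum]
  · exact this
  · intro j _
    refine int_mul_cc3 (f := fun x => sdz ψ j (x, t)) ((a2 i).integrable_mul (a2 j)) (cs j) ?_
    simp only [← k4]
    exact (k2.fderiv (𝕜 := ℝ)).comp_left (g := fun L : E3 →L[ℝ] ℝ => L (EuclideanSpace.single j 1)) (by simp)
  · intro j _
    exact int_mul_cc3 (f := fun x => ψ (x, t)) ((a2 j).integrable_mul (b2 j i)) k1.continuous k2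
end
lemma CD_of {Ω : Set E3} {T : ℝ} {v : ZT → E3} {Dv : ZT → Fin 3 → Fin 3 → ℝ} {p : ZT → ℝ} {v₀ : E3 → E3} (hΩ : IsOpen Ω)
    (H : IsSuitableWeakSolution Ω T v Dv p v₀) {x0 : E3} {t0 r : ℝ} (hB : Metric.ball x0 r ⊆ Ω) (hI : Ioo (t0 - r^2) t0 ⊆ Ioo 0 T) :
    CD v (pcyl (x0, t0) r) := by
  intro ψ h1 h2 h3
  have hs : pcyl (x0, t0) r ⊆ Ω ×ˢ Ioo 0 T := prod_mono hB hI
  have := H.div_free ψ h1 h2 (h3.trans hs)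
  rw [setIntegral_eq_of_subset_of_forall_sdiff_eq_zero (hΩ.measurableSet.prod measurableSet_Ioo) hs] at this
  · exact this
  · intro z hz
    unfold sdz
    rw [image_eq_zero_of_notMem_tsupport (f := fderiv ℝ ψ) fun h => hz.2 (h3 (tsupport_fderiv_subset ℝ h))]; simp
lemma vec_test {φ : Fin 3 → ZT → ℝ} (h1 : ∀ i, ContDiff ℝ (⊤ : ℕ∞) (φ i)) (h2 : ∀ i, HasCompactSupport (φ i)) {Q : Set ZT}
    (h3 : ∀ i, tsupport (φ i) ⊆ Q) : ∃ Φ : ZT → E3, ContDiff ℝ (⊤ : ℕ∞) Φ ∧ HasCompactSupport Φ ∧ tsupport Φ ⊆ Q ∧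
      (∀ z i, Φ z i = φ i z) ∧ (∀ z w i, fderiv ℝ Φ z w i = fderiv ℝ (φ i) z w) := by
  have c1 : ContDiff ℝ (⊤ : ℕ∞) (fun z => (WithLp.toLp 2 (fun i => φ i z) : E3)) := contDiff_euclidean.2 fun i => h1 i
  have hK : IsCompact (⋃ i, tsupport (φ i)) := isCompact_iUnion fun i => (h2 i).isCompact
  have hs : tsupport (fun z => (WithLp.toLp 2 (fun i => φ i z) : E3)) ⊆ ⋃ i, tsupport (φ i) := by
    refine closure_minimal ?_ hK.isClosed
    intro z hz
    by_contra hn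
    simp only [mem_iUnion, not_exists] at hn
    refine hz ?_
    ext i
    simpa using image_eq_zero_of_notMem_tsupport (hn i)
  refine ⟨_, c1, HasCompactSupport.of_support_subset_isCompact hK (subset_closure.trans hs), hs.trans (iUnion_subset h3), fun z i => rfl, fun z w i => ?_⟩
  have h4 := (c1.differentiable (by simp) z).hasFDerivAt
  have h5 := ((EuclideanSpace.proj i : E3 →L[ℝ] ℝ).hasFDerivAt (x := (WithLp.toLp 2 (fun i => φ i z) : E3))).comp z h4
  have h6 : HasFDerivAt (φ i) _ z := h5
  rw [h6.fderiv]; rfl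
lemma CB_of {Ω : Set E3} {T : ℝ} {v : ZT → E3} {Dv : ZT → Fin 3 → Fin 3 → ℝ} {p : ZT → ℝ} {v₀ : E3 → E3} (hΩ : IsOpen Ω)
    (H : IsSuitableWeakSolution Ω T v Dv p v₀) {x0 : E3} {t0 r : ℝ} (hB : Metric.ball x0 r ⊆ Ω) (hI : Ioo (t0 - r^2) t0 ⊆ Ioo 0 T)
    (ip : IntegrableOn p (pcyl (x0, t0) r)) : CB v p (pcyl (x0, t0) r) := by
  intro φ h1 h2 h3
  have hs : pcyl (x0, t0) r ⊆ Ω ×ˢ Ioo 0 T := prod_mono hB hI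
  have L := LS_of hΩ H hB hI
  have hd := CD_of hΩ H hB hI
  obtain ⟨Φ, f1, f2, f3, f4, f5⟩ := vec_test h1 h2 h3
  have key := H.weak_nse Φ f1 f2 (f3.trans (hs.trans (prod_mono subset_rfl fun t ht => ht.2)))
  have e0 : ∫ x in Ω, ∑ i, v₀ x i * Φ (x, 0) i = 0 := by
    have : ∀ x, Φ (x, 0) = 0 := fun x => image_eq_zero_of_notMem_tsupport fun h => by
      have := (hs (f3 h)).2
      simp at this
    simp [this]
  rw [e0, setIntegral_eq_of_subset_of_forall_sdiff_eq_zero (hΩ.measurableSet.prod measurableSet_Ioo) hs] at key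
  swap
  · intro z hz
    unfold sdz tdz
    rw [image_eq_zero_of_notMem_tsupport (f := fderiv ℝ Φ) fun h => hz.2 (f3 (tsupport_fderiv_subset ℝ h)),
      image_eq_zero_of_notMem_tsupport (f := Φ) fun h => hz.2 (f3 h)]
    simp
  simp only [tdz, sdz, f4, f5] at key
  set Q := pcyl (x0, t0) r
  have cs : ∀ i j, ContDiff ℝ (⊤ : ℕ∞) (fun z => sdz (φ i) j z) := fun i j =>
    ((h1 i).fderiv_right (m := (⊤ : ℕ∞)) (by simp)).clm_apply contDiff_const
  have hcs : ∀ i j, HasCompactSupport (fun z => sdz (φ i) j z) := fun i j => hcs_fderiv (h2 i) _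
  have hts : ∀ i j, tsupport (fun z => sdz (φ i) j z) ⊆ Q := fun i j =>
    (closure_mono (s := Function.support (fun z => sdz (φ i) j z)) (t := Function.support (fderiv ℝ (φ i))) fun z hz h => hz (by simp only [sdz, h]; simp)).trans ((tsupport_fderiv_subset ℝ).trans (h3 i))
  have n := fun i => L.nl hd (h1 i) (h2 i) (h3 i) i
  have it : ∀ i, IntegrableOn (fun z => v z i * tdz (φ i) z) Q := fun i =>
    int_mul_cc (f := fun z => tdz (φ i) z) (L.iv i) (cont_fd (h1 i) _) (hcs_fderiv (h2 i) _)
  have is : ∀ i j, IntegrableOn (fun z => Dv z j i * sdz (φ i) j z) Q := fun i j =>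
    int_mul_cc (f := fun z => sdz (φ i) j z) (L.iD j i) (cont_fd (h1 i) _) (hcs_fderiv (h2 i) _)
  have iss : ∀ i j, IntegrableOn (fun z => v z i * sdz (fun w => sdz (φ i) j w) j z) Q := fun i j =>
    int_mul_cc (f := fun z => sdz (fun w => sdz (φ i) j w) j z) (L.iv i) (cont_fd (cs i j) _) (hcs_fderiv (hcs i j) _)
  have ipp : ∀ i, IntegrableOn (fun z => p z * sdz (φ i) i z) Q := fun i =>
    int_mul_cc (f := fun z => sdz (φ i) i z) ip (cont_fd (h1 i) _) (hcs_fderiv (h2 i) _)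
  have ib := fun i j => L.ibp (cs i j) (hcs i j) (hts i j) i j
  have sI : ∀ {f : Fin 3 → Fin 3 → ZT → ℝ}, (∀ i j, IntegrableOn (f i j) Q) → IntegrableOn (fun z => ∑ i, ∑ j, f i j z) Q :=
    fun h => integrable_finsetSum _ fun i _ => integrable_finsetSum _ fun j _ => h i j
  have sE : ∀ {f : Fin 3 → Fin 3 → ZT → ℝ}, (∀ i j, IntegrableOn (f i j) Q) → ∫ z in Q, ∑ i, ∑ j, f i j z = ∑ i, ∑ j, ∫ z in Q, f i j z := by
    intro f h
    rw [integral_finsetSum _ fun i _ => integrable_finsetSum _ fun j _ => h i j]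
    exact Finset.sum_congr rfl fun i _ => integral_finsetSum _ fun j _ => h i j
  change ∫ z in Q, (-(∑ i, v z i * tdz (φ i) z) + (∑ i, ∑ j, v z j * Dv z j i * φ i z)
          + (∑ i, ∑ j, Dv z j i * sdz (φ i) j z) - p z * ∑ i, sdz (φ i) i z) = 0 at key
  have I1 : IntegrableOn (fun z => ∑ i, v z i * tdz (φ i) z) Q := integrable_finsetSum _ fun i _ => it i
  have I2 := sI fun i j => (n i).1 j
  have I3 := sI is
  have I4 : IntegrableOn (fun z => p z * ∑ i, sdz (φ i) i z) Q := by
    simp only [Finset.mul_sum]; exact integrable_finsetSum _ fun i _ => ipp i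
  have I5 := sI iss
  have I6 := sI fun i j => (n i).2.1 j
  rw [int4 I1 I2 I3 I4, sE fun i j => (n i).1 j, sE is] at key
  have e1 : (∫ z in Q, ((∑ i, v z i * (tdz (φ i) z + ∑ j, sdz (fun w => sdz (φ i) j w) j z))
      + (∑ i, ∑ j, v z i * v z j * sdz (φ i) j z) + p z * ∑ i, sdz (φ i) i z)) =
      ∫ z in Q, (((∑ i, v z i * tdz (φ i) z) + ∑ i, ∑ j, v z i * sdz (fun w => sdz (φ i) j w) j z)
      + (∑ i, ∑ j, v z i * v z j * sdz (φ i) j z) + p z * ∑ i, sdz (φ i) i z) := by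
    simp only [mul_add, Finset.sum_add_distrib, Finset.mul_sum]
  have I7 : IntegrableOn (fun z => (∑ i, v z i * tdz (φ i) z) + ∑ i, ∑ j, v z i * sdz (fun w => sdz (φ i) j w) j z) Q := I1.add I5
  have I8 : IntegrableOn (fun z => ((∑ i, v z i * tdz (φ i) z) + ∑ i, ∑ j, v z i * sdz (fun w => sdz (φ i) j w) j z) +
    ∑ i, ∑ j, v z i * v z j * sdz (φ i) j z) Q := I7.add I6
  rw [e1, integral_add I8 I4, integral_add I7 I6, integral_add I1 I5, sE iss, sE fun i j => (n i).2.1 j]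
  have e2 : ∑ i, ∑ j, ∫ z in Q, v z j * Dv z j i * φ i z = - ∑ i, ∑ j, ∫ z in Q, v z i * v z j * sdz (φ i) j z := by
    rw [← Finset.sum_neg_distrib]; exact Finset.sum_congr rfl fun i _ => (n i).2.2
  have e3 : ∑ i, ∑ j, ∫ z in Q, v z i * sdz (fun w => sdz (φ i) j w) j z = - ∑ i, ∑ j, ∫ z in Q, Dv z j i * sdz (φ i) j z := by
    simp only [← Finset.sum_neg_distrib]
    exact Finset.sum_congr rfl fun i _ => Finset.sum_congr rfl fun j _ => ib i j
  rw [e2] at key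
  rw [e3]
  linarith
lemma CH_of {Ω : Set E3} {T : ℝ} {v : ZT → E3} {Dv : ZT → Fin 3 → Fin 3 → ℝ} {p : ZT → ℝ} {v₀ : E3 → E3} (hΩ : IsOpen Ω)
    (H : IsSuitableWeakSolution Ω T v Dv p v₀) {x0 : E3} {t0 r : ℝ} (hB : Metric.ball x0 r ⊆ Ω) (hI : Ioo (t0 - r^2) t0 ⊆ Ioo 0 T) :
    ∃ K2, CH v p x0 t0 r K2 := by
  have hs : pcyl (x0, t0) r ⊆ Ω ×ˢ Ioo 0 T := prod_mono hB hI
  have mp := H.meas_p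
  have ip : IntegrableOn p (pcyl (x0, t0) r) := by
    refine Integrable.mono' ((integrable_const (1:ℝ)).add (H.p_l32.mono_set hs)) mp.aestronglyMeasurable (ae_of_all _ fun z => ?_)
    simp only [Pi.add_apply, Real.norm_eq_abs]
    have h0 := abs_nonneg (p z)
    rcases le_total |p z| 1 with h | h
    · have : 0 ≤ |p z| ^ (3/2:ℝ) := by positivity
      linarith
    · have : |p z| ^ (1:ℝ) ≤ |p z| ^ (3/2:ℝ) := Real.rpow_le_rpow_of_exponent_le h (by norm_num)
      rw [Real.rpow_one] at this
      linarith
  have hv := H.v_linf_l2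
  unfold MemMixed mixedNorm at hv
  rw [if_pos rfl] at hv
  set S := essSup (fun t => eLpNorm (fun x => v (x, t)) 2 (volume.restrict Ω)) (volume.restrict (Ioo 0 T)) with hS
  have hae : ∀ᵐ t ∂(volume.restrict (Ioo 0 T)), eLpNorm (fun x => v (x, t)) 2 (volume.restrict Ω) ≤ S := ENNReal.ae_le_essSup _
  refine ⟨S ^ 2, H.meas_v, mp, pow_ne_top hv.ne, ?_, ip, CB_of hΩ H hB hI ip, CD_of hΩ H hB hI⟩
  filter_upwards [ae_restrict_of_ae_restrict_of_subset hI hae] with t ht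
  rw [eLpNorm_eq_lintegral_rpow_enorm_toReal (by simp) (by simp)] at ht
  have := rpow_le_rpow ht (z := 2) (by norm_num)
  rw [← rpow_mul] at this
  norm_num at this
  exact (lintegral_mono_set hB).trans this
end
section
lemma frob_le (M : Fin 3 → Fin 3 → ℝ) (i j : Fin 3) : ‖M i j‖ₑ ≤ ‖frob M‖ₑ :=
  enorm_le_iff_norm_le.2 (PiLp.norm_apply_le (frob M) (i, j))
lemma grad_slice {Dv : ZT → Fin 3 → Fin 3 → ℝ} {x0 : E3} {t0 r ε : ℝ}
    (h : mixedNorm (fun z => frob (Dv z)) (Metric.ball x0 r) (t0 - r ^ 2) t0 (3 / 2 : ℝ≥0∞) ∞ ≤ ENNReal.ofReal ε) :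
    ∀ᵐ t ∂(volume.restrict (Ioo (t0 - r^2) t0)), ∀ j,
      (∑ i, ∫⁻ x in Metric.ball x0 r, ‖Dv (x, t) i j‖ₑ^(3/2:ℝ))^(2:ℝ) ≤ 9 * ENNReal.ofReal ε ^ (3:ℝ) := by
  unfold mixedNorm at h
  rw [if_pos rfl] at h
  have hae := ENNReal.ae_le_essSup (μ := volume.restrict (Ioo (t0 - r^2) t0))
    (fun t => eLpNorm (fun x => frob (Dv (x, t))) (3/2 : ℝ≥0∞) (volume.restrict (Metric.ball x0 r)))
  have e32 : (3/2 : ℝ≥0∞).toReal = 3/2 := by simp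
  filter_upwards [hae] with t ht j
  have h1 := ht.trans h
  rw [eLpNorm_eq_lintegral_rpow_enorm_toReal (by simp) (by simp [div_eq_top]), e32] at h1
  have h2 := rpow_le_rpow h1 (z := 3/2) (by norm_num)
  rw [← rpow_mul] at h2
  norm_num at h2
  have h3 : ∀ i, ∫⁻ x in Metric.ball x0 r, ‖Dv (x, t) i j‖ₑ^(3/2:ℝ) ≤ ENNReal.ofReal ε ^ (3/2:ℝ) := fun i =>
    (lintegral_mono fun x => rpow_le_rpow (frob_le _ i j) (by norm_num)).trans h2
  calc _ ≤ (∑ i : Fin 3, ENNReal.ofReal ε ^ (3/2:ℝ))^(2:ℝ) := rpow_le_rpow (Finset.sum_le_sum fun i _ => h3 i) (by norm_num)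
    _ = (3 * ENNReal.ofReal ε ^ (3/2:ℝ))^(2:ℝ) := by simp
    _ = _ := by
      rw [mul_rpow_of_nonneg _ _ (by norm_num), ← rpow_mul]; norm_num
lemma cube_bound {u : E3 → E3} (hu : Measurable u) {B : Set E3} {K : ℝ≥0∞} (h : ∀ j, ∫⁻ x in B, ‖u x j‖ₑ ^ (3:ℝ) ≤ K) :
    ∫⁻ x in B, ‖u x‖ₑ ^ (3:ℝ) ≤ 27 * K := by
  calc _ ≤ ∫⁻ x in B, 9 * ∑ j, ‖u x j‖ₑ ^ (3:ℝ) := by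
        refine lintegral_mono fun x => ?_
        calc _ ≤ (∑ j, ‖u x j‖ₑ) ^ (3:ℝ) := rpow_le_rpow (enorm_le_sum _) (by norm_num)
          _ ≤ _ := by
            have := inner_le_Lp_mul_Lq Finset.univ (fun _ : Fin 3 => (1:ℝ≥0∞)) (fun j => ‖u x j‖ₑ) (p := 3/2) (q := 3) ⟨by norm_num, by norm_num, by norm_num⟩
            simp only [one_mul, one_rpow] at this
            have h2 := rpow_le_rpow this (z := 3) (by norm_num)
            rw [mul_rpow_of_nonneg _ _ (by norm_num), ← rpow_mul, ← rpow_mul] at h2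
            rw [show (1/3*3:ℝ) = 1 by norm_num, show (1/(3/2)*3:ℝ) = 2 by norm_num, rpow_one] at h2
            refine h2.trans (le_of_eq ?_)
            congr 1
            simp; norm_num
    _ = 9 * ∑ j, ∫⁻ x in B, ‖u x j‖ₑ ^ (3:ℝ) := by
        rw [lintegral_const_mul _ (by fun_prop), lintegral_finsetSum _ fun j _ => by fun_prop]
    _ ≤ 9 * ∑ j : Fin 3, K := by gcongr; exact h _
    _ = _ := by simp; rw [← mul_assoc]; norm_num
lemma mor_bound {f : ZT → ℝ≥0∞} (hf : Measurable f) {K : ℝ≥0∞} (h : ∀ᵐ t : ℝ, ∫⁻ x, f (x, t) ^ (3:ℝ) ≤ K) (z : ZT) {ρ : ℝ} (hρ : 0 < ρ) :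
    ∫⁻ w in PB z ρ, f w ^ (3:ℝ) ≤ 2 * K * ENNReal.ofReal ρ ^ (2:ℝ) := by
  have hs : PB z ρ ⊆ (univ : Set E3) ×ˢ Ioo (z.2 - ρ^2) (z.2 + ρ^2) := by
    intro w hw
    have h1 : √|z.2 - w.2| < ρ := (le_max_right _ _).trans_lt hw
    rw [Real.sqrt_lt' hρ, abs_lt] at h1
    exact ⟨mem_univ _, by linarith, by linarith⟩
  calc _ ≤ ∫⁻ w in (univ : Set E3) ×ˢ Ioo (z.2 - ρ^2) (z.2 + ρ^2), f w ^ (3:ℝ) := lintegral_mono_set hs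
    _ = ∫⁻ t in Ioo (z.2 - ρ^2) (z.2 + ρ^2), ∫⁻ x, f (x, t) ^ (3:ℝ) := by
        rw [Measure.volume_eq_prod, ← Measure.prod_restrict, Measure.restrict_univ, lintegral_prod_symm _ (by fun_prop)]
    _ ≤ ∫⁻ t in Ioo (z.2 - ρ^2) (z.2 + ρ^2), K := lintegral_mono_ae (ae_restrict_of_ae h)
    _ = _ := by
        rw [lintegral_const, Measure.restrict_apply_univ, Real.volume_Ioo]
        have : z.2 + ρ^2 - (z.2 - ρ^2) = 2 * (ρ ^ 2) := by ring
        rw [this, ofReal_mul (by norm_num), ofReal_pow hρ.le, rpow_two]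
        simp only [ofReal_ofNat]
        ring
theorem final_thm :
    ∃ ε₁ : ℝ, 0 < ε₁ ∧
      ∀ (Ω : Set E3) (T : ℝ) (v : E3 × ℝ → E3) (Dv : E3 × ℝ → Fin 3 → Fin 3 → ℝ)
        (p : E3 × ℝ → ℝ) (v₀ : E3 → E3) (z₀ : E3 × ℝ) (r : ℝ),
        IsOpen Ω → 0 < T →
        IsSuitableWeakSolution Ω T v Dv p v₀ →
        z₀ ∈ Ω ×ˢ Ioo 0 T → 0 < r →
        closure (pcyl z₀ r) ⊆ Ω ×ˢ Ioo 0 T →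
        mixedNorm (fun z => frob (Dv z))
            (Metric.ball z₀.1 r) (z₀.2 - r ^ 2) z₀.2 (3 / 2 : ℝ≥0∞) ∞
          ≤ ENNReal.ofReal ε₁ →
        RegularPoint Ω T v z₀ := by
  obtain ⟨C, hC, hrep⟩ := rep
  obtain ⟨ε₀, hε₀, hmor⟩ := morrey_iter C hC
  obtain ⟨C3, hC3, hsl⟩ := slice3
  set ε' := min ε₀ 1 with hε'
  have p1 : ε' ≠ 0 := (lt_min hε₀ one_pos).ne'
  have p2 : ε' ≠ ∞ := ((min_le_right _ _).trans_lt one_lt_top).ne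
  have q1 : ε' ^ (3:ℝ) ≠ 0 := by simp [p1]
  have q2 : ε' ^ (3:ℝ) ≠ ∞ := by simp [p2]
  set E := ε' ^ (3:ℝ) / (54 * C3 + 1) with hE
  have q3 : 54 * C3 + 1 ≠ ∞ := add_ne_top.2 ⟨mul_ne_top (by simp) hC3, by simp⟩
  have q4 : 54 * C3 + 1 ≠ 0 := by simp
  have E0 : E ≠ 0 := ENNReal.div_ne_zero.2 ⟨q1, q3⟩
  have E1 : E ≠ ∞ := (div_lt_top q2 q4).ne
  have E2 : 54 * C3 * E ≤ ε' ^ (3:ℝ) := by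
    calc _ ≤ (54 * C3 + 1) * E := by gcongr; exact le_self_add
      _ = _ := ENNReal.mul_div_cancel q4 q3
  have E9 : E / 9 ≠ ∞ := (div_lt_top E1 (by simp)).ne
  have E90 : E / 9 ≠ 0 := ENNReal.div_ne_zero.2 ⟨E0, by simp⟩
  refine ⟨min (E/9).toReal 1, lt_min (toReal_pos E90 E9) one_pos, ?_⟩
  set ε₁ := min (E/9).toReal 1
  have E3' : 9 * ENNReal.ofReal ε₁ ^ (3:ℝ) ≤ E := by
    have h1 : ENNReal.ofReal ε₁ ≤ 1 := by
      rw [← ofReal_one]; exact ofReal_le_ofReal (min_le_right _ _)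
    have h2 : ENNReal.ofReal ε₁ ≤ E / 9 := by
      rw [← ofReal_toReal E9]; exact ofReal_le_ofReal (min_le_left _ _)
    have h3 : ENNReal.ofReal ε₁ ^ (3:ℝ) ≤ ENNReal.ofReal ε₁ ^ (1:ℝ) := rpow_le_rpow_of_exponent_ge h1 (by norm_num)
    rw [rpow_one] at h3
    calc _ ≤ 9 * (E / 9) := by gcongr; exact h3.trans h2
      _ = E := ENNReal.mul_div_cancel (by simp) (by simp)
  rintro Ω T v Dv p v₀ ⟨x0, t0⟩ r hΩ hT H hz hr hcl hgrad
  have hsub : pcyl (x0, t0) r ⊆ Ω ×ˢ Ioo 0 T := subset_closure.trans hcl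
  have r2 : 0 < r^2 := by positivity
  have hB : Metric.ball x0 r ⊆ Ω := fun x hx => (hsub (a := (x, t0 - r^2/2)) ⟨hx, by simp only; linarith, by simp only; linarith⟩).1
  have hI : Ioo (t0 - r^2) t0 ⊆ Ioo 0 T := fun t ht => (hsub (a := (x0, t)) ⟨Metric.mem_ball_self hr, ht⟩).2
  have L := LS_of hΩ H hB hI
  obtain ⟨K2, hCH⟩ := CH_of hΩ H hB hI
  obtain ⟨M, hM, hMz⟩ := hrep v p x0 t0 r K2 hCH hr
  obtain ⟨ρ, hρ, hρr, hslice⟩ := hsl r K2 E hr hCH.hK E0 E1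
  have mv := H.meas_v
  have hg := grad_slice hgrad
  have h3 : ∀ᵐ t ∂(volume.restrict (Ioo (t0 - r^2) t0)), ∫⁻ x in Metric.ball x0 ρ, ‖v (x, t)‖ₑ ^ (3:ℝ) ≤ 27 * (C3 * E) := by
    filter_upwards [hg, L.hs, hCH.vb] with t h1 h2 h4
    refine cube_bound (u := fun x => v (x, t)) (by fun_prop) fun j => ?_
    refine hslice x0 _ _ (h2.1 j) ((h1 j).trans E3') (le_trans (lintegral_mono fun x => ?_) h4)
    rw [rpow_two]
    gcongr
    exact enorm_le_iff_norm_le.2 (by rw [Real.norm_eq_abs]; exact abs_apply_le _ _)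
  set D : Set ZT := Metric.ball x0 ρ ×ˢ Ioo (t0 - r^2) t0 with hD
  have mD : MeasurableSet D := measurableSet_ball.prod measurableSet_Ioo
  set f : ZT → ℝ≥0∞ := D.indicator (fun z => ‖v z‖ₑ) with hf
  have mf : Measurable f := Measurable.indicator (by fun_prop) mD
  have h5 : ∀ᵐ t : ℝ, ∫⁻ x, f (x, t) ^ (3:ℝ) ≤ 27 * (C3 * E) := by
    filter_upwards [(ae_restrict_iff' measurableSet_Ioo).1 h3] with t ht
    by_cases htI : t ∈ Ioo (t0 - r^2) t0
    · refine le_trans (le_of_eq ?_) (ht htI)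
      rw [← lintegral_indicator measurableSet_ball]
      refine lintegral_congr fun x => ?_
      by_cases hx : x ∈ Metric.ball x0 ρ
      · rw [hf, indicator_of_mem hx, indicator_of_mem (show (x, t) ∈ D from ⟨hx, htI⟩)]
      · rw [hf, indicator_of_notMem hx, indicator_of_notMem (show (x, t) ∉ D from fun h => hx h.1)]; simp
    · have : ∀ x, f (x, t) = 0 := fun x => indicator_of_notMem (show (x, t) ∉ D from fun h => htI h.2) _
      simp [this]
  set a := min (ρ/2) (min (r/4) 1) with ha
  have a0 : 0 < a := by positivity
  have a1 : a ≤ 1 := (min_le_right _ _).trans (min_le_right _ _)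
  have aρ : a ≤ ρ / 2 := min_le_left _ _
  have ar : a ≤ r / 4 := (min_le_right _ _).trans (min_le_left _ _)
  set c := ENNReal.ofReal (ρ/2) ^ (-4:ℝ) with hc
  have c1 : c ≠ ∞ := by
    rw [hc, ne_eq, rpow_eq_top_iff]; simp [hρ]
  set M2 := M + C * (c * ∫⁻ w in pcyl (x0, t0) r, ‖v w‖ₑ ^ 2) with hM2
  have M2t : M2 ≠ ∞ := add_ne_top.2 ⟨hM, mul_ne_top hC (mul_ne_top c1 hCH.v2.ne)⟩
  have hpd : ∀ z w : ZT, pd z w = max ‖z.1 - w.1‖ (√|z.2 - w.2|) := fun z w => rfl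
  have hfin := hmor ε' (min_le_left _ _) f mf (fun z σ hσ => by
    refine (mor_bound mf h5 z hσ).trans ?_
    gcongr
    refine le_trans (le_of_eq ?_) E2
    rw [← mul_assoc, ← mul_assoc]; norm_num) (x0, t0) a M2 a0 a1 M2t (by
    filter_upwards [hMz] with z hz1 hz2
    by_cases hzD : z ∈ D
    swap
    · rw [hf, indicator_of_notMem hzD]; exact zero_le
    have hz2' : pd (x0, t0) z < a := hz2
    rw [hpd, max_lt_iff, Real.sqrt_lt' a0] at hz2'
    obtain ⟨b1, b2⟩ := hz2'
    have b3 : a^2 ≤ r^2/16 := by nlinarith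
    have b4 := (abs_lt.1 b2).2
    have hzx : ‖z.1 - x0‖ < a := by rw [norm_sub_rev]; exact b1
    have h6 := hz1 ⟨by rw [mem_ball_iff_norm]; linarith, by simp only at b4 ⊢; linarith, hzD.2.2⟩
    rw [hf, indicator_of_mem hzD]
    refine h6.trans ?_
    rw [hM2, add_assoc, ← mul_add]
    gcongr
    have h7 : ∫⁻ w in pcyl (x0, t0) r, pk 4 z w * ‖v w‖ₑ ^ 2 ≤ ∫⁻ w in pcyl (x0, t0) r, (c * ‖v w‖ₑ^2 + pk 4 z w * f w ^ (2:ℝ)) := by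
      refine setLIntegral_mono' (meas_pcyl _ _ _) fun w hw => ?_
      by_cases hwD : w ∈ D
      · rw [hf, indicator_of_mem hwD, rpow_two]; exact le_add_self
      · refine le_trans ?_ le_self_add
        gcongr
        have hwx : ρ ≤ ‖w.1 - x0‖ := by
          by_contra hn
          exact hwD ⟨by rw [mem_ball_iff_norm]; exact not_le.1 hn, hw.2⟩
        have h8 : ρ/2 ≤ pd z w := by
          refine le_trans ?_ (le_max_left _ _)
          have h9 : ‖w.1 - x0‖ ≤ ‖z.1 - w.1‖ + ‖z.1 - x0‖ := by
            rw [norm_sub_rev z.1 w.1]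
            calc _ = ‖(w.1 - z.1) + (z.1 - x0)‖ := by congr 1; abel
              _ ≤ _ := norm_add_le _ _
          linarith
        unfold pk
        rw [hc, rpow_neg, rpow_neg]
        gcongr
    refine h7.trans ?_
    rw [lintegral_add_left (by fun_prop), lintegral_const_mul _ (by fun_prop)]
    gcongr
    exact Measure.restrict_le_self)
  obtain ⟨M', hM', hfin⟩ := hfin
  have s1 : pcyl (x0, t0) (a/4) ⊆ PB (x0, t0) (a/4) := by
    intro w hw
    change pd (x0, t0) w < a/4
    rw [hpd]
    refine max_lt ?_ ?_
    · have := hw.1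
      rw [mem_ball_iff_norm'] at this; exact this
    · have h1 := hw.2.1
      have h2 := hw.2.2
      rw [Real.sqrt_lt' (by positivity), abs_lt]
      simp only at h1 h2 ⊢
      constructor <;> nlinarith
  have s2 : pcyl (x0, t0) (a/4) ⊆ D := by
    intro w hw
    refine ⟨Metric.ball_subset_ball (by linarith) hw.1, ?_, hw.2.2⟩
    have h1 := hw.2.1
    simp only at h1 ⊢
    nlinarith
  refine ⟨a/4, by positivity, fun w hw => hsub ⟨Metric.ball_subset_ball hρr (s2 hw).1, (s2 hw).2⟩, M'.toReal, ?_⟩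
  rw [ae_restrict_iff' (meas_pcyl _ _ _)]
  filter_upwards [hfin] with w hw hwp
  have := hw (s1 hwp)
  rw [hf, indicator_of_mem (s2 hwp)] at this
  rw [← toReal_enorm]
  exact toReal_mono hM' this
end
/-- **Corollary 2.1, first part**: there is an absolute constant `ε₁ > 0` such
that if `(v,p)` is a suitable weak solution of the Navier–Stokes equations in
`Q_T = Ω × (0,T)`, `z₀ ∈ Q_T`, the closure of `Q_{z₀,r}` is contained in
`Q_T`, and the weak spatial gradient satisfies
`‖∇v‖_{L^{3/2,∞}_{x,t}(Q_{z₀,r})} ≤ ε₁`, then `z₀` is a regular point of `v`.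
(The pointwise norm of `∇v` is the Frobenius norm, realized here by viewing
the gradient matrix as a Euclidean vector via `frob`.) -/
theorem gradient_small_L32_linfty_implies_regular :
    ∃ ε₁ : ℝ, 0 < ε₁ ∧
      ∀ (Ω : Set E3) (T : ℝ) (v : E3 × ℝ → E3) (Dv : E3 × ℝ → Fin 3 → Fin 3 → ℝ)
        (p : E3 × ℝ → ℝ) (v₀ : E3 → E3) (z₀ : E3 × ℝ) (r : ℝ),
        IsOpen Ω → 0 < T →
        IsSuitableWeakSolution Ω T v Dv p v₀ →
        z₀ ∈ Ω ×ˢ Ioo 0 T → 0 < r →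
        closure (pcyl z₀ r) ⊆ Ω ×ˢ Ioo 0 T →
        mixedNorm (fun z => frob (Dv z))
            (Metric.ball z₀.1 r) (z₀.2 - r ^ 2) z₀.2 (3 / 2 : ℝ≥0∞) ∞
          ≤ ENNReal.ofReal ε₁ →
        RegularPoint Ω T v z₀ := by
  exact final_thm

end
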